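/- Let T be a simple geodesic triangle in Y with vertices p, q, r. For all sufficiently small ε > 0, the limit segment R_q^ε of T at p extends to an X-geodesic [p,q']_X with q' ∈ [q,r]_Y and [p,q']_X ⊆ T ∪ Int T; similarly, the limit segment R_r^ε extends to an X-geodesic [p,r']_X with r' ∈ [q,r]_Y and [p,r']_X ⊆ T ∪ Int T. -/

import Mathlib

open Set Metric Filter

noncomputable section

namespace Cat2Cx

/-! ### Comparison angles -/

/-- Inverse hyperbolic cosine. -/
def arcosh (x : ℝ) : ℝ := Real.log (x + Real.sqrt (x ^ 2 - 1))

/-- The Euclidean comparison angle at the vertex of a (comparison) triangle whose adjacent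
sides have lengths `a`, `b` and whose opposite side has length `c`, via the law of cosines. -/
def euclCompAngle (a b c : ℝ) : ℝ :=
  Real.arccos ((a ^ 2 + b ^ 2 - c ^ 2) / (2 * a * b))

/-- The comparison angle in the model plane `M_κ²` of constant curvature `κ ≤ 0`, via the
(Euclidean or hyperbolic) law of cosines. -/
def compAngle (κ a b c : ℝ) : ℝ :=
  if κ = 0 then euclCompAngle a b c
  else
    Real.arccos
      ((Real.cosh (Real.sqrt (-κ) * a) * Real.cosh (Real.sqrt (-κ) * b) -
          Real.cosh (Real.sqrt (-κ) * c)) /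
        (Real.sinh (Real.sqrt (-κ) * a) * Real.sinh (Real.sqrt (-κ) * b)))

variable {Z : Type*}

/-! ### Geodesics with respect to a distance function -/

/-- `f` restricted to `[a,b]` is a unit-speed geodesic for the distance function `d`
(an isometric embedding of the compact interval `[a,b]`). -/
def IsGeodesicWrt (d : Z → Z → ℝ) (f : ℝ → Z) (a b : ℝ) : Prop :=
  a ≤ b ∧ ∀ s ∈ Icc a b, ∀ t ∈ Icc a b, d (f s) (f t) = |s - t|

/-- `f` is a unit-speed geodesic from `x` to `y` (for the distance function `d`),
staying inside `S`. -/
def IsGeodesicFromTo (d : Z → Z → ℝ) (S : Set Z) (f : ℝ → Z) (x y : Z) : Prop :=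
  f 0 = x ∧ f (d x y) = y ∧ IsGeodesicWrt d f 0 (d x y) ∧ MapsTo f (Icc 0 (d x y)) S

/-- `S`, with the distance function `d`, is a geodesic space. -/
def GeodesicSpaceWrt (d : Z → Z → ℝ) (S : Set Z) : Prop :=
  ∀ x ∈ S, ∀ y ∈ S, ∃ f, IsGeodesicFromTo d S f x y

/-- The geodesic segment `[x,y]`: the union of (the images of) all geodesics from `x` to `y`
inside `S`.  In a uniquely geodesic space this is the image of the unique geodesic. -/
def geodSeg (d : Z → Z → ℝ) (S : Set Z) (x y : Z) : Set Z :=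
  ⋃ f ∈ {f : ℝ → Z | IsGeodesicFromTo d S f x y}, f '' Icc 0 (d x y)

/-- `C ⊆ S` is geodesically convex with respect to `d`: every geodesic (in `S`) between two
points of `C` lies in `C`. -/
def ConvexWrtIn (d : Z → Z → ℝ) (S C : Set Z) : Prop :=
  ∀ x ∈ C, ∀ y ∈ C, geodSeg d S x y ⊆ C

/-- `C` is geodesically convex with respect to `d`. -/
abbrev ConvexWrt (d : Z → Z → ℝ) (C : Set Z) : Prop := ConvexWrtIn d univ C

/-- The geodesically convex hull of `A` with respect to `d`. -/
def convexHullWrt (d : Z → Z → ℝ) (A : Set Z) : Set Z :=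
  ⋂₀ {C | ConvexWrt d C ∧ A ⊆ C}

/-- The Alexandrov (upper) angle at `p` between two paths `σ`, `τ` issuing from `p`
(each parametrized so that `σ 0 = τ 0 = p`): the limit as `ε → 0⁺` (i.e. the infimum over
`ε > 0`) of the supremum over `0 < s, t < ε` of the Euclidean comparison angles. -/
def upperAngleWrt (d : Z → Z → ℝ) (p : Z) (σ τ : ℝ → Z) : ℝ :=
  sInf {a | ∃ ε > 0, a = sSup {b | ∃ s t : ℝ, 0 < s ∧ s < ε ∧ 0 < t ∧ t < ε ∧
      b = euclCompAngle (d p (σ s)) (d p (τ t)) (d (σ s) (τ t))}}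

/-- The CAT(κ) condition (for `κ ≤ 0`), in the angle-comparison form
(Bridson–Haefliger II.1.7(4)): `S` is geodesic and for every triple of distinct points the
Alexandrov angle between geodesics is at most the comparison angle in `M_κ²`. -/
def IsCATWrt (κ : ℝ) (d : Z → Z → ℝ) (S : Set Z) : Prop :=
  GeodesicSpaceWrt d S ∧
    ∀ p ∈ S, ∀ q ∈ S, ∀ r ∈ S, p ≠ q → p ≠ r → q ≠ r →
      ∀ σ τ : ℝ → Z, IsGeodesicFromTo d S σ p q → IsGeodesicFromTo d S τ p r →
        upperAngleWrt d p σ τ ≤ compAngle κ (d p q) (d p r) (d q r)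

/-- Completeness of `S` with respect to the distance function `d`:
every Cauchy sequence converges. -/
def CompleteWrt (d : Z → Z → ℝ) (S : Set Z) : Prop :=
  ∀ u : ℕ → Z, (∀ n, u n ∈ S) →
    (∀ ε > 0, ∃ N, ∀ m ≥ N, ∀ n ≥ N, d (u m) (u n) < ε) →
    ∃ x ∈ S, ∀ ε > 0, ∃ N, ∀ n ≥ N, d (u n) x < ε

variable {X : Type*} [MetricSpace X]

/-- `X` is a CAT(κ) metric space. -/
def IsCATSpace (κ : ℝ) (X : Type*) [MetricSpace X] : Prop :=
  IsCATWrt κ (fun x y : X => dist x y) univ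

/-- The distance function of the metric space `X`. -/
abbrev xDist (X : Type*) [MetricSpace X] : X → X → ℝ := fun x y => dist x y

/-! ### The model plane `M_κ²` and polyhedral 2-complexes -/

/-- The distance function of the model plane `M_κ²` of constant curvature `κ ≤ 0`, in global
coordinates `ℝ²`: the Euclidean distance for `κ = 0`, and for `κ < 0` the distance of the
hyperboloid model rescaled by `1/√(-κ)` (so that the curvature is `κ`). -/
def mDist (κ : ℝ) (u v : ℝ × ℝ) : ℝ :=
  if κ = 0 then Real.sqrt ((u.1 - v.1) ^ 2 + (u.2 - v.2) ^ 2)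
  else
    (1 / Real.sqrt (-κ)) *
      arcosh (Real.sqrt (1 + u.1 ^ 2 + u.2 ^ 2) * Real.sqrt (1 + v.1 ^ 2 + v.2 ^ 2) -
        u.1 * v.1 - u.2 * v.2)

/-- A convex polygonal 2-cell in `M_κ²`: the geodesically convex hull of a finite set of
points, with nonempty interior. -/
def IsPolygonalCell (κ : ℝ) (P : Set (ℝ × ℝ)) : Prop :=
  ∃ F : Finset (ℝ × ℝ), P = convexHullWrt (mDist κ) (F : Set (ℝ × ℝ)) ∧ (interior P).Nonempty

/-- The subset `S` of `X` embeds isometrically into the model plane `M_κ²`. -/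
def IsomEmbedsInModelPlane (κ : ℝ) (S : Set X) : Prop :=
  ∃ f : X → ℝ × ℝ, ∀ x ∈ S, ∀ y ∈ S, mDist κ (f x) (f y) = dist x y

/-- A locally finite `M_κ`-polyhedral 2-complex structure on the metric space `X`:
`X` is partitioned into open 2-cells (faces), open 1-cells (edges) and vertices; the closure of
each face is isometric to a compact convex polygon of the model plane `M_κ²` (so each face has
constant curvature `κ`), each edge is a geodesic arc, and the complex is locally finite. -/
structure PolyComplex2 (κ : ℝ) (X : Type*) [MetricSpace X] where
  faces : Set (Set X)
  edges : Set (Set X)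
  vertices : Set X
  faces_open : ∀ F ∈ faces, IsOpen F
  cover : ⋃₀ faces ∪ ⋃₀ edges ∪ vertices = univ
  cells_disjoint : ∀ c ∈ faces ∪ edges, ∀ c' ∈ faces ∪ edges, c ≠ c' → c ∩ c' = ∅
  cells_vertex_disjoint : ∀ c ∈ faces ∪ edges, c ∩ vertices = ∅
  face_chart : ∀ F ∈ faces, ∃ (f : X → ℝ × ℝ) (P : Set (ℝ × ℝ)),
    IsPolygonalCell κ P ∧ InjOn f (closure F) ∧ f '' closure F = P ∧ f '' F = interior P ∧
    ∀ x ∈ closure F, ∀ y ∈ closure F, mDist κ (f x) (f y) = dist x y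
  edge_geodesic : ∀ e ∈ edges, ∃ (f : ℝ → X) (L : ℝ), 0 < L ∧
    IsGeodesicWrt (fun x y : X => dist x y) f 0 L ∧ f '' Ioo 0 L = e
  edge_closure : ∀ e ∈ edges, closure e \ e ⊆ vertices
  face_closure : ∀ F ∈ faces, closure F \ F ⊆ ⋃₀ edges ∪ vertices
  locally_finite : ∀ x : X, ∃ ε > 0,
    {c | (c ∈ faces ∨ c ∈ edges) ∧ (c ∩ ball x ε).Nonempty}.Finite ∧
    (vertices ∩ ball x ε).Finite

/-! ### Simple closed curves, their interiors, and first homology -/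

/-- A simple closed curve in `X` (identified with its image). -/
structure SCC (X : Type*) [TopologicalSpace X] where
  toFun : ℝ → X
  contOn : ContinuousOn toFun (Icc 0 1)
  loop : toFun 0 = toFun 1
  inj : InjOn toFun (Ico 0 1)

/-- The image of a simple closed curve. -/
def SCC.img {X : Type*} [TopologicalSpace X] (γ : SCC X) : Set X := γ.toFun '' Icc 0 1

/-- The first singular homology class of a loop, via the Hurewicz isomorphism: the class of
the loop in the abelianization of the fundamental group (of its path component); the loop is
nullhomologous iff this class is trivial. -/
def loopClassH1 {B : Type*} [TopologicalSpace B] {x : B} (p : Path x x) :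
    Abelianization (FundamentalGroup B x) :=
  Abelianization.of (FundamentalGroup.fromPath (X := TopCat.of B) ⟦p⟧)

/-- The basepoint of a simple closed curve, regarded in a subspace `B` containing it. -/
def SCC.basePoint {X : Type*} [TopologicalSpace X] (γ : SCC X) (B : Set X)
    (h : γ.img ⊆ B) : B :=
  ⟨γ.toFun 0, h ⟨0, ⟨le_rfl, zero_le_one⟩, rfl⟩⟩

/-- The loop of a simple closed curve, as a `Path` in a subspace `B` containing it. -/
def SCC.pathIn {X : Type*} [TopologicalSpace X] (γ : SCC X) (B : Set X) (h : γ.img ⊆ B) :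
    Path (γ.basePoint B h) (γ.basePoint B h) where
  toFun t := ⟨γ.toFun t, h ⟨(t : ℝ), t.2, rfl⟩⟩
  continuous_toFun := by
    apply Continuous.subtype_mk
    exact γ.contOn.comp_continuous continuous_subtype_val fun t => t.2
  source' := by
    apply Subtype.ext
    rfl
  target' := by
    apply Subtype.ext
    exact γ.loop.symm

/-- The simple closed curve `γ` is nullhomologous in the subspace `B` of `X`:
its class in `H₁(B)` vanishes. -/
def SCC.NullhomologousIn {X : Type*} [TopologicalSpace X] (γ : SCC X) (B : Set X) : Prop :=
  ∀ h : γ.img ⊆ B, loopClassH1 (γ.pathIn B h) = 1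

/-- The interior of a simple closed curve `γ`:
`Int γ = {x ∈ X \ γ | [γ] ≠ 0 ∈ H₁(X \ {x})}`. -/
def SCC.interiorSet {X : Type*} [TopologicalSpace X] (γ : SCC X) : Set X :=
  {x | x ∉ γ.img ∧ ¬ γ.NullhomologousIn {x}ᶜ}

/-- The first singular homology of `B` vanishes: every loop in `B` is nullhomologous
(via the Hurewicz isomorphism on each path component). -/
def H1Trivial (B : Type*) [TopologicalSpace B] : Prop :=
  ∀ (x : B) (p : Path x x), loopClassH1 p = 1

/-! ### Rectifiable connectedness and the induced path metric -/

/-- `g` is a path from `x` to `y` (parametrized by `[0,1]`) inside `E`. -/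
def IsPathIn {X : Type*} [TopologicalSpace X] (E : Set X) (g : ℝ → X) (x y : X) : Prop :=
  ContinuousOn g (Icc 0 1) ∧ g 0 = x ∧ g 1 = y ∧ MapsTo g (Icc 0 1) E

/-- `E` is rectifiably connected: any two of its points are joined by a rectifiable
(finite length) path in `E`. -/
def RectConnected {X : Type*} [MetricSpace X] (E : Set X) : Prop :=
  ∀ x ∈ E, ∀ y ∈ E, ∃ g : ℝ → X, IsPathIn E g x y ∧ eVariationOn g (Icc 0 1) ≠ ⊤

/-- The induced path metric on `E`: the infimum of the lengths of rectifiable paths in `E`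
joining the two points. -/
def pathDistIn {X : Type*} [MetricSpace X] (E : Set X) (x y : X) : ℝ :=
  (⨅ g : {g : ℝ → X // IsPathIn E g x y}, eVariationOn g.1 (Icc 0 1)).toReal


universe u
/-! ### Conical neighborhoods -/


/-- The distance function of the `κ`-cone (κ ≤ 0) over a space with distance function `dL`:
a point is a pair (radius, link point), all points of radius `0` being identified (the cone
point); the distance is given by the law of cosines in curvature `κ`, with angle
`min π (dL ℓ ℓ')`. -/
def coneDist (κ : ℝ) {L : Type*} (dL : L → L → ℝ) (a b : ℝ × L) : ℝ :=
  if κ = 0 then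
    Real.sqrt (a.1 ^ 2 + b.1 ^ 2 - 2 * a.1 * b.1 * Real.cos (min Real.pi (dL a.2 b.2)))
  else
    (1 / Real.sqrt (-κ)) *
      arcosh (Real.cosh (Real.sqrt (-κ) * a.1) * Real.cosh (Real.sqrt (-κ) * b.1) -
        Real.sinh (Real.sqrt (-κ) * a.1) * Real.sinh (Real.sqrt (-κ) * b.1) *
          Real.cos (min Real.pi (dL a.2 b.2)))

/-- `V` is a conical neighborhood of `p` in `X`: an open neighborhood of `p` isometric to a
convex open subset of the `κ`-cone over a metric space (the link of `p`), the isometry taking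
`p` to the cone point. -/
def IsConicalNbhd (κ : ℝ) (p : X) (V : Set X) : Prop :=
  IsOpen V ∧ p ∈ V ∧
    ∃ (L : Type u) (dL : L → L → ℝ) (f : X → ℝ × L),
      (∀ a, dL a a = 0) ∧ (∀ a b, 0 ≤ dL a b) ∧ (∀ a b, dL a b = dL b a) ∧
      (∀ a b c, dL a c ≤ dL a b + dL b c) ∧
      (∀ x ∈ V, 0 ≤ (f x).1) ∧ (f p).1 = 0 ∧
      (∀ x ∈ V, ∀ y ∈ V, dist x y = coneDist κ dL (f x) (f y)) ∧
      (∀ x ∈ V, (f x).1 = 0 → x = p) ∧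
      ConvexWrtIn (coneDist κ dL) {w : ℝ × L | 0 ≤ w.1} (f '' V) ∧
      (∀ z ∈ f '' V, ∃ ε > 0, ∀ w : ℝ × L, 0 ≤ w.1 → coneDist κ dL z w < ε → w ∈ f '' V)

/-! ### Geodesics, triangles, and limit segments in `Y = (E, induced path metric)` -/

/-- The set `α` is (the image of) a geodesic arc of `Y = (E, pathDistIn E)`. -/
def IsYGeodesicArc (E : Set X) (α : Set X) : Prop :=
  ∃ (f : ℝ → X) (a b : ℝ), IsGeodesicWrt (pathDistIn E) f a b ∧
    MapsTo f (Icc a b) E ∧ f '' Icc a b = α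

/-- `T` is a geodesic triangle of `Y = (E, pathDistIn E)` with vertices `p`, `q`, `r`:
the union of the three `Y`-geodesics joining the vertices. -/
def IsYTriangle (E : Set X) (T : Set X) (p q r : X) : Prop :=
  p ∈ E ∧ q ∈ E ∧ r ∈ E ∧
    T = geodSeg (pathDistIn E) E p q ∪ geodSeg (pathDistIn E) E q r ∪
        geodSeg (pathDistIn E) E r p

/-- The set `γim` (a curve in `E`) is locally geodesic in `Y` at `p`: some subarc of `γim`
containing `p` in its relative interior is a geodesic of `Y`. -/
def LocallyYGeodesicAt (E γim : Set X) (p : X) : Prop :=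
  ∃ (f : ℝ → X) (a b t : ℝ), t ∈ Ioo a b ∧ f t = p ∧
    IsGeodesicWrt (pathDistIn E) f a b ∧ MapsTo f (Icc a b) E ∧ f '' Icc a b ⊆ γim

/-- `f : [0,1] → E` is the constant-speed parametrization of the `Y`-geodesic
from `x` to `y`. -/
def IsConstSpeedYGeodesic (E : Set X) (f : ℝ → X) (x y : X) : Prop :=
  f 0 = x ∧ f 1 = y ∧ MapsTo f (Icc 0 1) E ∧
    ∀ s ∈ Icc (0:ℝ) 1, ∀ t ∈ Icc (0:ℝ) 1,
      pathDistIn E (f s) (f t) = pathDistIn E x y * |s - t|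

/-- `R` is the limit segment of length `ε` at `p` of the `Y`-geodesic side from `p` to `q`:
`R` is an `X`-geodesic of length `ε` issuing from `p`, and the `X`-geodesics of length `ε`
from `p` through `σ t` (σ the `Y`-geodesic from `p` to `q`) converge uniformly to `R`
as `t → 0⁺`. -/
def IsLimitSegment (E : Set X) (p q : X) (ε : ℝ) (R : ℝ → X) : Prop :=
  0 < ε ∧ R 0 = p ∧ IsGeodesicWrt (fun x y : X => dist x y) R 0 ε ∧
    ∀ σ : ℝ → X, IsGeodesicFromTo (pathDistIn E) E σ p q →
      ∀ δ > 0, ∃ t₀ > 0, ∀ t, 0 < t → t ≤ t₀ → t ≤ pathDistIn E p q →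
        ∀ g : ℝ → X, IsGeodesicWrt (fun x y : X => dist x y) g 0 ε → g 0 = p →
          g (dist p (σ t)) = σ t → ∀ s ∈ Icc 0 ε, dist (g s) (R s) ≤ δ


end Cat2Cx

end

noncomputable section

namespace Cat2Cx

/-! ### CAT(0) geometry -/

section CAT0
variable {X : Type*} [MetricSpace X]

/-- `z` lies metrically between `x` and `y`. -/
def Btw (x z y : X) : Prop := dist x z + dist z y = dist x y

/-- The set of points metrically between `x` and `y`. -/
def seg (x y : X) : Set X := {z | Btw x z y}

/-- Geodesic spaces satisfying Stewart's inequality. -/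
class CAT0Space (X : Type*) [MetricSpace X] : Prop where
  exists_pt : ∀ x y : X, ∀ t ∈ Icc (0:ℝ) 1,
    ∃ z, dist x z = t * dist x y ∧ dist z y = (1 - t) * dist x y
  stewart : ∀ o x y z : X, ∀ t ∈ Icc (0:ℝ) 1, dist x z = t * dist x y →
    dist z y = (1 - t) * dist x y →
    dist o z ^ 2 ≤ (1 - t) * dist o x ^ 2 + t * dist o y ^ 2 - t * (1 - t) * dist x y ^ 2

theorem Btw.symm {x z y : X} (h : Btw x z y) : Btw y z x := by
  unfold Btw at *
  rw [dist_comm y z, dist_comm z x, dist_comm y x]; linarith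

theorem btw_left (x y : X) : Btw x x y := by simp [Btw]

theorem btw_right (x y : X) : Btw x y y := by simp [Btw]

theorem Btw.dist_le_left {x z y : X} (h : Btw x z y) : dist x z ≤ dist x y := by
  unfold Btw at h; linarith [dist_nonneg (x := z) (y := y)]

theorem Btw.trans_left {x u z y : X} (h : Btw x z y) (hu : Btw x u z) : Btw x u y := by
  unfold Btw at *
  linarith [dist_triangle u z y, dist_triangle x u y]

theorem Btw.trans_left' {x u z y : X} (h : Btw x z y) (hu : Btw x u z) : Btw u z y := by
  unfold Btw at *
  linarith [dist_triangle u z y, dist_triangle x u y]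

theorem Btw.trans_right {x u z y : X} (h : Btw x z y) (hu : Btw z u y) : Btw x u y :=
  (h.symm.trans_left hu.symm).symm

theorem Btw.trans_right' {x u z y : X} (h : Btw x z y) (hu : Btw z u y) : Btw x z u :=
  (h.symm.trans_left' hu.symm).symm

theorem Btw.eq_of_self {x z : X} (h : Btw x z x) : z = x := by
  unfold Btw at h
  have := dist_nonneg (x := x) (y := z)
  rw [dist_comm z x, dist_self] at h
  exact (dist_le_zero.1 (by linarith)).symm

theorem seg_comm (x y : X) : seg x y = seg y x :=
  Set.ext fun _ => ⟨Btw.symm, Btw.symm⟩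

theorem isClosed_seg (x y : X) : IsClosed (seg x y) :=
  isClosed_eq (by fun_prop) (by fun_prop)

theorem isClosed_btw : IsClosed {v : X × X × X | Btw v.1 v.2.1 v.2.2} :=
  isClosed_eq (by fun_prop) (by fun_prop)

theorem Btw.of_tendsto {ι : Type*} {l : Filter ι} [l.NeBot] {a b c : ι → X} {x z y : X}
    (ha : Tendsto a l (nhds x)) (hb : Tendsto b l (nhds z)) (hc : Tendsto c l (nhds y))
    (h : ∀ᶠ i in l, Btw (a i) (b i) (c i)) : Btw x z y :=
  isClosed_btw.mem_of_tendsto (ha.prodMk_nhds (hb.prodMk_nhds hc)) h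

theorem Btw.frac {x z y : X} (h : Btw x z y) : ∃ t ∈ Icc (0:ℝ) 1,
    dist x z = t * dist x y ∧ dist z y = (1 - t) * dist x y := by
  rcases eq_or_ne x y with rfl | hxy
  · obtain rfl := h.eq_of_self
    exact ⟨0, by simp, by simp, by simp⟩
  · have hd : 0 < dist x y := dist_pos.2 hxy
    have := h.dist_le_left
    refine ⟨dist x z / dist x y, ⟨by positivity, (div_le_one hd).2 this⟩, ?_, ?_⟩
    · field_simp
    · unfold Btw at h
      field_simp; linarith

theorem btw_of_frac {x z y : X} {t : ℝ} (h1 : dist x z = t * dist x y)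
    (h2 : dist z y = (1 - t) * dist x y) : Btw x z y := by
  unfold Btw; rw [h1, h2]; ring

variable [CAT0Space X]

theorem Btw.unique {x z z' y : X} (h : Btw x z y) (h' : Btw x z' y) (he : dist x z = dist x z') :
    z = z' := by
  obtain ⟨t, ht, h1, h2⟩ := h.frac
  have := CAT0Space.stewart z' x y z t ht h1 h2
  have e1 : dist z' x = t * dist x y := by rw [dist_comm, ← he, h1]
  have e2 : dist z' y = (1 - t) * dist x y := by
    unfold Btw at h'; linarith
  rw [e1, e2] at this
  have h3 : dist z' z ^ 2 ≤ 0 := by nlinarith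
  have h4 : dist z' z = 0 := by nlinarith [dist_nonneg (x := z') (y := z)]
  exact (dist_eq_zero.1 h4).symm

/-- The point dividing the geodesic from `x` to `y` in the ratio `t : 1 - t`
(with `t` clamped to `[0,1]`). -/
def pt (x y : X) (t : ℝ) : X :=
  (CAT0Space.exists_pt x y (projIcc 0 1 zero_le_one t) (projIcc 0 1 zero_le_one t).2).choose

theorem dist_pt_clamp (x y : X) (t : ℝ) :
    dist x (pt x y t) = (projIcc (0:ℝ) 1 zero_le_one t) * dist x y ∧
    dist (pt x y t) y = (1 - projIcc (0:ℝ) 1 zero_le_one t) * dist x y :=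
  (CAT0Space.exists_pt x y (projIcc 0 1 zero_le_one t) (projIcc 0 1 zero_le_one t).2).choose_spec

theorem btw_pt (x y : X) (t : ℝ) : Btw x (pt x y t) y :=
  btw_of_frac (dist_pt_clamp x y t).1 (dist_pt_clamp x y t).2

theorem dist_pt {t : ℝ} (ht : t ∈ Icc (0:ℝ) 1) (x y : X) : dist x (pt x y t) = t * dist x y := by
  have := (dist_pt_clamp x y t).1
  rwa [projIcc_of_mem _ ht] at this

theorem dist_pt' {t : ℝ} (ht : t ∈ Icc (0:ℝ) 1) (x y : X) :
    dist (pt x y t) y = (1 - t) * dist x y := by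
  have := (dist_pt_clamp x y t).2
  rwa [projIcc_of_mem _ ht] at this

theorem Btw.eq_pt {x z y : X} {t : ℝ} (ht : t ∈ Icc (0:ℝ) 1) (h : Btw x z y)
    (hd : dist x z = t * dist x y) : z = pt x y t :=
  h.unique (btw_pt x y t) (hd.trans (dist_pt ht x y).symm)

theorem pt_zero (x y : X) : pt x y 0 = x :=
  ((btw_left x y).eq_pt (by simp) (by simp)).symm

theorem pt_one (x y : X) : pt x y 1 = y :=
  ((btw_right x y).eq_pt (by simp) (by simp)).symm

theorem pt_symm {t : ℝ} (ht : t ∈ Icc (0:ℝ) 1) (x y : X) : pt x y t = pt y x (1 - t) := by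
  refine (btw_pt x y t).symm.eq_pt ⟨by linarith [ht.2], by linarith [ht.1]⟩ ?_
  rw [dist_comm, dist_pt' ht, dist_comm x y]

theorem pt_clamp (x y : X) (t : ℝ) : pt x y t = pt x y (projIcc (0:ℝ) 1 zero_le_one t) := by
  refine (btw_pt x y t).eq_pt (projIcc (0:ℝ) 1 zero_le_one t).2 (dist_pt_clamp x y t).1

theorem seg_eq_image (x y : X) : seg x y = pt x y '' Icc 0 1 := by
  ext z; constructor
  · intro h
    obtain ⟨t, ht, h1, -⟩ := Btw.frac h
    exact ⟨t, ht, (Btw.eq_pt ht h h1).symm⟩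
  · rintro ⟨t, -, rfl⟩; exact btw_pt x y t

theorem dist_pt_pt_le {t : ℝ} (ht : t ∈ Icc (0:ℝ) 1) (o x y : X) :
    dist (pt o x t) (pt o y t) ≤ t * dist x y := by
  have h1 := CAT0Space.stewart (pt o y t) o x (pt o x t) t ht (dist_pt ht o x) (dist_pt' ht o x)
  have h2 := CAT0Space.stewart x o y (pt o y t) t ht (dist_pt ht o y) (dist_pt' ht o y)
  rw [dist_comm (pt o y t) o, dist_pt ht o y, dist_comm (pt o y t) (pt o x t)] at h1
  rw [dist_comm x o, dist_comm x (pt o y t)] at h2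
  have h3 := mul_le_mul_of_nonneg_left h2 ht.1
  have : dist (pt o x t) (pt o y t) ^ 2 ≤ (t * dist x y) ^ 2 := by nlinarith
  exact le_of_abs_le (abs_le_of_sq_le_sq this (mul_nonneg ht.1 dist_nonneg))

theorem dist_pt_pt_le' {t : ℝ} (ht : t ∈ Icc (0:ℝ) 1) (o x y : X) :
    dist (pt x o t) (pt y o t) ≤ (1 - t) * dist x y := by
  rw [pt_symm ht, pt_symm ht]
  exact dist_pt_pt_le ⟨by linarith [ht.2], by linarith [ht.1]⟩ o x y

theorem Btw.of_dist_le {x y u v : X} (hu : Btw x u y) (hv : Btw x v y)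
    (h : dist x u ≤ dist x v) : Btw x u v := by
  rcases eq_or_ne x v with rfl | hne
  · rw [dist_self] at h
    obtain rfl := dist_le_zero.1 h
    exact btw_left _ _
  · have hd : 0 < dist x v := dist_pos.2 hne
    have ht : dist x u / dist x v ∈ Icc (0:ℝ) 1 := ⟨by positivity, (div_le_one hd).2 h⟩
    have := btw_pt x v (dist x u / dist x v)
    have h2 := hv.trans_left this
    have : u = pt x v (dist x u / dist x v) := hu.unique h2 (by rw [dist_pt ht]; field_simp)
    rw [this]; exact btw_pt _ _ _

theorem dist_pt_pt {s t : ℝ} (hs : s ∈ Icc (0:ℝ) 1) (ht : t ∈ Icc (0:ℝ) 1) (x y : X) :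
    dist (pt x y s) (pt x y t) = |s - t| * dist x y := by
  wlog hst : s ≤ t generalizing s t
  · rw [dist_comm, abs_sub_comm]; exact this ht hs (le_of_not_ge hst)
  have h := (btw_pt x y s).of_dist_le (btw_pt x y t) (by
    rw [dist_pt hs, dist_pt ht]; exact mul_le_mul_of_nonneg_right hst dist_nonneg)
  unfold Btw at h
  rw [dist_pt hs, dist_pt ht] at h
  rw [abs_of_nonpos (by linarith)]; linarith

theorem continuous_pt : Continuous fun v : X × X × ℝ => pt v.1 v.2.1 v.2.2 := by
  rw [continuous_iff_continuousAt]
  rintro ⟨x, y, t⟩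
  have key : ∀ v : X × X × ℝ, dist (pt v.1 v.2.1 v.2.2) (pt x y t) ≤
      dist v.1 x + dist v.2.1 y +
        |(projIcc (0:ℝ) 1 zero_le_one v.2.2 : ℝ) - projIcc (0:ℝ) 1 zero_le_one t| * dist x y := by
    rintro ⟨x', y', t'⟩
    dsimp only
    rw [pt_clamp x' y' t', pt_clamp x y t]
    set s := projIcc (0:ℝ) 1 zero_le_one t'
    set r := projIcc (0:ℝ) 1 zero_le_one t
    have a1 := dist_pt_pt_le' s.2 y' x' x
    have a2 := dist_pt_pt_le s.2 x y' y
    have a3 := dist_pt_pt s.2 r.2 x y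
    have a4 : (1 - (s:ℝ)) * dist x' x ≤ dist x' x := by
      nlinarith [s.2.1, dist_nonneg (x := x') (y := x)]
    have a5 : (s:ℝ) * dist y' y ≤ dist y' y := by
      nlinarith [s.2.2, dist_nonneg (x := y') (y := y)]
    linarith [dist_triangle (pt x' y' s) (pt x y' s) (pt x y r),
      dist_triangle (pt x y' s) (pt x y s) (pt x y r)]
  refine tendsto_iff_dist_tendsto_zero.2 (squeeze_zero (fun _ => dist_nonneg) key ?_)
  have hc : Continuous fun v : X × X × ℝ => dist v.1 x + dist v.2.1 y +
        |(projIcc (0:ℝ) 1 zero_le_one v.2.2 : ℝ) - projIcc (0:ℝ) 1 zero_le_one t| * dist x y := by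
    have : Continuous fun v : X × X × ℝ => (projIcc (0:ℝ) 1 zero_le_one v.2.2 : ℝ) :=
      continuous_subtype_val.comp (continuous_projIcc.comp (by fun_prop))
    fun_prop
  have := hc.tendsto (x, y, t)
  simpa using this

theorem continuous_pt_right (x y : X) : Continuous (pt x y) :=
  continuous_pt.comp (by fun_prop : Continuous fun t : ℝ => (x, y, t))

theorem isCompact_seg (x y : X) : IsCompact (seg x y) := by
  rw [seg_eq_image]
  exact isCompact_Icc.image (continuous_pt_right x y)

theorem dist_convex {o x y z : X} {t : ℝ} (ht : t ∈ Icc (0:ℝ) 1) (h1 : dist x z = t * dist x y)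
    (h2 : dist z y = (1 - t) * dist x y) :
    dist o z ≤ (1 - t) * dist o x + t * dist o y := by
  have h := CAT0Space.stewart o x y z t ht h1 h2
  have h3 : (dist o x - dist o y) ^ 2 ≤ dist x y ^ 2 := by
    have := abs_dist_sub_le x y o
    rw [dist_comm x o, dist_comm y o] at this
    exact sq_le_sq' (by linarith [(abs_le.1 this).1]) (abs_le.1 this).2
  have h4 : 0 ≤ t * (1 - t) := mul_nonneg ht.1 (by linarith [ht.2])
  have h5 := mul_le_mul_of_nonneg_left h3 h4
  have : dist o z ^ 2 ≤ ((1 - t) * dist o x + t * dist o y) ^ 2 := by nlinarith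
  exact le_of_abs_le (abs_le_of_sq_le_sq this (add_nonneg
    (mul_nonneg (by linarith [ht.2]) dist_nonneg) (mul_nonneg ht.1 dist_nonneg)))

theorem dist_le_max_of_btw {o x y z : X} (h : Btw x z y) :
    dist o z ≤ max (dist o x) (dist o y) := by
  obtain ⟨t, ht, h1, h2⟩ := h.frac
  have := dist_convex (o := o) ht h1 h2
  have a := mul_le_mul_of_nonneg_left (le_max_left (dist o x) (dist o y))
    (show 0 ≤ 1 - t by linarith [ht.2])
  have b := mul_le_mul_of_nonneg_left (le_max_right (dist o x) (dist o y)) ht.1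
  linarith

theorem Btw.mem_ball {o x y z : X} {r : ℝ} (h : Btw x z y) (hx : x ∈ ball o r)
    (hy : y ∈ ball o r) : z ∈ ball o r := by
  rw [mem_ball'] at *
  exact (dist_le_max_of_btw h).trans_lt (max_lt hx hy)

/-- Local geodesics are geodesics: concatenation of overlapping geodesics. -/
theorem Btw.concat {w x y v : X} (h1 : Btw w x y) (h2 : Btw x y v) (hne : x ≠ y) :
    Btw w y v ∧ Btw w x v := by
  obtain ⟨t, ht, e1, e2⟩ := h2.frac
  have h := dist_convex (o := w) ht e1 e2
  have hp : 0 < dist x y := dist_pos.2 hne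
  have htp : 0 < t := by
    rcases ht.1.lt_or_eq with h | h
    · exact h
    · rw [← h] at e1; linarith
  unfold Btw at h1 h2
  have : dist w x + dist x v ≤ dist w v := by
    have : t * (dist w x + dist x v) ≤ t * dist w v := by nlinarith
    exact le_of_mul_le_mul_left this htp
  have h3 : Btw w x v := le_antisymm this (dist_triangle _ _ _)
  exact ⟨h3.trans_right h2, h3⟩

/-- The point of the geodesic from `y` to `x` at distance `η` from `y`. -/
def rad (y : X) (η : ℝ) (x : X) : X := pt y x (η / dist y x)

theorem btw_rad (y : X) (η : ℝ) (x : X) : Btw y (rad y η x) x := btw_pt _ _ _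

theorem dist_rad {y : X} {η : ℝ} {x : X} (h0 : 0 ≤ η) (h : η ≤ dist y x) :
    dist y (rad y η x) = η := by
  unfold rad
  rcases (dist_nonneg (x := y) (y := x)).lt_or_eq with hp | hp
  · rw [dist_pt ⟨by positivity, (div_le_one hp).2 h⟩]
    field_simp
  · rw [dist_eq_zero.1 hp.symm]
    have : η = 0 := by linarith
    simp [this, pt_zero]

theorem Btw.eq_rad {y z x : X} (h : Btw y z x) : z = rad y (dist y z) x :=
  h.unique (btw_rad _ _ _) (dist_rad dist_nonneg h.dist_le_left).symm

theorem rad_dist (y x : X) : rad y (dist y x) x = x := ((btw_right y x).eq_rad).symm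

theorem continuousOn_rad (y : X) : ContinuousOn (fun v : ℝ × X => rad y v.1 v.2)
    {v | v.2 ≠ y} := by
  unfold rad
  refine continuous_pt.comp_continuousOn (f := fun v : ℝ × X => (y, v.2, v.1 / dist y v.2)) ?_
  refine continuousOn_const.prodMk (continuousOn_snd.prodMk (continuousOn_fst.div ?_ ?_))
  · exact (by fun_prop : Continuous fun v : ℝ × X => dist y v.2).continuousOn
  · intro v hv
    exact dist_ne_zero.2 (Ne.symm hv)

end CAT0

end Cat2Cx

end

noncomputable section

namespace Cat2Cx

/-! ### Continuous logarithms of circle-valued functions -/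

section Logs
variable {X Y : Type*} [TopologicalSpace X] [TopologicalSpace Y]

/-- `θ` has a continuous logarithm on `A`. -/
def HasLog (θ : X → Circle) (A : Set X) : Prop :=
  ∃ l : X → ℝ, ContinuousOn l A ∧ ∀ x ∈ A, θ x = Circle.exp (l x)

/-- Every continuous circle-valued function on `A` has a continuous logarithm. -/
def AllLog (A : Set X) : Prop := ∀ θ : X → Circle, ContinuousOn θ A → HasLog θ A

theorem HasLog.mono {θ : X → Circle} {A B : Set X} (h : HasLog θ B) (hAB : A ⊆ B) :
    HasLog θ A := by
  obtain ⟨l, hl, h⟩ := h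
  exact ⟨l, hl.mono hAB, fun x hx => h x (hAB hx)⟩

theorem HasLog.congr {θ φ : X → Circle} {A : Set X} (h : HasLog θ A) (he : EqOn φ θ A) :
    HasLog φ A := by
  obtain ⟨l, hl, h⟩ := h
  exact ⟨l, hl, fun x hx => (he hx).trans (h x hx)⟩

theorem HasLog.comp {θ : Y → Circle} {f : X → Y} {A : Set X} {B : Set Y} (h : HasLog θ B)
    (hf : ContinuousOn f A) (hm : MapsTo f A B) : HasLog (θ ∘ f) A := by
  obtain ⟨l, hl, h⟩ := h
  exact ⟨l ∘ f, hl.comp hf hm, fun x hx => h _ (hm hx)⟩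

/-- Two logarithms of the same function differ by a constant on preconnected sets. -/
theorem log_sub_const {A : Set X} (hA : IsPreconnected A) {l l' : X → ℝ} (hl : ContinuousOn l A)
    (hl' : ContinuousOn l' A) (h : ∀ x ∈ A, Circle.exp (l x) = Circle.exp (l' x))
    {x y : X} (hx : x ∈ A) (hy : y ∈ A) : l x - l' x = l y - l' y := by
  have h1 : ∀ x ∈ A, ∃ m : ℤ, (l x - l' x) / (2 * Real.pi) = m := by
    intro x hx
    obtain ⟨m, hm⟩ := Circle.exp_eq_exp.1 (h x hx)
    refine ⟨m, ?_⟩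
    rw [hm]; field_simp; ring
  choose! n hn using h1
  have hc : ContinuousOn n A := by
    rw [Int.isClosedEmbedding_coe_real.isInducing.continuousOn_iff]
    exact ((hl.sub hl').div_const _).congr fun x hx => (hn x hx).symm
  have := hA.constant hc hx hy
  have e1 := hn x hx
  have e2 := hn y hy
  rw [this, ← e2] at e1
  have hpi : (2 * Real.pi) ≠ 0 := by positivity
  field_simp at e1
  exact e1

open Classical in
theorem HasLog.union {θ : X → Circle} {A B : Set X} (hA : HasLog θ A) (hB : HasLog θ B)
    (cA : IsClosed A) (cB : IsClosed B) (hp : IsPreconnected (A ∩ B)) : HasLog θ (A ∪ B) := by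
  obtain ⟨l, hl, h⟩ := hA
  obtain ⟨m, hm, h'⟩ := hB
  obtain ⟨k, hk⟩ : ∃ k : ℝ, Circle.exp k = 1 ∧ ∀ x ∈ A ∩ B, l x = m x + k := by
    rcases (A ∩ B).eq_empty_or_nonempty with he | ⟨y, hy⟩
    · exact ⟨0, by simp, by simp [he]⟩
    · have heq : ∀ x ∈ A ∩ B, Circle.exp (l x) = Circle.exp (m x) := fun x hx => by
        rw [← h x hx.1, ← h' x hx.2]
      refine ⟨l y - m y, by rw [Circle.exp_sub, heq y hy, div_self'], fun x hx => ?_⟩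
      have := log_sub_const hp (hl.mono inter_subset_left) (hm.mono inter_subset_right) heq hx hy
      linarith
  refine ⟨fun x => if x ∈ A then l x else m x + k, ?_, ?_⟩
  · refine ContinuousOn.union_of_isClosed (hl.congr fun x hx => by simp [hx])
      ((hm.add (continuousOn_const (c := k))).congr fun x hx => ?_) cA cB
    by_cases hxA : x ∈ A
    · simp only [hxA, if_true]; exact hk.2 x ⟨hxA, hx⟩
    · simp [hxA]
  · intro x hx
    by_cases hxA : x ∈ A
    · simp only [hxA, if_true]; exact h x hxA
    · simp only [hxA, if_false]
      rw [Circle.exp_add, hk.1, mul_one, h' x (hx.resolve_left hxA)]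

theorem mem_slitPlane_of_ne {z : Circle} (h : z ≠ -1) : (z : ℂ) ∈ Complex.slitPlane := by
  rw [Complex.mem_slitPlane_iff_not_le_zero]
  intro hz
  obtain ⟨h1, h2⟩ := Complex.le_def.1 hz
  apply h
  have hn := Circle.normSq_coe z
  rw [Complex.normSq_apply] at hn
  simp only [Complex.zero_re, Complex.zero_im] at h1 h2
  have : (z : ℂ).re = -1 := by nlinarith
  ext
  apply Complex.ext <;> simp [this, h2]

theorem hasLog_of_ne {θ : X → Circle} {A : Set X} (hθ : ContinuousOn θ A) (c : Circle)
    (h : ∀ x ∈ A, θ x ≠ -c) : HasLog θ A := by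
  refine ⟨fun x => Complex.arg ((θ x / c : Circle) : ℂ) + Complex.arg (c : ℂ), ?_, ?_⟩
  · refine ContinuousOn.add ?_ continuousOn_const
    intro x hx
    have hs : ((θ x / c : Circle) : ℂ) ∈ Complex.slitPlane := by
      apply mem_slitPlane_of_ne
      intro he
      apply h x hx
      rw [div_eq_iff_eq_mul] at he
      simpa using he
    refine (Complex.continuousAt_arg hs).comp_continuousWithinAt
      (f := fun x => ((θ x / c : Circle) : ℂ)) ?_
    exact continuous_subtype_val.continuousAt.comp_continuousWithinAt
      ((hθ.div' continuousOn_const) x hx)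
  · intro x hx
    rw [Circle.exp_add, Circle.exp_arg, Circle.exp_arg, div_mul_cancel]

/-- Continuity descends along continuous surjections from compact sets. -/
theorem continuousOn_image_of_comp {Z : Type*} [TopologicalSpace Z] [T2Space Y] {K : Set X}
    (hK : IsCompact K) {f : X → Y} (hf : ContinuousOn f K) {g : Y → Z}
    (hg : ContinuousOn (g ∘ f) K) : ContinuousOn g (f '' K) := by
  rw [continuousOn_iff_isClosed]
  intro t ht
  obtain ⟨u, hu, he⟩ := continuousOn_iff_isClosed.1 hg t ht
  refine ⟨f '' (K ∩ u), ((hK.inter_right hu).image_of_continuousOn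
    (hf.mono inter_subset_left)).isClosed, ?_⟩
  ext y
  constructor
  · rintro ⟨hy, x, hx, rfl⟩
    have : x ∈ u ∩ K := he ▸ ⟨hy, hx⟩
    exact ⟨⟨x, this.symm, rfl⟩, x, hx, rfl⟩
  · rintro ⟨⟨x, hx, rfl⟩, -⟩
    have : x ∈ g ∘ f ⁻¹' t ∩ K := he.symm ▸ hx.symm
    exact ⟨this.1, x, hx.1, rfl⟩

theorem AllLog.of_injOn [T2Space Y] {A : Set X} (hA : IsCompact A) {f : X → Y}
    (hf : ContinuousOn f A) (hi : InjOn f A) (h : AllLog (f '' A)) : AllLog A := by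
  intro θ hθ
  rcases A.eq_empty_or_nonempty with rfl | ⟨x0, -⟩
  · exact ⟨fun _ => 0, continuousOn_empty _, by simp⟩
  have : Nonempty X := ⟨x0⟩
  have hl := h (θ ∘ Function.invFunOn f A) (continuousOn_image_of_comp hA hf
    (hθ.congr fun x hx => by
      simp only [Function.comp_apply]
      rw [hi.leftInvOn_invFunOn hx]))
  exact (hl.comp hf (mapsTo_image f A)).congr fun x hx => by
    simp only [Function.comp_apply]
    rw [hi.leftInvOn_invFunOn hx]

theorem allLog_real {K : Set ℝ} (hK : IsCompact K) : AllLog K := by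
  intro θ hθ
  obtain ⟨δ, hδ, hu⟩ := Metric.uniformContinuousOn_iff.1
    (hK.uniformContinuousOn_of_continuous hθ) 1 one_pos
  obtain ⟨a, b, hab⟩ : ∃ a b : ℝ, K ⊆ Icc a b := by
    obtain ⟨b, hb⟩ := hK.bddAbove
    obtain ⟨a, ha⟩ := hK.bddBelow
    exact ⟨a, b, fun x hx => ⟨ha hx, hb hx⟩⟩
  have small : ∀ c, HasLog θ (K ∩ Icc c (c + δ / 2)) := by
    intro c
    rcases (K ∩ Icc c (c + δ / 2)).eq_empty_or_nonempty with he | ⟨y, hy⟩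
    · rw [he]; exact ⟨fun _ => 0, continuousOn_empty _, by simp⟩
    · refine hasLog_of_ne (hθ.mono inter_subset_left) (θ y) fun x hx he => ?_
      have := hu x hx.1 y hy.1 (by
        rw [Real.dist_eq, abs_lt]
        constructor <;> linarith [hx.2.1, hx.2.2, hy.2.1, hy.2.2])
      rw [he] at this
      change dist ((-θ y : Circle) : ℂ) (θ y : ℂ) < 1 at this
      rw [dist_eq_norm] at this
      have h2 : ((-θ y : Circle) : ℂ) - (θ y : ℂ) = -2 * (θ y : ℂ) := by
        push_cast; ring
      rw [h2, norm_mul, Circle.norm_coe] at this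
      norm_num at this
  have all : ∀ n : ℕ, HasLog θ (K ∩ Icc a (a + n * (δ / 2))) := by
    intro n
    induction n with
    | zero =>
      refine (small a).mono (inter_subset_inter_right _ (Icc_subset_Icc_right ?_))
      push_cast; linarith
    | succ n ih =>
      have h0 : (0:ℝ) ≤ n * (δ / 2) := by positivity
      have := ih.union (small (a + n * (δ / 2))) (hK.isClosed.inter isClosed_Icc)
        (hK.isClosed.inter isClosed_Icc) (by
          apply Set.Subsingleton.isPreconnected
          rintro x ⟨⟨-, h1⟩, -, h2⟩ y ⟨⟨-, h3⟩, -, h4⟩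
          linarith [h1.2, h2.1, h3.2, h4.1])
      rw [← inter_union_distrib_left, Icc_union_Icc_eq_Icc (by linarith) (by linarith)] at this
      have e : a + ((n + 1 : ℕ) : ℝ) * (δ / 2) = a + n * (δ / 2) + δ / 2 := by push_cast; ring
      rwa [e]
  obtain ⟨n, hn⟩ := exists_nat_gt ((b - a) / (δ / 2))
  refine (all n).mono fun x hx => ⟨hx, (hab hx).1, ?_⟩
  have := (hab hx).2
  rw [div_lt_iff₀ (by positivity)] at hn
  linarith

theorem allLog_circle {A : Set Circle} (hA : IsCompact A) {c : Circle} (hc : c ∉ A) :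
    AllLog A := by
  obtain ⟨l, hl, h⟩ : HasLog (id : Circle → Circle) A :=
    hasLog_of_ne continuousOn_id (-c) (by
      rintro x hx h
      rw [neg_neg] at h
      exact hc (h ▸ hx))
  refine AllLog.of_injOn hA hl (fun x hx y hy hxy => ?_)
    (allLog_real (hA.image_of_continuousOn hl))
  have h1 := h x hx
  have h2 := h y hy
  simp only [id] at h1 h2
  rw [h1, h2, hxy]

theorem AllLog.of_inj_real {A : Set X} (hA : IsCompact A) {f : X → ℝ} (hf : ContinuousOn f A)
    (hi : InjOn f A) : AllLog A :=
  AllLog.of_injOn hA hf hi (allLog_real (hA.image_of_continuousOn hf))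

theorem AllLog.union {A B : Set X} (hA : AllLog A) (hB : AllLog B)
    (cA : IsClosed A) (cB : IsClosed B) (hp : IsPreconnected (A ∩ B)) : AllLog (A ∪ B) :=
  fun θ hθ => (hA θ (hθ.mono subset_union_left)).union (hB θ (hθ.mono subset_union_right)) cA cB hp

theorem hasLog_homotopy {Z : Set X} {Ψ : X × ℝ → Circle} (h : ContinuousOn Ψ (Z ×ˢ Icc 0 1))
    (h0 : HasLog (fun z => Ψ (z, 0)) Z) : HasLog Ψ (Z ×ˢ Icc 0 1) := by
  classical
  obtain ⟨l, hl, hl'⟩ := h0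
  let H : C(unitInterval × Z, Circle) := ⟨fun v => Ψ (v.2, v.1),
    h.comp_continuous (by fun_prop) fun v => ⟨v.2.2, v.1.2⟩⟩
  let f : C(Z, ℝ) := ⟨Z.domRestrict l, hl.domRestrict⟩
  let L := Circle.isCoveringMap_exp.liftHomotopy H f fun a => hl' a a.2
  have hL : ∀ v, Circle.exp (L v) = H v := fun v =>
    congrFun (Circle.isCoveringMap_exp.liftHomotopy_lifts H f fun a => hl' a a.2) v
  refine ⟨fun w => if hw : w ∈ Z ×ˢ Icc (0:ℝ) 1 then L (⟨w.2, hw.2⟩, ⟨w.1, hw.1⟩) else 0, ?_, ?_⟩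
  · rw [continuousOn_iff_continuous_domRestrict]
    have : Continuous fun w : (Z ×ˢ Icc (0:ℝ) 1 : Set (X × ℝ)) =>
        L (⟨w.1.2, w.2.2⟩, ⟨w.1.1, w.2.1⟩) := by fun_prop
    convert this using 2 with w
    exact dif_pos w.2
  · intro w hw
    simp only [hw, dif_pos]
    rw [hL]
    rfl

/-- A compact set which embeds in the circle. -/
def CircleLike (A : Set X) : Prop :=
  IsCompact A ∧ ∃ f : X → Circle, ContinuousOn f A ∧ InjOn f A

theorem CircleLike.allLog_or_eq {A Γ : Set X} (h : CircleLike Γ) (hA : IsCompact A)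
    (hAΓ : A ⊆ Γ) : AllLog A ∨ A = Γ := by
  obtain ⟨-, f, hf, hi⟩ := h
  by_cases hs : f '' A = univ
  · right
    refine hAΓ.antisymm fun x hx => ?_
    obtain ⟨y, hy, he⟩ : f x ∈ f '' A := hs ▸ mem_univ _
    rwa [← hi (hAΓ hy) hx he]
  · left
    obtain ⟨c, hc⟩ := (ne_univ_iff_exists_notMem _).1 hs
    exact AllLog.of_injOn hA (hf.mono hAΓ) (hi.mono hAΓ)
      (allLog_circle (hA.image_of_continuousOn (hf.mono hAΓ)) hc)

theorem circleLike_singleton (x : X) : CircleLike {x} :=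
  ⟨isCompact_singleton, fun _ => 1, continuousOn_const, by simp⟩

theorem exists_union_extension [T2Space X] {A B : Set X} (cA : IsClosed A) (cB : IsClosed B)
    {θ φ : X → Circle} (hθ : ContinuousOn θ A) (hφ : ContinuousOn φ B)
    (he : EqOn θ φ (A ∩ B)) :
    ∃ ψ : X → Circle, ContinuousOn ψ (A ∪ B) ∧ EqOn ψ θ A ∧ EqOn ψ φ B := by
  classical
  have e1 : EqOn (fun x => if x ∈ A then θ x else φ x) θ A := fun x hx => by simp [hx]
  have e2 : EqOn (fun x => if x ∈ A then θ x else φ x) φ B := fun x hx => by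
    by_cases h : x ∈ A
    · simp only [h, if_true]; exact he ⟨h, hx⟩
    · simp [h]
  exact ⟨_, (hθ.congr e1).union_of_isClosed (hφ.congr e2) cA cB, e1, e2⟩

end Logs

/-- The direction of a nonzero complex number. -/
def circ (z : ℂ) : Circle := Circle.exp (Complex.arg z)

theorem coe_circ {z : ℂ} (hz : z ≠ 0) : (circ z : ℂ) = z / ‖z‖ := by
  have h : (‖z‖ : ℂ) ≠ 0 := by exact_mod_cast norm_ne_zero_iff.2 hz
  rw [eq_div_iff h, circ, Circle.coe_exp, mul_comm]
  exact Complex.norm_mul_exp_arg_mul_I z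

theorem continuousOn_circ : ContinuousOn circ {0}ᶜ := by
  have : ContinuousOn (fun z : ℂ => z / ‖z‖) {0}ᶜ :=
    continuousOn_id.div (by fun_prop) fun z hz => by
      exact_mod_cast norm_ne_zero_iff.2 hz
  exact Topology.IsInducing.subtypeVal.continuousOn_iff.2 (this.congr fun z hz => coe_circ hz)

section LogsMetric
variable {X : Type*} [MetricSpace X]

theorem exists_real_extension {A : Set X} (cA : IsClosed A) {l : X → ℝ} (hl : ContinuousOn l A) :
    ∃ m : X → ℝ, Continuous m ∧ EqOn m l A := by
  obtain ⟨g, hg⟩ := ContinuousMap.exists_restrict_eq cA (⟨A.domRestrict l, hl.domRestrict⟩ : C(A, ℝ))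
  refine ⟨g, g.continuous, fun x hx => ?_⟩
  exact congrArg (fun k : C(A, ℝ) => k ⟨x, hx⟩) hg

theorem HasLog.extend {θ : X → Circle} {A : Set X} (cA : IsClosed A) (h : HasLog θ A) :
    ∃ φ : X → Circle, Continuous φ ∧ EqOn φ θ A := by
  obtain ⟨l, hl, hl'⟩ := h
  obtain ⟨m, hm, hml⟩ := exists_real_extension cA hl
  refine ⟨fun x => Circle.exp (m x), by fun_prop, fun x hx => ?_⟩
  simp only [hml hx, hl' x hx]

theorem exists_nhds_extension {θ : X → Circle} {A : Set X} (cA : IsClosed A)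
    (h : ContinuousOn θ A) :
    ∃ (U : Set X) (φ : X → Circle), IsOpen U ∧ A ⊆ U ∧ ContinuousOn φ U ∧ EqOn φ θ A := by
  classical
  obtain ⟨a, ha, ha'⟩ := exists_real_extension cA (l := fun x => (θ x : ℂ).re)
    ((Complex.continuous_re.comp continuous_subtype_val).comp_continuousOn h)
  obtain ⟨b, hb, hb'⟩ := exists_real_extension cA (l := fun x => (θ x : ℂ).im)
    ((Complex.continuous_im.comp continuous_subtype_val).comp_continuousOn h)
  let g : X → ℂ := fun x => a x + b x * Complex.I
  have hg : Continuous g := by fun_prop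
  have hgA : ∀ x ∈ A, g x = θ x := fun x hx => by
    simp only [g, ha' hx, hb' hx, Complex.re_add_im]
  refine ⟨{x | g x ≠ 0}, fun x => circ (g x), isOpen_ne_fun hg continuous_const, fun x hx => ?_,
    continuousOn_circ.comp hg.continuousOn fun x hx => hx, fun x hx => ?_⟩
  · change g x ≠ 0
    rw [hgA x hx]
    exact Circle.coe_ne_zero _
  · apply Circle.ext
    simp only [hgA x hx]
    rw [coe_circ (Circle.coe_ne_zero _), Circle.norm_coe]
    simp

theorem CircleLike.extend {A Γ : Set X} (h : CircleLike Γ) (hA : IsCompact A)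
    (hAΓ : A ⊆ Γ) {θ : X → Circle} (hθ : ContinuousOn θ A) :
    ∃ φ : X → Circle, ContinuousOn φ Γ ∧ EqOn φ θ A := by
  rcases h.allLog_or_eq hA hAΓ with h | rfl
  · obtain ⟨φ, h1, h2⟩ := (h θ hθ).extend hA.isClosed
    exact ⟨φ, h1.continuousOn, h2⟩
  · exact ⟨θ, hθ, fun _ _ => rfl⟩

theorem exists_extension_of_circleLike {𝒢 : Set (Set X)} (h𝒢 : 𝒢.Finite)
    (hc : ∀ Γ ∈ 𝒢, CircleLike Γ) {A : Set X} (hA : IsCompact A) {θ : X → Circle}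
    (hθ : ContinuousOn θ A) :
    ∃ φ : X → Circle, ContinuousOn φ (A ∪ ⋃₀ 𝒢) ∧ EqOn φ θ A := by
  induction 𝒢, h𝒢 using Set.Finite.induction_on with
  | empty => exact ⟨θ, by simpa using hθ, fun _ _ => rfl⟩
  | @insert Γ 𝒢 hΓ hfin ih =>
    obtain ⟨φ, h1, h2⟩ := ih fun Δ hΔ => hc Δ (mem_insert_of_mem _ hΔ)
    have hΓc := hc Γ (mem_insert _ _)
    have hK : IsCompact (A ∪ ⋃₀ 𝒢) :=
      hA.union (hfin.isCompact_sUnion fun Δ hΔ => (hc Δ (mem_insert_of_mem _ hΔ)).1)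
    obtain ⟨χ, h3, h4⟩ := hΓc.extend (hK.inter hΓc.1) inter_subset_right
      (h1.mono inter_subset_left)
    obtain ⟨ψ, h5, h6, -⟩ := exists_union_extension hK.isClosed hΓc.1.isClosed h1 h3 h4.symm
    refine ⟨ψ, ?_, fun x hx => (h6 (Or.inl hx)).trans (h2 hx)⟩
    rwa [sUnion_insert, union_comm Γ, ← union_assoc]

end LogsMetric

end Cat2Cx

end

noncomputable section

namespace Cat2Cx

/-! ### Simple closed curves and homology -/

section Winding
variable {B : Type*} [TopologicalSpace B]

/-- The circle-valued function `θ` has a lift along the path `p` with increment `w`. -/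
def Wind (θ : B → Circle) {x y : B} (p : Path x y) (w : ℝ) : Prop :=
  ∃ (a b : ℝ) (L : Path a b), (∀ t, Circle.exp (L t) = θ (p t)) ∧ b = a + w

theorem exists_wind {θ : B → Circle} {x y : B} (p : Path x y) (h : ContinuousOn θ (range p)) :
    ∃ w, Wind θ p w := by
  let g : C(unitInterval, Circle) :=
    ⟨fun t => θ (p t), h.comp_continuous p.continuous fun t => mem_range_self t⟩
  obtain ⟨L, hL, -⟩ := Circle.isCoveringMap_exp.exists_path_lifts g (Complex.arg (g 0))
    (Circle.exp_arg (g 0)).symm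
  exact ⟨L 1 - L 0, L 0, L 1, ⟨L, rfl, rfl⟩, fun t => congrFun hL t, by ring⟩

theorem Wind.trans {θ : B → Circle} {x y z : B} {p : Path x y} {q : Path y z} {w v : ℝ}
    (hp : Wind θ p w) (hq : Wind θ q v) : Wind θ (p.trans q) (w + v) := by
  obtain ⟨a, b, L, hL, hb⟩ := hp
  obtain ⟨c, d, M, hM, hd⟩ := hq
  have hk : Circle.exp (b - c) = 1 := by
    have h1 := hL 1
    have h2 := hM 0
    rw [L.target, p.target] at h1
    rw [M.source, q.source] at h2
    rw [Circle.exp_sub, h1, h2, div_self']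
  let M' : Path b (d + (b - c)) := (M.map (f := fun s => s + (b - c)) (by fun_prop)).cast
    (by ring) rfl
  refine ⟨a, d + (b - c), L.trans M', fun t => ?_, by rw [hd, hb]; ring⟩
  rw [Path.trans_apply, Path.trans_apply]
  split_ifs with h
  · exact hL _
  · simp only [M', Path.cast_coe, Path.map_coe, Function.comp_apply]
    rw [Circle.exp_add, hk, mul_one, hM]

theorem Wind.symm {θ : B → Circle} {x y : B} {p : Path x y} {w : ℝ}
    (hp : Wind θ p w) : Wind θ p.symm (-w) := by
  obtain ⟨a, b, L, hL, hb⟩ := hp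
  refine ⟨b, a, L.symm, fun t => ?_, by rw [hb]; ring⟩
  rw [Path.symm_apply, Path.symm_apply]
  exact hL _

theorem Wind.homotopic {θ : B → Circle} {x y : B} {p q : Path x y} {w : ℝ} (H : p.Homotopy q)
    (hθ : ContinuousOn θ (range H)) (hp : Wind θ p w) : Wind θ q w := by
  obtain ⟨a, b, L, hL, hb⟩ := hp
  let P : C(unitInterval × unitInterval, Circle) :=
    ⟨fun v => θ (H v), hθ.comp_continuous H.continuous fun t => mem_range_self t⟩
  let M := Circle.isCoveringMap_exp.liftHomotopy
    (P.comp ⟨fun v : unitInterval × unitInterval => (v.1, v.2), by fun_prop⟩) L.toContinuousMap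
    (fun t => by
      change θ (H (0, t)) = Circle.exp (L t)
      rw [hL]; simp)
  have hM : ∀ v, Circle.exp (M v) = θ (H v) := fun v =>
    congrFun (Circle.isCoveringMap_exp.liftHomotopy_lifts _ _ _) v
  have hM0 : ∀ t, M (0, t) = L t := fun t =>
    Circle.isCoveringMap_exp.liftHomotopy_zero _ _ _ t
  have side : ∀ t, (∀ s, H (s, t) = H (0, t)) → M (1, t) = M (0, t) := fun t ht => by
    have := log_sub_const (A := univ) (l := fun s => M (s, t)) (l' := fun _ => M (0, t))
      isPreconnected_univ (by fun_prop) (by fun_prop)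
      (fun s _ => by rw [hM, hM, ht s]) (mem_univ (1 : unitInterval)) (mem_univ 0)
    linarith
  refine ⟨M (1, 0), M (1, 1), ⟨⟨fun t => M (1, t), by fun_prop⟩, rfl, rfl⟩, fun t => ?_, ?_⟩
  · change Circle.exp (M (1, t)) = _
    rw [hM]; simp
  · rw [side 0 (by simp), side 1 (by simp), hM0, hM0, L.source, L.target, hb]

/-- Loops in the commutator subgroup are unwound by every circle-valued function on a suitable
compact set. -/
theorem exists_compact_wind_zero {x : B} (g : FundamentalGroup B x)
    (hg : g ∈ commutator (FundamentalGroup B x)) :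
    ∃ (p : Path x x) (C : Set B), FundamentalGroup.fromPath ⟦p⟧ = g ∧ IsCompact C ∧
      range p ⊆ C ∧ ∀ θ : B → Circle, ContinuousOn θ C → Wind θ p 0 := by
  have cr : ∀ p : Path x x, IsCompact (range p) := fun p => isCompact_range p.continuous
  rw [commutator_eq_closure] at hg
  induction hg using Subgroup.closure_induction with
  | mem g hg =>
    obtain ⟨a, b, rfl⟩ := hg
    obtain ⟨p, rfl⟩ := Quotient.exists_rep a
    obtain ⟨q, rfl⟩ := Quotient.exists_rep b
    refine ⟨q.symm.trans (p.symm.trans (q.trans p)), range p ∪ range q, rfl,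
      (cr p).union (cr q), ?_, fun θ hθ => ?_⟩
    · simp only [Path.trans_range, Path.symm_range]
      intro y; simp only [mem_union]; tauto
    · obtain ⟨w, hw⟩ := exists_wind p (hθ.mono subset_union_left)
      obtain ⟨v, hv⟩ := exists_wind q (hθ.mono subset_union_right)
      have := hv.symm.trans (hw.symm.trans (hv.trans hw))
      convert this using 1; ring
  | one =>
    refine ⟨Path.refl x, range (Path.refl x), rfl, cr _, le_rfl, fun θ _ => ?_⟩
    exact ⟨_, _, Path.refl (Complex.arg (θ x)), fun t => Circle.exp_arg _, by simp⟩
  | mul a b _ _ ha hb =>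
    obtain ⟨p, C, rfl, hC, hp, h⟩ := ha
    obtain ⟨q, D, rfl, hD, hq, h'⟩ := hb
    refine ⟨q.trans p, C ∪ D, rfl, hC.union hD, ?_, fun θ hθ => ?_⟩
    · rw [Path.trans_range]
      exact union_subset (hq.trans subset_union_right) (hp.trans subset_union_left)
    · have := (h' θ (hθ.mono subset_union_right)).trans (h θ (hθ.mono subset_union_left))
      simpa using this
  | inv a _ ha =>
    obtain ⟨p, C, rfl, hC, hp, h⟩ := ha
    refine ⟨p.symm, C, rfl, hC, by rwa [Path.symm_range], fun θ hθ => ?_⟩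
    simpa using (h θ hθ).symm

end Winding

section Curves
variable {X : Type*} [TopologicalSpace X]

theorem SCC.isCompact_img (γ : SCC X) : IsCompact γ.img :=
  isCompact_Icc.image_of_continuousOn γ.contOn

theorem SCC.eq_or_of_apply_eq (γ : SCC X) {s t : ℝ} (hs : s ∈ Icc (0:ℝ) 1) (ht : t ∈ Icc (0:ℝ) 1)
    (h : γ.toFun s = γ.toFun t) : s = t ∨ (s = 0 ∧ t = 1) ∨ (s = 1 ∧ t = 0) := by
  rcases hs.2.lt_or_eq with h1 | rfl <;> rcases ht.2.lt_or_eq with h2 | rfl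
  · exact Or.inl (γ.inj ⟨hs.1, h1⟩ ⟨ht.1, h2⟩ h)
  · rw [← γ.loop] at h
    exact Or.inr (Or.inl ⟨γ.inj ⟨hs.1, h1⟩ (by simp) h, rfl⟩)
  · rw [← γ.loop] at h
    exact Or.inr (Or.inr ⟨rfl, (γ.inj (by simp) ⟨ht.1, h2⟩ h).symm⟩)
  · exact Or.inl rfl

/-- Functions on a simple closed curve. -/
theorem SCC.exists_factor [T2Space X] {Z : Type*} [TopologicalSpace Z] (γ : SCC X) {k : ℝ → Z}
    (hk : ContinuousOn k (Icc 0 1))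
    (h01 : k 0 = k 1) : ∃ θ : X → Z, ContinuousOn θ γ.img ∧
      ∀ t ∈ Icc (0:ℝ) 1, θ (γ.toFun t) = k t := by
  have key : ∀ t ∈ Icc (0:ℝ) 1,
      k (Function.invFunOn γ.toFun (Icc 0 1) (γ.toFun t)) = k t := by
    intro t ht
    have hex : ∃ s ∈ Icc (0:ℝ) 1, γ.toFun s = γ.toFun t := ⟨t, ht, rfl⟩
    rcases γ.eq_or_of_apply_eq (Function.invFunOn_mem hex) ht (Function.invFunOn_eq hex)
      with h | ⟨h, rfl⟩ | ⟨h, rfl⟩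
    · rw [h]
    · rw [h, h01]
    · rw [h, h01]
  exact ⟨fun x => k (Function.invFunOn γ.toFun (Icc 0 1) x),
    continuousOn_image_of_comp isCompact_Icc γ.contOn (hk.congr key), key⟩

theorem SCC.circleLike [T2Space X] (γ : SCC X) : CircleLike γ.img := by
  obtain ⟨θ, h1, h2⟩ := γ.exists_factor (k := fun t => Circle.exp (2 * Real.pi * t))
    (by fun_prop) (by simp)
  refine ⟨γ.isCompact_img, θ, h1, ?_⟩
  rintro _ ⟨s, hs, rfl⟩ _ ⟨t, ht, rfl⟩ he
  rw [h2 s hs, h2 t ht] at he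
  obtain ⟨m, hm⟩ := Circle.exp_eq_exp.1 he
  have hpi := Real.pi_pos
  have hst : s = t + m := by
    have : (2 * Real.pi) * s = (2 * Real.pi) * (t + m) := by linarith
    exact mul_left_cancel₀ (by positivity) this
  have hm1 : (m : ℝ) ≤ 1 := by linarith [hs.2, ht.1]
  have hm2 : (-1 : ℝ) ≤ m := by linarith [hs.1, ht.2]
  have hm1 : m ≤ 1 := by exact_mod_cast hm1
  have hm2 : -1 ≤ m := by exact_mod_cast hm2
  have : m = 0 ∨ m = 1 ∨ m = -1 := by omega
  rcases this with rfl | rfl | rfl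
  · simp at hst; rw [hst]
  · have e1 : s = 1 := by push_cast at hst; linarith [hs.2, ht.1]
    have e2 : t = 0 := by push_cast at hst; linarith [hs.2, ht.1]
    rw [e1, e2, γ.loop]
  · have e1 : s = 0 := by push_cast at hst; linarith [hs.1, ht.2]
    have e2 : t = 1 := by push_cast at hst; linarith [hs.1, ht.2]
    rw [e1, e2, γ.loop]

/-- A lift with nonzero increment along a simple closed curve obstructs logarithms. -/
theorem SCC.not_hasLog (γ : SCC X) {θ : X → Circle} {k : ℝ → ℝ} (hk : ContinuousOn k (Icc 0 1))
    (h : ∀ t ∈ Icc (0:ℝ) 1, θ (γ.toFun t) = Circle.exp (k t)) (h01 : k 0 ≠ k 1) :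
    ¬ HasLog θ γ.img := by
  rintro ⟨l, hl, hl'⟩
  have := log_sub_const (A := Icc (0:ℝ) 1) (l := l ∘ γ.toFun) (l' := k) isPreconnected_Icc
    (hl.comp γ.contOn (mapsTo_image _ _)) hk
    (fun t ht => by rw [← h t ht]; exact (hl' _ (mem_image_of_mem _ ht)).symm)
    (x := 0) (y := 1) (by simp) (by simp)
  simp only [Function.comp_apply, γ.loop] at this
  exact h01 (by linarith)

/-- `G` unwinds the curve `γ`: circle-valued functions on `G` have logarithms along `γ`. -/
def Unwinds (G : Set X) (γ : SCC X) : Prop := ∀ θ : X → Circle, ContinuousOn θ G → HasLog θ γ.img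

theorem SCC.hasLog_of_wind [T2Space X] (γ : SCC X) {B : Set X} (hB : γ.img ⊆ B) {θ : X → Circle}
    (h : Wind (fun b : B => θ b) (γ.pathIn B hB) 0) : HasLog θ γ.img := by
  obtain ⟨a, b, L, hL, hb⟩ := h
  let l : ℝ → ℝ := fun t => L (projIcc 0 1 zero_le_one t)
  have hl : Continuous l := L.continuous.comp continuous_projIcc
  have hlt : ∀ t ∈ Icc (0:ℝ) 1, θ (γ.toFun t) = Circle.exp (l t) := fun t ht => by
    simp only [l, hL, projIcc_of_mem _ ht]; rfl
  have l01 : l 0 = l 1 := by simp [l, hb]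
  obtain ⟨m, hm, hml⟩ := γ.exists_factor hl.continuousOn l01
  refine ⟨m, hm, ?_⟩
  rintro _ ⟨t, ht, rfl⟩
  rw [hml t ht, hlt t ht]

theorem SCC.exists_compact_unwinds [T2Space X] (γ : SCC X) {B : Set X} (hB : γ.img ⊆ B)
    (h : loopClassH1 (γ.pathIn B hB) = 1) :
    ∃ C : Set X, IsCompact C ∧ γ.img ⊆ C ∧ C ⊆ B ∧ Unwinds C γ := by
  have hmem := (Abelianization.ker_of (G := FundamentalGroup B (γ.basePoint B hB))).le h
  obtain ⟨p, C, hp, hC, hpC, hw⟩ := exists_compact_wind_zero _ hmem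
  obtain ⟨H⟩ : p.Homotopic (γ.pathIn B hB) := Quotient.exact hp
  refine ⟨Subtype.val '' (C ∪ range H), (hC.union (isCompact_range H.continuous)).image
    continuous_subtype_val, ?_, ?_, fun θ hθ => ?_⟩
  · rintro _ ⟨t, ht, rfl⟩
    refine ⟨γ.pathIn B hB ⟨t, ht⟩, Or.inr ⟨(1, ⟨t, ht⟩), by simp⟩, rfl⟩
  · rintro _ ⟨x, -, rfl⟩; exact x.2
  · have hθ' : ContinuousOn (fun b : B => θ b) (C ∪ range H) :=
      hθ.comp continuous_subtype_val.continuousOn (mapsTo_image _ _)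
    exact γ.hasLog_of_wind hB ((hw _ (hθ'.mono subset_union_left)).homotopic H
      (hθ'.mono subset_union_right))

end Curves

section Wrap
variable {X : Type*} [MetricSpace X]

/-- A closed set which near some point of `γ` consists only of `γ` does not unwind `γ`. -/
theorem SCC.not_unwinds_of_local (γ : SCC X) {G : Set X} (hG : IsClosed G) {z : X}
    (hz : z ∈ γ.img) {r : ℝ} (hr : 0 < r) (h : G ∩ ball z r ⊆ γ.img) : ¬ Unwinds G γ := by
  obtain ⟨t₀, ht₀, rfl⟩ : ∃ t₀ ∈ Ico (0:ℝ) 1, γ.toFun t₀ = z := by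
    obtain ⟨t, ht, rfl⟩ := hz
    rcases ht.2.lt_or_eq with h1 | rfl
    · exact ⟨t, ⟨ht.1, h1⟩, rfl⟩
    · exact ⟨0, by simp, γ.loop⟩
  have hc := γ.contOn t₀ ⟨ht₀.1, ht₀.2.le⟩
  obtain ⟨δ, hδ, hball⟩ := Metric.continuousWithinAt_iff.1 hc r hr
  obtain ⟨ρ, hρ, hρδ, hρ1⟩ : ∃ ρ > 0, ρ < δ ∧ t₀ + ρ ≤ 1 := by
    refine ⟨min (δ / 2) (1 - t₀), lt_min (by linarith) (by linarith [ht₀.2]),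
      (min_le_left _ _).trans_lt (by linarith), ?_⟩
    linarith [min_le_right (δ / 2) (1 - t₀)]
  let k : ℝ → ℝ := fun t => 2 * Real.pi * projIcc (0:ℝ) 1 zero_le_one ((t - t₀) / ρ)
  have hk : Continuous k := by
    have : Continuous fun t : ℝ => ((projIcc (0:ℝ) 1 zero_le_one ((t - t₀) / ρ) : Icc (0:ℝ) 1) : ℝ) :=
      continuous_subtype_val.comp (continuous_projIcc.comp (by fun_prop))
    exact this.const_mul _
  have k0 : ∀ t ≤ t₀, k t = 0 := fun t ht => by
    simp only [k]
    rw [projIcc_of_le_left _ (div_nonpos_of_nonpos_of_nonneg (by linarith) hρ.le)]; simp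
  have k1 : ∀ t, t₀ + ρ ≤ t → k t = 2 * Real.pi := fun t ht => by
    simp only [k]
    rw [projIcc_of_right_le _ ((le_div_iff₀ hρ).2 (by linarith))]; simp
  obtain ⟨θ, hθ, hθk⟩ := γ.exists_factor (k := fun t => Circle.exp (k t)) (by fun_prop)
    (by rw [k0 0 ht₀.1, k1 1 hρ1]; simp)
  have out : EqOn θ (fun _ => 1) (γ.img ∩ (G \ ball (γ.toFun t₀) r)) := by
    rintro _ ⟨⟨t, ht, rfl⟩, -, hb⟩
    rw [hθk t ht]
    rcases le_total t t₀ with h1 | h1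
    · rw [k0 t h1]; simp
    · rcases le_total (t₀ + ρ) t with h2 | h2
      · rw [k1 t h2]; simp
      · exact absurd (hball ht (by rw [Real.dist_eq, abs_lt]; constructor <;> linarith)) hb
  obtain ⟨ψ, h1, h2, -⟩ := exists_union_extension γ.isCompact_img.isClosed
    (hG.sdiff isOpen_ball) hθ continuousOn_const out
  intro hU
  refine γ.not_hasLog (θ := ψ) hk.continuousOn (fun t ht => ?_) ?_ (hU ψ (h1.mono fun x hx => ?_))
  · rw [h2 (mem_image_of_mem _ ht), hθk t ht]
  · rw [k0 0 ht₀.1, k1 1 hρ1]; positivity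
  · by_cases hb : x ∈ ball (γ.toFun t₀) r
    · exact Or.inl (h ⟨hx, hb⟩)
    · exact Or.inr ⟨hx, hb⟩

theorem SCC.not_allLog (γ : SCC X) : ¬ AllLog γ.img := fun h =>
  γ.not_unwinds_of_local γ.isCompact_img.isClosed (mem_image_of_mem _ (by simp : (0:ℝ) ∈ Icc (0:ℝ) 1))
    one_pos inter_subset_left h

end Wrap

end Cat2Cx

end

noncomputable section

namespace Cat2Cx

/-! ### Locally planar spaces -/

section Planar
variable {X : Type*} [MetricSpace X]

/-- A projective chart of an open face: geodesics correspond to straight segments. -/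
structure FaceChart (F : Set X) (h : X → ℂ) : Prop where
  isOpen : IsOpen F
  cont : ContinuousOn h (closure F)
  inj : InjOn h (closure F)
  mem_of_btw : ∀ x ∈ closure F, ∀ y ∈ closure F, ∀ z, Btw x z y → z ∈ closure F
  segment_of_btw : ∀ x ∈ closure F, ∀ y ∈ closure F, ∀ z, Btw x z y → h z ∈ segment ℝ (h x) (h y)
  btw_of_segment : ∀ x ∈ closure F, ∀ y ∈ closure F, ∀ z ∈ closure F,
    h z ∈ segment ℝ (h x) (h y) → Btw x z y
  star : ∀ y ∈ closure F, ∀ x ∈ F, ∀ z, Btw y z x → z ≠ y → z ∈ F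

/-- A radius below which the family `𝓕` of faces is conical around `y`. -/
structure GoodRadius (𝓕 : Set (Set X)) (y : X) (η₀ : ℝ) : Prop where
  pos : 0 < η₀
  finite_faces : {F ∈ 𝓕 | (F ∩ ball y η₀).Nonempty}.Finite
  mem_closure : ∀ F ∈ 𝓕, (F ∩ ball y η₀).Nonempty → y ∈ closure F
  finite_sphere : ∀ η ∈ Ioo 0 η₀, (sphere y η \ ⋃₀ 𝓕).Finite
  nonbranching : ∀ x₁ ∈ ball y η₀, ∀ x₂ ∈ ball y η₀, ∀ u, u ≠ y → Btw y u x₁ → Btw y u x₂ →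
    dist y x₁ = dist y x₂ → x₁ = x₂

/-- Spaces covered by planar faces, up to a one-dimensional set. -/
structure LocallyPlanar (𝓕 : Set (Set X)) : Prop where
  chart : ∀ F ∈ 𝓕, ∃ h : X → ℂ, FaceChart F h
  exists_radius : ∀ y, ∃ η₀, GoodRadius 𝓕 y η₀

theorem GoodRadius.mono {𝓕 : Set (Set X)} {y : X} {η η' : ℝ} (h : GoodRadius 𝓕 y η) (h0 : 0 < η')
    (hle : η' ≤ η) : GoodRadius 𝓕 y η' where
  pos := h0
  finite_faces := h.finite_faces.subset fun _ hF =>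
    ⟨hF.1, hF.2.mono (inter_subset_inter_right _ (ball_subset_ball hle))⟩
  mem_closure F hF hn := h.mem_closure F hF (hn.mono (inter_subset_inter_right _ (ball_subset_ball hle)))
  finite_sphere ρ hρ := h.finite_sphere ρ ⟨hρ.1, hρ.2.trans_le hle⟩
  nonbranching x hx x' hx' := h.nonbranching x (ball_subset_ball hle hx) x' (ball_subset_ball hle hx')

theorem LocallyPlanar.exists_radius_lt {𝓕 : Set (Set X)} (h : LocallyPlanar 𝓕) (y : X) {U : Set X}
    (hU : U ∈ nhds y) : ∃ η₀, GoodRadius 𝓕 y η₀ ∧ ball y η₀ ⊆ U := by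
  obtain ⟨η, hη⟩ := h.exists_radius y
  obtain ⟨δ, hδ, hb⟩ := Metric.mem_nhds_iff.1 hU
  exact ⟨min η δ, hη.mono (lt_min hη.pos hδ) (min_le_left _ _),
    (ball_subset_ball (min_le_right _ _)).trans hb⟩

theorem FaceChart.circleLike {F : Set X} {h : X → ℂ} (hF : FaceChart F h) {y : X}
    (hy : y ∈ closure F) {η : ℝ} (hη : 0 < η) {K : Set X} (hK : IsCompact K)
    (hKs : K ⊆ sphere y η) (hKF : K ⊆ closure F) : CircleLike K := by
  have hne : ∀ x ∈ K, h x - h y ≠ 0 := fun x hx he => by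
    have := hF.inj (hKF hx) hy (sub_eq_zero.1 he)
    have h2 := hKs hx
    rw [this, mem_sphere, dist_self] at h2
    exact hη.ne h2
  refine ⟨hK, fun x => circ (h x - h y), continuousOn_circ.comp
    ((hF.cont.mono hKF).sub continuousOn_const) hne, ?_⟩
  have key : ∀ x ∈ K, ∀ x' ∈ K, circ (h x - h y) = circ (h x' - h y) →
      ‖h x - h y‖ ≤ ‖h x' - h y‖ → x = x' := by
    intro x hx x' hx' he hle
    have h1 := congrArg (Subtype.val) he
    change (circ (h x - h y) : ℂ) = (circ (h x' - h y) : ℂ) at h1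
    rw [coe_circ (hne x hx), coe_circ (hne x' hx')] at h1
    have p1 := norm_pos_iff.2 (hne x hx)
    have p2 := norm_pos_iff.2 (hne x' hx')
    have hb : Btw y x x' := by
      refine hF.btw_of_segment y hy x' (hKF hx') x (hKF hx) ?_
      rw [segment_eq_image']
      refine ⟨‖h x - h y‖ / ‖h x' - h y‖, ⟨by positivity, (div_le_one p2).2 hle⟩, ?_⟩
      have q1 : (‖h x - h y‖ : ℂ) ≠ 0 := by exact_mod_cast p1.ne'
      have q2 : (‖h x' - h y‖ : ℂ) ≠ 0 := by exact_mod_cast p2.ne'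
      simp only [Complex.real_smul]
      push_cast
      have : h x - h y = ‖h x - h y‖ / ‖h x' - h y‖ * (h x' - h y) := by
        field_simp at h1 ⊢
        linear_combination h1
      linear_combination -this
    have d1 := hKs hx
    have d2 := hKs hx'
    rw [mem_sphere'] at d1 d2
    unfold Btw at hb
    exact dist_le_zero.1 (by linarith)
  intro x hx x' hx' he
  rcases le_total ‖h x - h y‖ ‖h x' - h y‖ with hle | hle
  · exact key x hx x' hx' he hle
  · exact (key x' hx' x hx he.symm hle).symm

theorem LocallyPlanar.exists_sphere_extension {𝓕 : Set (Set X)} (hP : LocallyPlanar 𝓕) {y : X}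
    {η₀ η : ℝ} (hg : GoodRadius 𝓕 y η₀) (hη : η ∈ Ioo 0 η₀) {A Q : Set X} (hA : IsCompact A)
    (hQ : IsCompact Q) (hQs : Q ⊆ sphere y η) {θ : X → Circle}
    (hθ : ContinuousOn θ A) : ∃ φ : X → Circle, ContinuousOn φ (A ∪ Q) ∧ EqOn φ θ A := by
  have hball : Q ⊆ ball y η₀ := fun x hx => by
    have := hQs hx
    rw [mem_sphere] at this
    rw [mem_ball, this]; exact hη.2
  let 𝒢 : Set (Set X) := (fun F => Q ∩ closure F) '' {F ∈ 𝓕 | (F ∩ ball y η₀).Nonempty} ∪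
    (fun x => {x}) '' (Q \ ⋃₀ 𝓕)
  have hfin : 𝒢.Finite := (hg.finite_faces.image _).union
    (((hg.finite_sphere η hη).subset (sdiff_subset_sdiff_left hQs)).image _)
  have hc : ∀ Γ ∈ 𝒢, CircleLike Γ := by
    rintro _ (⟨F, hF, rfl⟩ | ⟨x, -, rfl⟩)
    · obtain ⟨h, hh⟩ := hP.chart F hF.1
      exact hh.circleLike (hg.mem_closure F hF.1 hF.2) hη.1 (hQ.inter_right isClosed_closure)
        (inter_subset_left.trans hQs) inter_subset_right
    · exact circleLike_singleton x
  obtain ⟨φ, h1, h2⟩ := exists_extension_of_circleLike hfin hc hA hθ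
  refine ⟨φ, h1.mono (union_subset_union_right _ fun x hx => ?_), h2⟩
  by_cases hxF : x ∈ ⋃₀ 𝓕
  · obtain ⟨F, hF, hxF⟩ := hxF
    exact ⟨_, Or.inl ⟨F, ⟨hF, x, hxF, hball hx⟩, rfl⟩, hx, subset_closure hxF⟩
  · exact ⟨_, Or.inr ⟨x, ⟨hx, hxF⟩, rfl⟩, rfl⟩

variable [CAT0Space X]

/-- A compact part of a small sphere around `y` without antipodes of `o` has logarithms. -/
theorem LocallyPlanar.allLog_of_no_antipode {𝓕 : Set (Set X)} (hP : LocallyPlanar 𝓕) {y : X}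
    {η₀ η : ℝ} (hg : GoodRadius 𝓕 y η₀) (hη : η ∈ Ioo 0 η₀) {A : Set X} (hA : IsCompact A)
    (hAs : A ⊆ sphere y η) {o : X} (hno : ∀ a ∈ A, ¬ Btw o y a) : AllLog A := by
  intro θ hθ
  rcases A.eq_empty_or_nonempty with rfl | hAne
  · exact ⟨fun _ => 0, continuousOn_empty _, by simp⟩
  have hK : IsCompact (A ×ˢ Icc (0:ℝ) 1) := hA.prod isCompact_Icc
  let τ : X × ℝ → X := fun v => pt o v.1 v.2
  have hτ : Continuous τ := continuous_pt.comp (by fun_prop : Continuous fun v : X × ℝ => (o, v.1, v.2))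
  have hτy : ∀ v ∈ A ×ˢ Icc (0:ℝ) 1, τ v ≠ y := by
    rintro ⟨a, s⟩ hv he
    exact hno a hv.1 (he ▸ btw_pt o a s)
  obtain ⟨v₀, hv₀, hmin⟩ := hK.exists_isMinOn (hAne.prod ⟨0, by simp⟩)
    (f := fun v => dist y (τ v)) (by fun_prop)
  set η' := dist y (τ v₀) with hη'
  have hη'0 : 0 < η' := dist_pos.2 (hτy v₀ hv₀).symm
  have hdist : ∀ v ∈ A ×ˢ Icc (0:ℝ) 1, η' ≤ dist y (τ v) := fun v hv => hmin hv
  have hτ1 : ∀ a, τ (a, 1) = a := fun a => pt_one o a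
  have hm1 : ∀ a ∈ A, (a, (1:ℝ)) ∈ A ×ˢ Icc (0:ℝ) 1 := fun a ha => ⟨ha, by simp⟩
  have hη'η : η' ≤ η := by
    obtain ⟨a, ha⟩ := hAne
    have := hdist _ (hm1 a ha)
    rw [hτ1] at this
    have h2 := hAs ha
    rw [mem_sphere'] at h2
    linarith
  let r : X → X := rad y η'
  have hr : ContinuousOn r {x | x ≠ y} := (continuousOn_rad y).comp
    (f := fun x : X => (η', x)) (by fun_prop) fun x hx => hx
  have hAy : ∀ a ∈ A, a ≠ y := fun a ha => by
    have := hτy _ (hm1 a ha); rwa [hτ1] at this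
  have hrA : InjOn r A := by
    intro a ha a' ha' he
    have d1 := hAs ha
    have d2 := hAs ha'
    rw [mem_sphere'] at d1 d2
    refine hg.nonbranching a (by rw [mem_ball', d1]; exact hη.2) a'
      (by rw [mem_ball', d2]; exact hη.2) (r a) ?_ (btw_rad _ _ _) (he ▸ btw_rad _ _ _)
      (d1.trans d2.symm)
    have := dist_rad (x := a) hη'0.le (by rw [d1]; exact hη'η)
    intro h
    change r a = y at h
    change dist y (r a) = η' at this
    rw [h, dist_self] at this
    exact hη'0.ne this
  have hrAc : ContinuousOn r A := hr.mono hAy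
  have : Nonempty X := ⟨y⟩
  have hcR : ContinuousOn (fun v => r (τ v)) (A ×ˢ Icc (0:ℝ) 1) := hr.comp hτ.continuousOn hτy
  obtain ⟨φ, hφ, hφe⟩ := hP.exists_sphere_extension (η := η') hg ⟨hη'0, hη'η.trans_lt hη.2⟩
    (A := r '' A) (Q := (fun v => r (τ v)) '' (A ×ˢ Icc (0:ℝ) 1))
    (hA.image_of_continuousOn hrAc) (hK.image_of_continuousOn hcR) (by
      rintro _ ⟨v, hv, rfl⟩
      rw [mem_sphere']
      exact dist_rad hη'0.le (hdist v hv))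
    (θ := θ ∘ Function.invFunOn r A) (continuousOn_image_of_comp hA hrAc
      (hθ.congr fun x hx => by
        simp only [Function.comp_apply]
        rw [hrA.leftInvOn_invFunOn hx]))
  have hlog : HasLog (fun v => φ (r (τ v))) (A ×ˢ Icc (0:ℝ) 1) := by
    refine hasLog_homotopy (hφ.comp hcR fun v hv => Or.inr (mem_image_of_mem _ hv)) ?_
    refine ⟨fun _ => Complex.arg (φ (r o)), continuousOn_const, fun x hx => ?_⟩
    simp only [τ, pt_zero, Circle.exp_arg]
  have := hlog.comp (f := fun a : X => (a, (1:ℝ))) (A := A) (by fun_prop) hm1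
  refine this.congr fun a ha => ?_
  simp only [Function.comp_apply, hτ1]
  rw [hφe (mem_image_of_mem r ha)]
  simp only [Function.comp_apply]
  rw [hrA.leftInvOn_invFunOn ha]

end Planar

/-! ### Minimal unwinding sets -/

section Minimal
variable {X : Type*} [MetricSpace X]

/-- `G` is a minimal compact set unwinding `γ`. -/
structure MinUnwind (G : Set X) (γ : SCC X) : Prop where
  compact : IsCompact G
  subset : γ.img ⊆ G
  unwinds : Unwinds G γ
  minimal : ∀ G' ⊆ G, IsCompact G' → γ.img ⊆ G' → Unwinds G' γ → G ⊆ G'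

theorem exists_minUnwind {γ : SCC X} {C : Set X} (hC : IsCompact C) (hγ : γ.img ⊆ C)
    (h : Unwinds C γ) : ∃ G ⊆ C, MinUnwind G γ := by
  obtain ⟨G, hGC, hG⟩ := zorn_superset_nonempty
    {G : Set X | IsCompact G ∧ γ.img ⊆ G ∧ Unwinds G γ} (by
    intro c hc hch hne
    have : Nonempty c := hne.to_subtype
    have hcomp : IsCompact (⋂₀ c) := by
      obtain ⟨s, hs⟩ := hne
      exact (hc hs).1.of_isClosed_subset (isClosed_sInter fun t ht => (hc ht).1.isClosed)
        (sInter_subset_of_mem hs)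
    refine ⟨⋂₀ c, ⟨hcomp, subset_sInter fun s hs => (hc hs).2.1, fun θ hθ => ?_⟩,
      fun s hs => sInter_subset_of_mem hs⟩
    obtain ⟨U, φ, hU, hGU, hφ, he⟩ := exists_nhds_extension hcomp.isClosed hθ
    obtain ⟨i, hi⟩ := exists_subset_nhds_of_isCompact (V := fun s : c => (s : Set X))
      (by
        intro s t
        rcases hch.total s.2 t.2 with h | h
        · exact ⟨s, le_rfl, h⟩
        · exact ⟨t, h, le_rfl⟩)
      (fun s => (hc s.2).1) (U := U) (fun x hx => hU.mem_nhds (hGU (by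
        rw [sInter_eq_iInter]; exact hx)))
    refine ((hc i.2).2.2 φ (hφ.mono hi)).congr fun x hx => (he ?_).symm
    exact mem_sInter.2 fun s hs => (hc hs).2.1 hx) C ⟨hC, hγ, h⟩
  exact ⟨G, hGC, hG.1.1, hG.1.2.1, hG.1.2.2, fun G' hG' h1 h2 h3 => hG.2 ⟨h1, h2, h3⟩ hG'⟩

variable {G : Set X} {γ : SCC X}

theorem HasLog.mul {θ φ : X → Circle} {A : Set X} (h : HasLog θ A) (h' : HasLog φ A) :
    HasLog (fun x => θ x * φ x) A := by
  obtain ⟨l, hl, hl'⟩ := h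
  obtain ⟨m, hm, hm'⟩ := h'
  refine ⟨fun x => l x + m x, hl.add hm, fun x hx => ?_⟩
  change θ x * φ x = _
  rw [Circle.exp_add, hl' x hx, hm' x hx]

theorem allLog_of_finite {A : Set X} (hA : A.Finite) : AllLog A := fun θ _ =>
  ⟨fun x => Complex.arg (θ x), hA.continuousOn _, fun x _ => (Circle.exp_arg _).symm⟩

theorem MinUnwind.not_unwinds_diff (hG : MinUnwind G γ) {U : Set X} (hU : IsOpen U)
    (hd : Disjoint U γ.img) {y : X} (hy : y ∈ G) (hyU : y ∈ U) : ¬ Unwinds (G \ U) γ := fun h =>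
  (hG.minimal (G \ U) sdiff_subset (hG.compact.diff hU)
    (fun _ hx => ⟨hG.subset hx, fun hxU => hd.le_bot ⟨hxU, hx⟩⟩) h hy).2 hyU

theorem MinUnwind.not_allLog_sphere (hG : MinUnwind G γ) {y : X} (hy : y ∈ G) {η : ℝ} (hη : 0 < η)
    (hd : Disjoint (ball y η) γ.img) : ¬ AllLog (G ∩ sphere y η) := by
  intro hall
  refine hG.not_unwinds_diff isOpen_ball hd hy (mem_ball_self hη) fun θ hθ => ?_
  have hsub : G ∩ sphere y η ⊆ G \ ball y η := fun x hx => ⟨hx.1, by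
    have := hx.2
    rw [mem_sphere] at this
    rw [mem_ball, this]; exact lt_irrefl _⟩
  obtain ⟨φ, hφ, he⟩ := (hall θ (hθ.mono hsub)).extend
    (hG.compact.isClosed.inter isClosed_sphere)
  obtain ⟨ψ, h1, h2, -⟩ := exists_union_extension (hG.compact.diff isOpen_ball).isClosed
    (isClosed_closedBall (x := y) (ε := η)) hθ hφ.continuousOn fun x hx =>
      (he ⟨hx.1.1, le_antisymm hx.2 (not_lt.1 hx.1.2)⟩).symm
  refine (hG.unwinds ψ (h1.mono fun x hx => ?_)).congr fun x hx => (h2 ?_).symm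
  · by_cases hb : x ∈ ball y η
    · exact Or.inr (ball_subset_closedBall hb)
    · exact Or.inl ⟨hx, hb⟩
  · exact ⟨hG.subset hx, fun hb => hd.le_bot ⟨hb, hx⟩⟩

theorem MinUnwind.isOpen_inter_face (hG : MinUnwind G γ) {𝓕 : Set (Set X)} (hP : LocallyPlanar 𝓕)
    {F : Set X} (hF : F ∈ 𝓕) : IsOpen ((G ∩ F) \ γ.img) := by
  obtain ⟨h, hh⟩ := hP.chart F hF
  rw [Metric.isOpen_iff]
  rintro y ⟨⟨hyG, hyF⟩, hyγ⟩
  obtain ⟨ρ, hρ, hb⟩ := Metric.isOpen_iff.1 (hh.isOpen.sdiff γ.isCompact_img.isClosed) y ⟨hyF, hyγ⟩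
  refine ⟨ρ / 3, by positivity, fun y' hy' => ?_⟩
  have hy'F := hb (ball_subset_ball (by linarith) hy')
  refine ⟨⟨?_, hy'F.1⟩, hy'F.2⟩
  by_contra hy'G
  obtain ⟨y₁, hy₁, hmin⟩ := hG.compact.exists_isMinOn ⟨y, hyG⟩ (f := fun x => dist y' x) (by fun_prop)
  set η := dist y' y₁ with hη
  have hη0 : 0 < η := dist_pos.2 fun e => hy'G (e ▸ hy₁)
  have h1 : η ≤ dist y' y := hmin hyG
  rw [mem_ball] at hy'
  have h2 : dist y₁ y ≤ η + dist y' y := by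
    rw [hη]; exact dist_triangle_left _ _ _
  have hsub : closedBall y₁ η ⊆ F \ γ.img := fun x hx => hb (by
    rw [mem_closedBall] at hx
    rw [mem_ball]
    linarith [dist_triangle x y₁ y])
  have hΓ : CircleLike ((G ∩ sphere y₁ η) ∪ {y'}) := by
    refine hh.circleLike (y := y₁) (subset_closure (hsub (mem_closedBall_self hη0.le)).1) hη0
      ((hG.compact.inter_right isClosed_sphere).union isCompact_singleton)
      (union_subset inter_subset_right (by simp [hη])) (union_subset (fun x hx =>
        subset_closure (hsub (sphere_subset_closedBall hx.2)).1)
        (singleton_subset_iff.2 (subset_closure hy'F.1)))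
  rcases hΓ.allLog_or_eq (hG.compact.inter_right isClosed_sphere) subset_union_left with hl | he
  · exact hG.not_allLog_sphere hy₁ hη0 (disjoint_left.2 fun x hx hx' =>
      (hsub (ball_subset_closedBall hx)).2 hx') hl
  · exact hy'G (he.symm.subset (Or.inr rfl)).1

theorem MinUnwind.mem_closure_faces (hG : MinUnwind G γ) {𝓕 : Set (Set X)} (hP : LocallyPlanar 𝓕)
    {y : X} (hy : y ∈ G) (hyγ : y ∉ γ.img) : y ∈ closure (G ∩ ⋃₀ 𝓕) := by
  by_contra hcon
  obtain ⟨η₀, hg, hb⟩ := hP.exists_radius_lt y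
    ((isClosed_closure.isOpen_compl.inter γ.isCompact_img.isClosed.isOpen_compl).mem_nhds ⟨hcon, hyγ⟩)
  have hpos := hg.pos
  refine hG.not_allLog_sphere hy (η := η₀ / 2) (by positivity) (disjoint_left.2 fun x hx hx' =>
    (hb (ball_subset_ball (by linarith) hx)).2 hx') (allLog_of_finite
      ((hg.finite_sphere (η₀ / 2) ⟨by positivity, by linarith⟩).subset fun x hx => ⟨hx.2, fun hxF => ?_⟩))
  refine (hb (?_ : x ∈ ball y η₀)).1 (subset_closure ⟨hx.1, hxF⟩)
  have := hx.2
  rw [mem_sphere] at this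
  rw [mem_ball, this]; linarith

theorem MinUnwind.subset_closure_diff (hG : MinUnwind G γ) : γ.img ⊆ closure (G \ γ.img) := by
  intro z hz
  rw [Metric.mem_closure_iff]
  intro r hr
  by_contra! hcon
  refine γ.not_unwinds_of_local hG.compact.isClosed hz hr (fun x hx => ?_) hG.unwinds
  by_contra hxγ
  have := hcon x ⟨hx.1, hxγ⟩
  rw [dist_comm] at this
  exact (not_lt.2 this) hx.2

variable {𝓕 : Set (Set X)} [CAT0Space X]

theorem MinUnwind.exists_antipode (hG : MinUnwind G γ) (hP : LocallyPlanar 𝓕) {y : X} (hy : y ∈ G)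
    {η₀ η : ℝ} (hg : GoodRadius 𝓕 y η₀) (hη : η ∈ Ioo 0 η₀) (hd : Disjoint (ball y η) γ.img)
    (o : X) : ∃ w ∈ G ∩ sphere y η, Btw o y w := by
  by_contra! hcon
  exact hG.not_allLog_sphere hy hη.1 hd (hP.allLog_of_no_antipode hg hη
    (hG.compact.inter_right isClosed_sphere) inter_subset_right hcon)

end Minimal

end Cat2Cx

end

noncomputable section

namespace Cat2Cx

section Extend
variable {X : Type*} [MetricSpace X] [CAT0Space X] {G : Set X} {γ : SCC X} {𝓕 : Set (Set X)}

theorem Btw.split {x y z w : X} (h : Btw x z y) (hw : Btw x w y) : Btw x z w ∨ Btw w z y := by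
  rcases le_total (dist x z) (dist x w) with hle | hle
  · exact Or.inl (h.of_dist_le hw hle)
  · exact Or.inr (h.trans_left' (hw.of_dist_le h hle))

theorem MinUnwind.seg_subset (hG : MinUnwind G γ) (hP : LocallyPlanar 𝓕) {y : X} (hy : y ∈ G)
    {η₀ : ℝ} (hg : GoodRadius 𝓕 y η₀) (hd : Disjoint (ball y η₀) γ.img) {x : X} (hx : x ∈ G)
    (hxb : x ∈ ball y η₀) : seg y x ⊆ G := by
  have hclosed := hG.compact.isClosed
  have key : ∀ x ∈ G, x ∈ ball y η₀ → x ∈ ⋃₀ 𝓕 → ∀ t ∈ Icc (0:ℝ) 1, pt y x t ∈ G := by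
    rintro x hx hxb ⟨F, hF, hxF⟩ t ht
    rcases eq_or_ne x y with rfl | hxy
    · have := (btw_pt x x t).eq_of_self
      rwa [this]
    rcases ht.1.eq_or_lt with rfl | h0
    · rwa [pt_zero]
    obtain ⟨h, hh⟩ := hP.chart F hF
    have hyF := hg.mem_closure F hF ⟨x, hxF, hxb⟩
    have hSF : ∀ s ∈ Ioc (0:ℝ) 1, pt y x s ∈ F := fun s hs =>
      hh.star y hyF x hxF _ (btw_pt y x s) (by
        rw [← dist_pos, dist_comm, dist_pt ⟨hs.1.le, hs.2⟩]
        exact mul_pos hs.1 (dist_pos.2 hxy.symm))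
    have hSγ : ∀ s, pt y x s ∉ γ.img := fun s hs => 
      disjoint_left.1 hd ((btw_pt y x s).mem_ball (mem_ball_self hg.pos) hxb) hs
    have hpre : IsPreconnected (pt y x '' Ioc 0 1) :=
      isPreconnected_Ioc.image _ (continuous_pt_right y x).continuousOn
    have hne : (pt y x '' Ioc 0 1 ∩ ((G ∩ F) \ γ.img)).Nonempty :=
      ⟨x, ⟨1, (by simp : (1:ℝ) ∈ Ioc (0:ℝ) 1), pt_one y x⟩, ⟨hx, hxF⟩, fun hxγ => disjoint_left.1 hd hxb hxγ⟩
    have := hpre.subset_left_of_subset_union (hG.isOpen_inter_face hP hF) hclosed.isOpen_compl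
      (disjoint_left.2 fun z hz hz' => hz' hz.1.1) (by
        rintro _ ⟨s, hs, rfl⟩
        by_cases hsG : pt y x s ∈ G
        · exact Or.inl ⟨⟨hsG, hSF s hs⟩, hSγ s⟩
        · exact Or.inr hsG) hne
    exact (this (mem_image_of_mem _ (⟨h0, ht.2⟩ : t ∈ Ioc (0:ℝ) 1))).1.1
  rw [seg_eq_image]
  rintro _ ⟨t, ht, rfl⟩
  have hxc : x ∈ closure (G ∩ ⋃₀ 𝓕) := hG.mem_closure_faces hP hx fun hxγ => hd.le_bot ⟨hxb, hxγ⟩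
  have hxc' : x ∈ closure (G ∩ ⋃₀ 𝓕 ∩ ball y η₀) :=
    mem_closure_iff_nhdsWithin_neBot.2 (by
      rw [nhdsWithin_inter_of_mem' (nhdsWithin_le_nhds (isOpen_ball.mem_nhds hxb))]
      exact mem_closure_iff_nhdsWithin_neBot.1 hxc)
  have hc : Continuous fun x => pt y x t :=
    continuous_pt.comp (by fun_prop : Continuous fun x : X => (y, x, t))
  exact closure_minimal (s := G ∩ ⋃₀ 𝓕 ∩ ball y η₀) (t := (fun x => pt y x t) ⁻¹' G)
    (fun z hz => key z hz.1.1 hz.2 hz.1.2 t ht) (hclosed.preimage hc) hxc'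

/-- Geodesics arriving at a point of a minimal unwinding set extend inside it to the curve. -/
theorem MinUnwind.exists_extension (hG : MinUnwind G γ) (hP : LocallyPlanar 𝓕) {y : X} (hy : y ∈ G)
    (o : X) : ∃ w ∈ γ.img, Btw o y w ∧ seg y w ⊆ G ∧ ∀ z, Btw y z w → z ∈ γ.img → z = w := by
  have hclosed := hG.compact.isClosed
  obtain ⟨w, ⟨hwG, hbw, hsw⟩, hmax⟩ : ∃ w ∈ {w ∈ G | Btw o y w ∧ seg y w ⊆ G},
      IsMaxOn (fun w => dist o w) {w ∈ G | Btw o y w ∧ seg y w ⊆ G} w := by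
    have hne : {w ∈ G | Btw o y w ∧ seg y w ⊆ G}.Nonempty :=
      ⟨y, hy, btw_right o y, fun z hz => by rw [Btw.eq_of_self hz]; exact hy⟩
    refine IsCompact.exists_isMaxOn ?_ hne (by fun_prop)
    · have : {w ∈ G | Btw o y w ∧ seg y w ⊆ G} =
          G ∩ ({w | Btw o y w} ∩ ⋂ t ∈ Icc (0:ℝ) 1, (fun w => pt y w t) ⁻¹' G) := by
        ext w
        simp only [seg_eq_image, image_subset_iff, mem_inter_iff, mem_ofPred_eq, mem_iInter,
          mem_preimage]
        rfl
      rw [this]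
      refine hG.compact.inter_right (IsClosed.inter (isClosed_eq (by fun_prop) (by fun_prop))
        (isClosed_biInter fun t ht => hclosed.preimage ?_))
      exact continuous_pt.comp (by fun_prop : Continuous fun x : X => (y, x, t))
  have hwγ : w ∈ γ.img := by
    by_contra hwγ
    obtain ⟨η₀, hg, hb⟩ := hP.exists_radius_lt w
      (γ.isCompact_img.isClosed.isOpen_compl.mem_nhds hwγ)
    have hpos := hg.pos
    have hd : Disjoint (ball w η₀) γ.img := disjoint_left.2 fun x hx => hb hx
    obtain ⟨w', ⟨hw'G, hw's⟩, hbo⟩ := hG.exists_antipode hP hwG hg (η := η₀ / 2)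
      ⟨by positivity, by linarith⟩ (hd.mono_left (ball_subset_ball (by linarith))) o
    rw [mem_sphere'] at hw's
    have hs' := hG.seg_subset hP hwG hg hd hw'G (by rw [mem_ball', hw's]; linarith)
    have hyw := hbo.trans_left' hbw
    have hle : dist o w' ≤ dist o w := hmax ⟨hw'G, hbo.trans_left hbw, fun z hz => by
      rcases Btw.split hz hyw with h | h
      · exact hsw h
      · exact hs' h⟩
    unfold Btw at hbo
    linarith
  obtain ⟨w₁, ⟨hw₁s, hw₁γ⟩, hmin⟩ := ((isCompact_seg y w).inter γ.isCompact_img).exists_isMinOn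
    ⟨w, btw_right y w, hwγ⟩ (f := fun z => dist y z) (by fun_prop)
  refine ⟨w₁, hw₁γ, hbw.trans_right' hw₁s, fun z hz => hsw (Btw.trans_left hw₁s hz), fun z hz hzγ => ?_⟩
  have hle : dist y w₁ ≤ dist y z := hmin ⟨Btw.trans_left hw₁s hz, hzγ⟩
  unfold Btw at hz
  exact dist_le_zero.1 (by linarith)

theorem MinUnwind.subset_interior (hG : MinUnwind G γ) (hP : LocallyPlanar 𝓕) :
    G ⊆ γ.img ∪ γ.interiorSet := by
  intro y hy
  by_contra hcon
  simp only [mem_union, not_or, SCC.interiorSet, mem_ofPred_eq, not_and, not_not] at hcon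
  obtain ⟨hyγ, hn⟩ := hcon
  have hsub : γ.img ⊆ {y}ᶜ := fun x hx h => hyγ (h ▸ hx)
  obtain ⟨C, hC, hγC, hCy, hCu⟩ := γ.exists_compact_unwinds hsub (hn hyγ hsub)
  obtain ⟨η₀, hg, hb⟩ := hP.exists_radius_lt y
    (hC.isClosed.isOpen_compl.mem_nhds fun h => hCy h rfl)
  have hpos := hg.pos
  set η := η₀ / 2
  have hη0 : 0 < η := by positivity
  have hb' : ball y η ⊆ Cᶜ := (ball_subset_ball (by simp only [η]; linarith)).trans hb
  have hd : Disjoint (ball y η) γ.img := disjoint_left.2 fun x hx hx' => hb' hx (hγC hx')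
  have hnu := hG.not_unwinds_diff isOpen_ball hd hy (mem_ball_self hη0)
  unfold Unwinds at hnu
  push Not at hnu
  obtain ⟨θ, hθ, hθn⟩ := hnu
  have hGb := hG.compact.diff (isOpen_ball (x := y) (ε := η))
  set Z := (G \ ball y η) ∪ C
  have hZc : IsCompact Z := hGb.union hC
  have hZd : ∀ x ∈ Z, η ≤ dist y x := by
    rintro x (hx | hx)
    · have := hx.2; rwa [mem_ball', not_lt] at this
    · by_contra! h; exact hb' (mem_ball'.2 h) hx
  have hr : ContinuousOn (rad y η) Z := (continuousOn_rad y).comp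
    (f := fun x : X => (η, x)) (by fun_prop) fun x hx h => by
      have := hZd x hx
      change x = y at h
      rw [h, dist_self] at this; linarith
  have hsG : G ∩ sphere y η ⊆ G \ ball y η := fun x hx => ⟨hx.1, by
    have := hx.2
    rw [mem_sphere] at this
    rw [mem_ball, this]; exact lt_irrefl _⟩
  obtain ⟨φ, hφ, he⟩ := hP.exists_sphere_extension hg (η := η) ⟨hη0, by simp only [η]; linarith⟩
    (hG.compact.inter_right isClosed_sphere) (hZc.image_of_continuousOn hr) (by
      rintro _ ⟨x, hx, rfl⟩
      rw [mem_sphere']; exact dist_rad hη0.le (hZd x hx)) (hθ.mono hsG)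
  have hψ : ContinuousOn (fun x => φ (rad y η x)) Z :=
    hφ.comp hr fun x hx => Or.inr (mem_image_of_mem _ hx)
  have hψl := hCu _ (hψ.mono subset_union_right)
  obtain ⟨χ, h1, h2, -⟩ := exists_union_extension hGb.isClosed
    (isClosed_closedBall (x := y) (ε := η)) (θ := fun x => θ x * (φ (rad y η x))⁻¹)
    (φ := fun _ => 1) (hθ.mul (hψ.mono subset_union_left).inv) continuousOn_const fun x hx => by
      have hxs : x ∈ G ∩ sphere y η := ⟨hx.1.1, le_antisymm hx.2 (not_lt.1 hx.1.2)⟩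
      have hxr : rad y η x = x := by
        have := hxs.2
        rw [mem_sphere'] at this
        rw [← this]; exact rad_dist y x
      simp only [hxr, he hxs, mul_inv_cancel]
  have hχl := hG.unwinds χ (h1.mono fun x hx => by
    by_cases hb : x ∈ ball y η
    · exact Or.inr (ball_subset_closedBall hb)
    · exact Or.inl ⟨hx, hb⟩)
  refine hθn ((hχl.mul hψl).congr fun x hx => ?_)
  simp only
  rw [h2 ⟨hG.subset hx, fun hb => hd.le_bot ⟨hb, hx⟩⟩]
  simp

end Extend

end Cat2Cx

end

noncomputable section

namespace Cat2Cx

section Chords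
variable {X : Type*} [MetricSpace X] {G : Set X} {γ : SCC X} {𝓕 : Set (Set X)}

/-- Near `z`, chords of `Γ` lying in `E` are contained in `Γ`. -/
def ChordAt (E Γ : Set X) (z : X) : Prop :=
  ∃ ρ > 0, ∀ w ∈ Γ, ∀ w' ∈ Γ, w ∈ ball z ρ → w' ∈ ball z ρ → seg w w' ⊆ E → seg w w' ⊆ Γ

variable [CAT0Space X]

/-- Strong convexity along geodesics. -/
def StronglyConvex (g : X → ℝ) : Prop := ∃ c > 0, ∀ x y z, Btw x z y →
  g z * dist x y ≤ dist z y * g x + dist x z * g y - c * dist x z * dist z y * dist x y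

/-- The points of `A` lying on geodesics of `G` from `y` to `P`. -/
def exitSet (G P A : Set X) (y : X) : Set X := {x ∈ A | ∃ w ∈ P, Btw y x w ∧ seg y w ⊆ G}

theorem isCompact_exitSet {P A : Set X} (hG : IsClosed G) (hP : IsCompact P) (hA : IsCompact A)
    (y : X) : IsCompact (exitSet G P A y) := by
  have : exitSet G P A y = Prod.fst '' ((A ×ˢ P) ∩ ({v : X × X | Btw y v.1 v.2} ∩
      ⋂ t ∈ Icc (0:ℝ) 1, (fun v : X × X => pt y v.2 t) ⁻¹' G)) := by
    ext x
    simp only [exitSet, seg_eq_image, image_subset_iff, mem_image, mem_inter_iff, mem_ofPred_eq,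
      mem_iInter, mem_preimage, mem_prod, Prod.exists, exists_and_right, exists_eq_right]
    exact ⟨fun ⟨h, w, h1, h2, h3⟩ => ⟨w, ⟨h, h1⟩, h2, h3⟩, fun ⟨w, ⟨h, h1⟩, h2, h3⟩ => ⟨h, w, h1, h2, h3⟩⟩
  rw [this]
  refine IsCompact.image ((hA.prod hP).inter_right (IsClosed.inter
    (isClosed_eq (by fun_prop) (by fun_prop))
    (isClosed_biInter fun t ht => hG.preimage ?_))) continuous_fst
  exact continuous_pt.comp (by fun_prop : Continuous fun v : X × X => (y, v.2, t))

theorem LocallyPlanar.allLog_exitSet (hP : LocallyPlanar 𝓕) (hG : IsClosed G) {y : X} {η₀ η : ℝ}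
    (hg : GoodRadius 𝓕 y η₀) (hη : η ∈ Ioo 0 η₀) {P A : Set X} (hPc : IsCompact P)
    (hA : IsCompact A) (hAs : A ⊆ sphere y η)
    (hno : ∀ w ∈ P, ∀ w' ∈ P, seg y w ⊆ G → seg y w' ⊆ G → ¬ Btw w y w') :
    AllLog (exitSet G P A y) := by
  rcases (exitSet G P A y).eq_empty_or_nonempty with h | ⟨x₀, hx₀, w₀, hw₀, hb₀, hs₀⟩
  · rw [h]; exact allLog_of_finite finite_empty
  refine hP.allLog_of_no_antipode hg hη (isCompact_exitSet hG hPc hA y)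
    (fun x hx => hAs hx.1) (o := w₀) ?_
  rintro a ⟨ha, w, hw, hb, hs⟩ hcon
  refine hno w₀ hw₀ w hw hs₀ hs (hcon.concat hb ?_).2
  rintro rfl
  have := hAs ha
  rw [mem_sphere, dist_self] at this
  exact hη.1.ne this

theorem MinUnwind.not_chordAt_of_isMax (hG : MinUnwind G γ) (hP : LocallyPlanar 𝓕) {E : Set X}
    (hGE : G ⊆ E) {g : X → ℝ} (hgc : Continuous g) (hg : StronglyConvex g) {z : X}
    (hz : z ∈ γ.img) (hmax : ∀ x ∈ γ.img, g x ≤ g z) : ¬ ChordAt E γ.img z := by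
  rintro ⟨ρ₀, hρ₀, hch⟩
  obtain ⟨c, hc, hg⟩ := hg
  set ρ := ρ₀ / 2 with hρ
  have hρ0 : 0 < ρ := by positivity
  obtain ⟨δ, hδ, hgδ⟩ := Metric.continuous_iff.1 hgc z (c * (ρ / 2) ^ 2) (by positivity)
  obtain ⟨y, ⟨hyG, hyγ⟩, hyz⟩ := Metric.mem_closure_iff.1 (hG.subset_closure_diff hz)
    (min δ (ρ / 2)) (lt_min hδ (by positivity))
  have hgy : g z - c * (ρ / 2) ^ 2 < g y := by
    have := hgδ y (by rw [dist_comm]; exact hyz.trans_le (min_le_left _ _))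
    rw [Real.dist_eq, abs_lt] at this
    linarith [this.1]
  have hyz' : dist z y < ρ / 2 := hyz.trans_le (min_le_right _ _)
  have near : ∀ w ∈ γ.img ∩ closedBall z ρ, ∀ w' ∈ γ.img ∩ closedBall z ρ, seg y w ⊆ G →
      seg y w' ⊆ G → ¬ Btw w y w' := by
    intro w hw w' hw' h1 h2 hb
    have hin : closedBall z ρ ⊆ ball z ρ₀ := closedBall_subset_ball (by rw [hρ]; linarith)
    refine hyγ (hch w hw.1 w' hw'.1 (hin hw.2) (hin hw'.2) (fun x hx => hGE ?_) hb)
    rcases Btw.split hx hb with h | h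
    · exact h1 h.symm
    · exact h2 h
  have far : ∀ w ∈ γ.img \ ball z ρ, ∀ w' ∈ γ.img \ ball z ρ, seg y w ⊆ G →
      seg y w' ⊆ G → ¬ Btw w y w' := by
    intro w hw w' hw' _ _ hb
    have h1 := hg w w' y hb
    have d1 : ρ / 2 ≤ dist w y := by
      have := hw.2
      rw [mem_ball, not_lt] at this
      linarith [dist_triangle w y z, dist_comm z y]
    have d2 : ρ / 2 ≤ dist y w' := by
      have := hw'.2
      rw [mem_ball, not_lt] at this
      linarith [dist_triangle w' y z, dist_comm z y, dist_comm y w']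
    have hb' : dist w y + dist y w' = dist w w' := hb
    have hD : 0 < dist w w' := by linarith
    have m1 := hmax w hw.1
    have m2 := hmax w' hw'.1
    have : g y * dist w w' ≤ (g z - c * (dist w y * dist y w')) * dist w w' := by
      have e1 := mul_le_mul_of_nonneg_left m1 (dist_nonneg (x := y) (y := w'))
      have e2 := mul_le_mul_of_nonneg_left m2 (dist_nonneg (x := w) (y := y))
      rw [← hb'] at h1 ⊢
      linarith
    have h2 := le_of_mul_le_mul_right this hD
    have h3 : (ρ / 2) ^ 2 ≤ dist w y * dist y w' := by nlinarith
    nlinarith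
  obtain ⟨η₀, hr, hb⟩ := hP.exists_radius_lt y (γ.isCompact_img.isClosed.isOpen_compl.mem_nhds hyγ)
  have hpos := hr.pos
  have hη : η₀ / 2 ∈ Ioo 0 η₀ := ⟨by positivity, by linarith⟩
  have hd : Disjoint (ball y η₀) γ.img := disjoint_left.2 fun x hx => hb hx
  set A := G ∩ sphere y (η₀ / 2) with hA
  have hAc : IsCompact A := hG.compact.inter_right isClosed_sphere
  have hcl := hG.compact.isClosed
  have hPn : IsCompact (γ.img ∩ closedBall z ρ) := γ.isCompact_img.inter_right isClosed_closedBall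
  have hPf : IsCompact (γ.img \ ball z ρ) := γ.isCompact_img.diff isOpen_ball
  refine hG.not_allLog_sphere hyG hη.1 (hd.mono_left (ball_subset_ball hη.2.le)) ?_
  have hun : A = exitSet G (γ.img ∩ closedBall z ρ) A y ∪ exitSet G (γ.img \ ball z ρ) A y := by
    refine Subset.antisymm (fun x hx => ?_) (union_subset (fun x hx => hx.1) fun x hx => hx.1)
    obtain ⟨w, hw, hbw, hs, -⟩ := hG.exists_extension hP hx.1 y
    have hxb : x ∈ ball y η₀ := by
      have := hx.2
      rw [mem_sphere] at this
      rw [mem_ball, this]; exact hη.2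
    have hs' : seg y w ⊆ G := fun u hu => by
      rcases Btw.split hu hbw with h | h
      · exact hG.seg_subset hP hyG hr hd hx.1 hxb h
      · exact hs h
    by_cases hwb : w ∈ ball z ρ
    · exact Or.inl ⟨hx, w, ⟨hw, ball_subset_closedBall hwb⟩, hbw, hs'⟩
    · exact Or.inr ⟨hx, w, ⟨hw, hwb⟩, hbw, hs'⟩
  change AllLog A
  rw [hun]
  refine AllLog.union (hP.allLog_exitSet hcl hr hη hPn hAc inter_subset_right near)
    (hP.allLog_exitSet hcl hr hη hPf hAc inter_subset_right far)
    (isCompact_exitSet hcl hPn hAc y).isClosed (isCompact_exitSet hcl hPf hAc y).isClosed ?_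
  convert isPreconnected_empty
  rw [eq_empty_iff_forall_notMem]
  rintro x ⟨⟨hx, w, hw, hbw, hs⟩, ⟨-, w', hw', hbw', hs'⟩⟩
  obtain ⟨v, hv, hbv, hsv, -⟩ := hG.exists_extension hP hyG x
  have hxy : x ≠ y := by
    rintro rfl
    have := hx.2
    rw [mem_sphere, dist_self] at this
    linarith
  by_cases hvb : v ∈ ball z ρ
  · exact near w hw v ⟨hv, ball_subset_closedBall hvb⟩ hs hsv (hbw.symm.concat hbv hxy).1
  · exact far w' hw' v ⟨hv, hvb⟩ hs' hsv (hbw'.symm.concat hbv hxy).1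

theorem SCC.exists_notMem_seg (γ : SCC X) (a b : X) : ∃ z ∈ γ.img, z ∉ seg a b := by
  by_contra! h
  exact γ.not_allLog (AllLog.of_inj_real γ.isCompact_img (f := fun x => dist a x) (by fun_prop)
    fun x hx y hy he => Btw.unique (h x hx) (h y hy) he)

/-- A closed curve bounding in `E` has a short-cut in `E` away from any given segment. -/
theorem LocallyPlanar.exists_not_chordAt (hP : LocallyPlanar 𝓕) {E : Set X} (hH1 : H1Trivial E)
    (hγ : γ.img ⊆ E) (a b : X) : ∃ z ∈ γ.img, z ∉ seg a b ∧ ¬ ChordAt E γ.img z := by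
  obtain ⟨C, hC, hγC, hCE, hCu⟩ := γ.exists_compact_unwinds hγ (hH1 _ _)
  obtain ⟨G, hGC, hG⟩ := exists_minUnwind hC hγC hCu
  obtain ⟨z₀, hz₀, hz₀'⟩ := γ.exists_notMem_seg a b
  have hlt : dist a b < dist a z₀ + dist z₀ b :=
    (dist_triangle a z₀ b).lt_of_ne fun h => hz₀' h.symm
  set ε := (dist a z₀ + dist z₀ b - dist a b) / (2 * (dist a b ^ 2 + 1)) with hε
  have hε0 : 0 < ε := by
    have : 0 < dist a z₀ + dist z₀ b - dist a b := by linarith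
    positivity
  have hε1 : ε * dist a b ^ 2 < dist a z₀ + dist z₀ b - dist a b := by
    rw [hε, div_mul_eq_mul_div, div_lt_iff₀ (by positivity)]
    nlinarith [sq_nonneg (dist a b)]
  let g : X → ℝ := fun x => dist a x + dist b x + ε * dist a x ^ 2
  have hgc : Continuous g := by fun_prop
  obtain ⟨z, hz, hmax⟩ := γ.isCompact_img.exists_isMaxOn ⟨z₀, hz₀⟩ hgc.continuousOn
  refine ⟨z, hz, fun hzs => ?_, hG.not_chordAt_of_isMax hP (hGC.trans hCE) hgc ⟨ε, hε0, ?_⟩ hz hmax⟩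
  · have h1 : g z₀ ≤ g z := hmax hz₀
    have h2 : dist a z + dist z b = dist a b := hzs
    have h3 := (Btw.dist_le_left hzs)
    have h4 : dist a z ^ 2 ≤ dist a b ^ 2 := pow_le_pow_left₀ dist_nonneg h3 2
    simp only [g, dist_comm b] at h1
    nlinarith [sq_nonneg (dist a z₀)]
  · intro x y z hb
    obtain ⟨t, ht, h1, h2⟩ := hb.frac
    have c1 := mul_le_mul_of_nonneg_right (dist_convex (o := a) ht h1 h2) (dist_nonneg (x := x) (y := y))
    have c2 := mul_le_mul_of_nonneg_right (dist_convex (o := b) ht h1 h2) (dist_nonneg (x := x) (y := y))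
    have c3 := mul_le_mul_of_nonneg_right (CAT0Space.stewart a x y z t ht h1 h2)
      (mul_nonneg hε0.le (dist_nonneg (x := x) (y := y)))
    simp only [g]
    rw [h1, h2]
    linarith

end Chords

end Cat2Cx

end

noncomputable section

namespace Cat2Cx

section Intrinsic
variable {X : Type*} [MetricSpace X] {E : Set X}

theorem dist_le_pathDistIn (hE : RectConnected E) {x y : X} (hx : x ∈ E) (hy : y ∈ E) :
    dist x y ≤ pathDistIn E x y := by
  unfold pathDistIn
  have hle : edist x y ≤ ⨅ g : {g : ℝ → X // IsPathIn E g x y}, eVariationOn g.1 (Icc 0 1) := by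
    refine le_iInf fun g => ?_
    obtain ⟨g, -, h0, h1, -⟩ := g
    have := eVariationOn.edist_le g (s := Icc (0:ℝ) 1) (x := 0) (y := 1) (by simp) (by simp)
    rwa [h0, h1] at this
  have hne : (⨅ g : {g : ℝ → X // IsPathIn E g x y}, eVariationOn g.1 (Icc 0 1)) ≠ ⊤ := by
    obtain ⟨g, hg, hv⟩ := hE x hx y hy
    exact ((iInf_le _ (⟨g, hg⟩ : {g : ℝ → X // IsPathIn E g x y})).trans_lt hv.lt_top).ne
  rw [dist_edist]
  exact ENNReal.toReal_mono hne hle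

/-- A unit speed geodesic of `E` with its path metric. -/
def YGeod (E : Set X) (f : ℝ → X) (a b : ℝ) : Prop :=
  IsGeodesicWrt (pathDistIn E) f a b ∧ MapsTo f (Icc a b) E

theorem YGeod.mono {f : ℝ → X} {a b c d : ℝ} (h : YGeod E f a b) (hac : a ≤ c) (hcd : c ≤ d)
    (hdb : d ≤ b) : YGeod E f c d :=
  ⟨⟨hcd, fun s hs t ht => h.1.2 s (Icc_subset_Icc hac hdb hs) t (Icc_subset_Icc hac hdb ht)⟩,
    h.2.mono_left (Icc_subset_Icc hac hdb)⟩

theorem YGeod.dist_le {f : ℝ → X} {a b : ℝ} (hE : RectConnected E) (h : YGeod E f a b) {s t : ℝ}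
    (hs : s ∈ Icc a b) (ht : t ∈ Icc a b) : dist (f s) (f t) ≤ |s - t| := by
  rw [← h.1.2 s hs t ht]
  exact dist_le_pathDistIn hE (h.2 hs) (h.2 ht)

theorem YGeod.continuousOn {f : ℝ → X} {a b : ℝ} (hE : RectConnected E) (h : YGeod E f a b) :
    ContinuousOn f (Icc a b) :=
  LipschitzOnWith.continuousOn (K := 1) (LipschitzOnWith.of_dist_le_mul fun s hs t ht => by
    simpa [Real.dist_eq] using h.dist_le hE hs ht)

theorem YGeod.injOn {f : ℝ → X} {a b : ℝ} (h : YGeod E f a b) : InjOn f (Icc a b) := by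
  intro s hs t ht he
  have h1 := h.1.2 s hs t ht
  rw [← he, h.1.2 s hs s hs, sub_self, abs_zero] at h1
  exact sub_eq_zero.1 (abs_eq_zero.1 h1.symm)

theorem YGeod.reverse {f : ℝ → X} {b : ℝ} (h : YGeod E f 0 b) : YGeod E (fun t => f (b - t)) 0 b := by
  have hm : ∀ s ∈ Icc 0 b, b - s ∈ Icc 0 b := fun s hs => ⟨by linarith [hs.2], by linarith [hs.1]⟩
  refine ⟨⟨h.1.1, fun s hs t ht => ?_⟩, fun s hs => h.2 (hm s hs)⟩
  rw [h.1.2 _ (hm s hs) _ (hm t ht), abs_sub_comm]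
  congr 1; ring

variable [CAT0Space X]

theorem pathDistIn_le_dist {x y : X} (h : seg x y ⊆ E) : pathDistIn E x y ≤ dist x y := by
  have hmaps : MapsTo (pt x y) (Icc 0 1) E := fun t _ => h (btw_pt x y t)
  have hpath : IsPathIn E (pt x y) x y :=
    ⟨(continuous_pt_right x y).continuousOn, pt_zero x y, pt_one x y, hmaps⟩
  have hl : LipschitzOnWith (nndist x y) (pt x y) (Icc 0 1) :=
    LipschitzOnWith.of_dist_le_mul fun s hs t ht => by
      rw [dist_pt_pt hs ht, coe_nndist, Real.dist_eq, mul_comm]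
  have h1 : eVariationOn (pt x y) (Icc 0 1) ≤ ENNReal.ofReal (dist x y) := by
    have h2 := hl.comp_eVariationOn_le (g := id) (s := Icc (0:ℝ) 1) (mapsTo_id _)
    have h3 := (monotone_id.monotoneOn (Icc (0:ℝ) 1)).eVariationOn_eq (a := 0) (b := 1)
      (by simp) (by simp)
    rw [inter_self] at h3
    refine h2.trans ((mul_le_mul_right h3.le _).trans ?_)
    simp [ENNReal.ofReal, nndist_dist]
  unfold pathDistIn
  refine ENNReal.toReal_le_of_le_ofReal dist_nonneg ((iInf_le _ ⟨pt x y, hpath⟩).trans h1)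

/-- A chord in `E` of a geodesic of `E` is a part of the geodesic. -/
theorem YGeod.seg_eq {f : ℝ → X} {s t : ℝ} (hE : RectConnected E) (h : YGeod E f s t)
    (hs : seg (f s) (f t) ⊆ E) : seg (f s) (f t) = f '' Icc s t := by
  have hst := h.1.1
  have ms : s ∈ Icc s t := ⟨le_rfl, hst⟩
  have mt : t ∈ Icc s t := ⟨hst, le_rfl⟩
  have hd : dist (f s) (f t) = t - s := by
    refine le_antisymm ?_ ?_
    · have := h.dist_le hE ms mt
      rwa [abs_sub_comm, abs_of_nonneg (sub_nonneg.2 hst)] at this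
    · have := pathDistIn_le_dist hs
      rwa [h.1.2 s ms t mt, abs_sub_comm, abs_of_nonneg (sub_nonneg.2 hst)] at this
  have key : ∀ u ∈ Icc s t, dist (f s) (f u) = u - s ∧ Btw (f s) (f u) (f t) := by
    intro u hu
    have h1 := h.dist_le hE ms hu
    have h2 := h.dist_le hE hu mt
    rw [abs_sub_comm, abs_of_nonneg (sub_nonneg.2 hu.1)] at h1
    rw [abs_sub_comm, abs_of_nonneg (sub_nonneg.2 hu.2)] at h2
    have h3 := dist_triangle (f s) (f u) (f t)
    exact ⟨by linarith, by unfold Btw; linarith⟩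
  refine Subset.antisymm (fun z hz => ?_) ?_
  · have hz' : dist (f s) z ≤ t - s := hd ▸ Btw.dist_le_left hz
    have hu : s + dist (f s) z ∈ Icc s t := ⟨by linarith [dist_nonneg (x := f s) (y := z)], by linarith⟩
    refine ⟨_, hu, ?_⟩
    refine (key _ hu).2.unique hz ?_
    rw [(key _ hu).1]; ring
  · rintro _ ⟨u, hu, rfl⟩
    exact (key u hu).2

theorem YGeod.seg_subset {f : ℝ → X} {a b : ℝ} (hE : RectConnected E) (h : YGeod E f a b) {x y : X}
    (hx : x ∈ f '' Icc a b) (hy : y ∈ f '' Icc a b) (hs : seg x y ⊆ E) :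
    seg x y ⊆ f '' Icc a b := by
  obtain ⟨s, hs', rfl⟩ := hx
  obtain ⟨t, ht, rfl⟩ := hy
  rcases le_total s t with hst | hst
  · rw [(h.mono hs'.1 hst ht.2).seg_eq hE hs]
    exact image_mono (Icc_subset_Icc hs'.1 ht.2)
  · rw [seg_comm] at hs ⊢
    rw [(h.mono ht.1 hst hs'.2).seg_eq hE hs]
    exact image_mono (Icc_subset_Icc ht.1 hs'.2)

end Intrinsic

section Arcs
variable {X : Type*} [TopologicalSpace X]

/-- `S` is an arc from `x` to `y`. -/
def IsArc (S : Set X) (x y : X) : Prop := ∃ f : ℝ → X, ContinuousOn f (Icc 0 1) ∧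
  InjOn f (Icc 0 1) ∧ f 0 = x ∧ f 1 = y ∧ f '' Icc 0 1 = S

theorem isArc_of_injOn {f : ℝ → X} {a b : ℝ} (hab : a < b) (hc : ContinuousOn f (Icc a b))
    (hi : InjOn f (Icc a b)) : IsArc (f '' Icc a b) (f a) (f b) := by
  have hd : 0 < b - a := sub_pos.2 hab
  have him : (fun t => a + t * (b - a)) '' Icc 0 1 = Icc a b := by
    ext u; constructor
    · rintro ⟨t, ht, rfl⟩
      exact ⟨by nlinarith [ht.1], by nlinarith [ht.2]⟩
    · intro hu
      exact ⟨(u - a) / (b - a), ⟨div_nonneg (by linarith [hu.1]) hd.le,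
        (div_le_one hd).2 (by linarith [hu.2])⟩, by field_simp; ring⟩
  have hm : MapsTo (fun t => a + t * (b - a)) (Icc 0 1) (Icc a b) := fun t ht =>
    him.subset (mem_image_of_mem _ ht)
  refine ⟨fun t => f (a + t * (b - a)), hc.comp (by fun_prop) hm, fun s hs t ht he => ?_, by simp,
    by simp, ?_⟩
  · have := hi (hm hs) (hm ht) he
    have : s * (b - a) = t * (b - a) := by linarith
    exact mul_right_cancel₀ hd.ne' this
  · rw [← him, image_image]

theorem IsArc.symm {S : Set X} {x y : X} (h : IsArc S x y) : IsArc S y x := by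
  obtain ⟨f, hc, hi, h0, h1, him⟩ := h
  have hm : MapsTo (fun t : ℝ => 1 - t) (Icc 0 1) (Icc 0 1) := fun t ht =>
    ⟨by linarith [ht.2], by linarith [ht.1]⟩
  refine ⟨fun t => f (1 - t), hc.comp (by fun_prop) hm, fun s hs t ht he => ?_, by simpa using h1,
    by simpa using h0, ?_⟩
  · linarith [hi (hm hs) (hm ht) he]
  · rw [← him]
    refine Subset.antisymm ?_ ?_
    · rintro _ ⟨t, ht, rfl⟩; exact ⟨_, hm ht, rfl⟩
    · rintro _ ⟨t, ht, rfl⟩; exact ⟨1 - t, hm ht, by simp⟩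

/-- Concatenation of two paths on `[0,1]` and `[1,2]`. -/
theorem exists_concat {S S' : Set X} {x y z : X} (h : IsArc S x y) (h' : IsArc S' y z) :
    ∃ f : ℝ → X, ContinuousOn f (Icc 0 2) ∧ InjOn f (Icc 0 1) ∧ InjOn f (Icc 1 2) ∧
      f 0 = x ∧ f 1 = y ∧ f 2 = z ∧ f '' Icc 0 1 = S ∧ f '' Icc 1 2 = S' := by
  obtain ⟨f, hc, hi, h0, h1, him⟩ := h
  obtain ⟨g, gc, gi, g0, g1, gim⟩ := h'
  let k : ℝ → X := fun t => if t ≤ 1 then f t else g (t - 1)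
  have e1 : ∀ t ∈ Icc (0:ℝ) 1, k t = f t := fun t ht => if_pos ht.2
  have e2 : ∀ t ∈ Icc (1:ℝ) 2, k t = g (t - 1) := fun t ht => by
    rcases ht.1.eq_or_lt with rfl | hlt
    · simp [k, h1, g0]
    · exact if_neg (not_le.2 hlt)
  have hm : MapsTo (fun t : ℝ => t - 1) (Icc 1 2) (Icc 0 1) := fun t ht =>
    ⟨by linarith [ht.1], by linarith [ht.2]⟩
  refine ⟨k, ?_, fun s hs t ht he => hi hs ht (by rwa [e1 s hs, e1 t ht] at he),
    fun s hs t ht he => by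
      rw [e2 s hs, e2 t ht] at he
      linarith [gi (hm hs) (hm ht) he],
    by rw [e1 0 (by simp), h0], by rw [e1 1 (by simp), h1],
    by rw [e2 2 (by simp)]; norm_num [g1], ?_, ?_⟩
  · rw [← Icc_union_Icc_eq_Icc (zero_le_one' ℝ) one_le_two]
    refine ContinuousOn.union_of_isClosed ?_ ?_ isClosed_Icc isClosed_Icc
    · exact hc.congr e1
    · exact (gc.comp (by fun_prop) hm).congr e2
  · rw [← him]; exact image_congr e1
  · rw [← gim]
    refine Subset.antisymm ?_ ?_
    · rintro _ ⟨t, ht, rfl⟩; exact ⟨_, hm ht, (e2 t ht).symm⟩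
    · rintro _ ⟨t, ht, rfl⟩
      have : t + 1 ∈ Icc (1:ℝ) 2 := ⟨by linarith [ht.1], by linarith [ht.2]⟩
      exact ⟨t + 1, this, by rw [e2 _ this]; simp⟩

theorem IsArc.concat {S S' : Set X} {x y z : X} (h : IsArc S x y) (h' : IsArc S' y z)
    (hd : S ∩ S' ⊆ {y}) : IsArc (S ∪ S') x z := by
  obtain ⟨f, hc, i1, i2, h0, h1, h2, m1, m2⟩ := exists_concat h h'
  have hu : Icc (0:ℝ) 1 ∪ Icc 1 2 = Icc 0 2 := Icc_union_Icc_eq_Icc zero_le_one one_le_two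
  have key : ∀ s ∈ Icc (0:ℝ) 1, ∀ t ∈ Icc (1:ℝ) 2, f s = f t → s = t := by
    intro s hs t ht he
    have hy : f s = y := hd ⟨m1 ▸ mem_image_of_mem f hs, he ▸ m2 ▸ mem_image_of_mem f ht⟩
    have s1 : s = 1 := i1 hs (by simp) (hy.trans h1.symm)
    have t1 : t = 1 := i2 ht (by simp) ((he.symm.trans hy).trans h1.symm)
    rw [s1, t1]
  have := isArc_of_injOn (f := f) (a := 0) (b := 2) two_pos hc (by
    rw [← hu]
    rintro s (hs | hs) t (ht | ht) he
    · exact i1 hs ht he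
    · exact key s hs t ht he
    · exact (key t ht s hs he.symm).symm
    · exact i2 hs ht he)
  rw [h0, h2, ← hu, image_union, m1, m2] at this
  exact this

theorem IsArc.exists_scc {S S' : Set X} {x y : X} (h : IsArc S x y) (h' : IsArc S' x y)
    (hd : S ∩ S' ⊆ {x, y}) : ∃ γ : SCC X, γ.img = S ∪ S' := by
  obtain ⟨f, hc, i1, i2, h0, h1, h2, m1, m2⟩ := exists_concat h h'.symm
  have hm : MapsTo (fun t : ℝ => 2 * t) (Icc 0 1) (Icc 0 2) := fun t ht =>
    ⟨by linarith [ht.1], by linarith [ht.2]⟩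
  have key : ∀ s ∈ Ico (0:ℝ) 1, ∀ t ∈ Ico (1:ℝ) 2, f s = f t → False := by
    intro s hs t ht he
    have hs' : s ∈ Icc (0:ℝ) 1 := ⟨hs.1, hs.2.le⟩
    have ht' : t ∈ Icc (1:ℝ) 2 := ⟨ht.1, ht.2.le⟩
    rcases hd ⟨m1 ▸ mem_image_of_mem f hs', he ▸ m2 ▸ mem_image_of_mem f ht'⟩ with hy | hy
    · have := i2 ht' (by simp) ((he.symm.trans hy).trans h2.symm)
      linarith [ht.2]
    · have := i1 hs' (by simp) (hy.trans h1.symm)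
      linarith [hs.2]
  refine ⟨⟨fun t => f (2 * t), hc.comp (by fun_prop) hm, by simp [h0, h2], ?_⟩, ?_⟩
  · intro s hs t ht he
    simp only at he
    rcases lt_or_ge (2 * s) 1 with s1 | s1 <;> rcases lt_or_ge (2 * t) 1 with t1 | t1
    · linarith [i1 ⟨by linarith [hs.1], s1.le⟩ ⟨by linarith [ht.1], t1.le⟩ he]
    · exact (key _ ⟨by linarith [hs.1], s1⟩ _ ⟨t1, by linarith [ht.2]⟩ he).elim
    · exact (key _ ⟨by linarith [ht.1], t1⟩ _ ⟨s1, by linarith [hs.2]⟩ he.symm).elim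
    · linarith [i2 ⟨s1, by linarith [hs.2]⟩ ⟨t1, by linarith [ht.2]⟩ he]
  · have h3 : (fun t : ℝ => 2 * t) '' Icc 0 1 = Icc 0 2 := by
      refine Subset.antisymm hm.image_subset fun t ht => ⟨t / 2, ⟨by linarith [ht.1], by linarith [ht.2]⟩, by ring⟩
    change (fun t => f (2 * t)) '' Icc 0 1 = _
    rw [← m1, ← m2, ← image_union, Icc_union_Icc_eq_Icc (zero_le_one' ℝ) one_le_two, ← h3, image_image]

theorem allLog_image [T2Space X] {K : Set ℝ} (hK : IsCompact K) {f : ℝ → X} (hf : ContinuousOn f K)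
    (hi : InjOn f K) : AllLog (f '' K) := by
  refine AllLog.of_inj_real (hK.image_of_continuousOn hf) (f := Function.invFunOn f K)
    (continuousOn_image_of_comp hK hf ?_) ?_
  · exact continuousOn_id.congr fun t ht => hi.leftInvOn_invFunOn ht
  · rintro _ ⟨s, hs, rfl⟩ _ ⟨t, ht, rfl⟩ he
    rw [hi.leftInvOn_invFunOn hs, hi.leftInvOn_invFunOn ht] at he
    rw [he]

end Arcs

end Cat2Cx

end

noncomputable section

namespace Cat2Cx

section Triangles
variable {X : Type*} [MetricSpace X] [CAT0Space X] {E : Set X} {𝓕 : Set (Set X)}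

/-- A closed curve in `E` is not made of geodesics of `E` with corners on a single segment. -/
theorem LocallyPlanar.not_piecewise_geodesic (hP : LocallyPlanar 𝓕) (hE : RectConnected E)
    (hH1 : H1Trivial E) (γ : SCC X) (hγ : γ.img ⊆ E) (a b : X)
    (h : ∀ z ∈ γ.img, z ∉ seg a b → ∃ (f : ℝ → X) (c d : ℝ) (C : Set X), YGeod E f c d ∧
      f '' Icc c d ⊆ γ.img ∧ IsClosed C ∧ γ.img ⊆ f '' Icc c d ∪ C ∧ z ∉ C) : False := by
  obtain ⟨z, hz, hzs, hn⟩ := hP.exists_not_chordAt hH1 hγ a b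
  obtain ⟨f, c, d, C, hf, hfγ, hC, hsub, hzC⟩ := h z hz hzs
  obtain ⟨ρ, hρ, hb⟩ := Metric.isOpen_iff.1 hC.isOpen_compl z hzC
  refine hn ⟨ρ, hρ, fun w hw w' hw' hwb hwb' hs => ?_⟩
  exact (hf.seg_subset hE ((hsub hw).resolve_right (hb hwb))
    ((hsub hw').resolve_right (hb hwb')) hs).trans hfγ

theorem LocallyPlanar.ygeod_unique (hP : LocallyPlanar 𝓕) (hE : RectConnected E)
    (hH1 : H1Trivial E) {f g : ℝ → X} {d : ℝ} (hf : YGeod E f 0 d) (hg : YGeod E g 0 d)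
    (h0 : f 0 = g 0) (h1 : f d = g d) : EqOn f g (Icc 0 d) := by
  intro s hs
  by_contra hne
  have hcf := hf.continuousOn hE
  have hcg := hg.continuousOn hE
  have hK : IsCompact {t ∈ Icc 0 d | f t = g t} := by
    refine isCompact_Icc.of_isClosed_subset ?_ fun t ht => ht.1
    have : {t ∈ Icc 0 d | f t = g t} = Icc 0 d ∩ (fun t => dist (f t) (g t)) ⁻¹' {0} := by
      ext t; simp [dist_eq_zero]
    rw [this]
    exact (continuous_dist.comp_continuousOn (hcf.prodMk hcg)).preimage_isClosed_of_isClosed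
      isClosed_Icc isClosed_singleton
  have hd := hf.1.1
  obtain ⟨a, ⟨⟨ha, hae⟩, has⟩, hamax⟩ := (hK.inter_right (isClosed_Iic (a := s))).exists_isMaxOn
    (f := id) ⟨0, ⟨⟨le_rfl, hd⟩, h0⟩, hs.1⟩ continuousOn_id
  obtain ⟨b, ⟨⟨hb, hbe⟩, hsb⟩, hbmin⟩ := (hK.inter_right (isClosed_Ici (a := s))).exists_isMinOn
    (f := id) ⟨d, ⟨⟨hd, le_rfl⟩, h1⟩, hs.2⟩ continuousOn_id
  have has' : a < s := lt_of_le_of_ne has fun h => hne (h ▸ hae)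
  have hsb' : s < b := lt_of_le_of_ne hsb fun h => hne (h ▸ hbe)
  have hab : a < b := has'.trans hsb'
  have hfab := hf.mono ha.1 hab.le hb.2
  have hgab := hg.mono ha.1 hab.le hb.2
  have key : ∀ u ∈ Icc a b, f u = g u → u = a ∨ u = b := by
    intro u hu he
    have hu' : u ∈ Icc 0 d := ⟨ha.1.trans hu.1, hu.2.trans hb.2⟩
    rcases le_total u s with hus | hus
    · exact Or.inl (le_antisymm (hamax ⟨⟨hu', he⟩, hus⟩) hu.1)
    · exact Or.inr (le_antisymm hu.2 (hbmin ⟨⟨hu', he⟩, hus⟩))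
  have hpar : ∀ u ∈ Icc a b, ∀ v ∈ Icc a b, f u = g v → u = v := by
    intro u hu v hv he
    have e1 := hf.1.2 0 ⟨le_rfl, hd⟩ u ⟨ha.1.trans hu.1, hu.2.trans hb.2⟩
    have e2 := hg.1.2 0 ⟨le_rfl, hd⟩ v ⟨ha.1.trans hv.1, hv.2.trans hb.2⟩
    rw [h0, he, e2, zero_sub, zero_sub, abs_neg, abs_neg, abs_of_nonneg (ha.1.trans hv.1),
      abs_of_nonneg (ha.1.trans hu.1)] at e1
    exact e1.symm
  have hinter : f '' Icc a b ∩ g '' Icc a b ⊆ {f a, f b} := by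
    rintro _ ⟨⟨u, hu, rfl⟩, ⟨v, hv, hv'⟩⟩
    obtain rfl := hpar u hu v hv hv'.symm
    rcases key u hu hv'.symm with rfl | rfl <;> simp
  have arcg := isArc_of_injOn hab (hgab.continuousOn hE) hgab.injOn
  rw [← hae, ← hbe] at arcg
  obtain ⟨γ, hγ⟩ := (isArc_of_injOn hab (hfab.continuousOn hE) hfab.injOn).exists_scc arcg hinter
  have cf : IsClosed (f '' Icc a b) := (isCompact_Icc.image_of_continuousOn (hfab.continuousOn hE)).isClosed
  have cg : IsClosed (g '' Icc a b) := (isCompact_Icc.image_of_continuousOn (hgab.continuousOn hE)).isClosed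
  refine hP.not_piecewise_geodesic hE hH1 γ ?_ (f a) (f b) ?_
  · rw [hγ]; exact union_subset hfab.2.image_subset hgab.2.image_subset
  · rw [hγ]
    intro z hz hzs
    have hnot : ¬ (z ∈ f '' Icc a b ∧ z ∈ g '' Icc a b) := fun hh => hzs (by
      rcases hinter hh with rfl | rfl
      · exact btw_left _ _
      · exact btw_right _ _)
    rcases hz with hz | hz
    · exact ⟨f, a, b, g '' Icc a b, hfab, subset_union_left, cg, subset_rfl, fun h => hnot ⟨hz, h⟩⟩
    · exact ⟨g, a, b, f '' Icc a b, hgab, subset_union_right, cf, by rw [union_comm], fun h => hnot ⟨h, hz⟩⟩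

/-- Two geodesics of `E` issuing from the same point share an initial part. -/
theorem LocallyPlanar.inter_eq (hP : LocallyPlanar 𝓕) (hE : RectConnected E)
    (hH1 : H1Trivial E) {f g : ℝ → X} {d d' : ℝ} (hf : YGeod E f 0 d) (hg : YGeod E g 0 d')
    (h0 : f 0 = g 0) : ∃ m ∈ Icc 0 d ∩ Icc 0 d', EqOn f g (Icc 0 m) ∧
      f '' Icc 0 d ∩ g '' Icc 0 d' = f '' Icc 0 m ∧
      ∀ s ∈ Icc 0 d, ∀ t ∈ Icc 0 d', f s = g t → s = t ∧ s ≤ m := by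
  have hpar : ∀ u ∈ Icc 0 d, ∀ v ∈ Icc 0 d', f u = g v → u = v := by
    intro u hu v hv he
    have e1 := hf.1.2 0 ⟨le_rfl, hf.1.1⟩ u hu
    have e2 := hg.1.2 0 ⟨le_rfl, hg.1.1⟩ v hv
    rw [h0, he, e2, zero_sub, zero_sub, abs_neg, abs_neg, abs_of_nonneg hv.1,
      abs_of_nonneg hu.1] at e1
    exact e1.symm
  have hK : IsCompact {t ∈ Icc 0 (min d d') | f t = g t} := by
    refine isCompact_Icc.of_isClosed_subset ?_ fun t ht => ht.1
    have : {t ∈ Icc 0 (min d d') | f t = g t} =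
        Icc 0 (min d d') ∩ (fun t => dist (f t) (g t)) ⁻¹' {0} := by
      ext t; simp [dist_eq_zero]
    rw [this]
    exact (continuous_dist.comp_continuousOn
      (((hf.continuousOn hE).mono (Icc_subset_Icc_right (min_le_left _ _))).prodMk
      ((hg.continuousOn hE).mono
        (Icc_subset_Icc_right (min_le_right _ _))))).preimage_isClosed_of_isClosed
      isClosed_Icc isClosed_singleton
  obtain ⟨m, ⟨hm, hme⟩, hmax⟩ := hK.exists_isMaxOn (f := id)
    ⟨0, ⟨le_rfl, le_min hf.1.1 hg.1.1⟩, h0⟩ continuousOn_id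
  have hmd := hm.2.trans (min_le_left _ _)
  have hmd' := hm.2.trans (min_le_right _ _)
  have heq : EqOn f g (Icc 0 m) := hP.ygeod_unique hE hH1 (hf.mono le_rfl hm.1 hmd)
    (hg.mono le_rfl hm.1 hmd') h0 hme
  have hlast : ∀ s ∈ Icc 0 d, ∀ t ∈ Icc 0 d', f s = g t → s = t ∧ s ≤ m := by
    intro s hs t ht he
    obtain rfl := hpar s hs t ht he
    exact ⟨rfl, hmax ⟨⟨hs.1, le_min hs.2 ht.2⟩, he⟩⟩
  refine ⟨m, ⟨⟨hm.1, hmd⟩, ⟨hm.1, hmd'⟩⟩, heq, Subset.antisymm ?_ ?_, hlast⟩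
  · rintro _ ⟨⟨s, hs, rfl⟩, ⟨t, ht, he⟩⟩
    exact ⟨s, ⟨hs.1, (hlast s hs t ht he.symm).2⟩, rfl⟩
  · rintro _ ⟨s, hs, rfl⟩
    exact ⟨⟨s, ⟨hs.1, hs.2.trans hmd⟩, rfl⟩, ⟨s, ⟨hs.1, hs.2.trans hmd'⟩, (heq hs).symm⟩⟩

/-- `S` is a geodesic segment of `E` with endpoints `x` and `y`. -/
def IsSide (E S : Set X) (x y : X) : Prop :=
  ∃ f d, YGeod E f 0 d ∧ f 0 = x ∧ f d = y ∧ f '' Icc 0 d = S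

theorem IsSide.symm {S : Set X} {x y : X} (h : IsSide E S x y) : IsSide E S y x := by
  obtain ⟨f, d, hf, h0, h1, him⟩ := h
  refine ⟨_, d, hf.reverse, by simpa using h1, by simpa using h0, ?_⟩
  rw [← him]
  have := image_const_sub_Icc d 0 d
  simp only [sub_self, sub_zero] at this
  conv_rhs => rw [← this, image_image]

theorem IsSide.geodSeg_eq (hP : LocallyPlanar 𝓕) (hE : RectConnected E)
    (hH1 : H1Trivial E) {x y : X} (h : (geodSeg (pathDistIn E) E x y).Nonempty) :
    IsSide E (geodSeg (pathDistIn E) E x y) x y := by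
  obtain ⟨z, hz⟩ := h
  simp only [geodSeg, mem_iUnion] at hz
  obtain ⟨f, hf, -⟩ := hz
  refine ⟨f, pathDistIn E x y, ⟨hf.2.2.1, hf.2.2.2⟩, hf.1, hf.2.1, ?_⟩
  refine Subset.antisymm (fun z hz => mem_biUnion hf hz) ?_
  refine iUnion₂_subset fun g hg => ?_
  have := hP.ygeod_unique hE hH1 ⟨hf.2.2.1, hf.2.2.2⟩ ⟨hg.2.2.1, hg.2.2.2⟩ (hf.1.trans hg.1.symm)
    (hf.2.1.trans hg.2.1.symm)
  rw [image_congr this]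

theorem IsSide.isCompact (hE : RectConnected E) {S : Set X} {x y : X} (h : IsSide E S x y) :
    IsCompact S := by
  obtain ⟨f, d, hf, h0, h1, rfl⟩ := h
  exact isCompact_Icc.image_of_continuousOn (hf.continuousOn hE)

theorem IsSide.allLog (hE : RectConnected E) {S : Set X} {x y : X} (h : IsSide E S x y) :
    AllLog S := by
  obtain ⟨f, d, hf, h0, h1, rfl⟩ := h
  exact allLog_image isCompact_Icc (hf.continuousOn hE) hf.injOn

theorem IsSide.left_mem {S : Set X} {x y : X} (h : IsSide E S x y) : x ∈ S := by
  obtain ⟨f, d, hf, rfl, h1, rfl⟩ := h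
  exact ⟨0, ⟨le_rfl, hf.1.1⟩, rfl⟩

theorem IsSide.isPreconnected_inter (hP : LocallyPlanar 𝓕) (hE : RectConnected E)
    (hH1 : H1Trivial E) {S S' : Set X} {x y y' : X} (h : IsSide E S x y) (h' : IsSide E S' x y') :
    IsPreconnected (S ∩ S') := by
  obtain ⟨f, d, hf, rfl, h1, rfl⟩ := h
  obtain ⟨g, d', hg, h0, h1', rfl⟩ := h'
  obtain ⟨m, hm, -, he, -⟩ := hP.inter_eq hE hH1 hf hg h0.symm
  rw [he]
  exact isPreconnected_Icc.image _ ((hf.continuousOn hE).mono (Icc_subset_Icc_right hm.1.2))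

/-- In a simple triangle the two sides at `p` meet only at `p`, and the third side avoids `p`. -/
theorem LocallyPlanar.triangle_sides (hP : LocallyPlanar 𝓕) (hE : RectConnected E)
    (hH1 : H1Trivial E) (γ : SCC X) {p q r : X} {A B C : Set X} (hA : A.Nonempty → IsSide E A p q)
    (hB : B.Nonempty → IsSide E B q r) (hC : C.Nonempty → IsSide E C p r)
    (h : γ.img = A ∪ B ∪ C) :
    IsSide E A p q ∧ IsSide E B q r ∧ IsSide E C p r ∧ p ∉ B ∧ A ∩ C = {p} := by
  have hlog : ∀ {S : Set X} {x y : X}, (S.Nonempty → IsSide E S x y) → AllLog S := by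
    intro S x y hS
    rcases S.eq_empty_or_nonempty with rfl | hne
    · exact allLog_of_finite finite_empty
    · exact (hS hne).allLog hE
  have hcl : ∀ {S : Set X} {x y : X}, (S.Nonempty → IsSide E S x y) → IsClosed S := by
    intro S x y hS
    rcases S.eq_empty_or_nonempty with rfl | hne
    · exact isClosed_empty
    · exact ((hS hne).isCompact hE).isClosed
  have hpre : ∀ {S S' : Set X} {x y y' : X}, (S.Nonempty → IsSide E S x y) →
      (S'.Nonempty → IsSide E S' x y') → IsPreconnected (S ∩ S') := by
    intro S S' x y y' hS hS'
    rcases (S ∩ S').eq_empty_or_nonempty with he | ⟨x, hx⟩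
    · rw [he]; exact isPreconnected_empty
    · exact (hS ⟨x, hx.1⟩).isPreconnected_inter hP hE hH1 (hS' ⟨x, hx.2⟩)
  have hAC : IsPreconnected (A ∩ C) := hpre hA hC
  have hAB : IsPreconnected (A ∩ B) := hpre (fun hn => (hA hn).symm) hB
  have hCB : IsPreconnected (C ∩ B) := hpre (fun hn => (hC hn).symm) (fun hn => (hB hn).symm)
  have hnot : ¬ IsPreconnected ((A ∪ C) ∩ B) := fun hp => γ.not_allLog (by
    rw [h, union_right_comm]
    exact AllLog.union (AllLog.union (hlog hA) (hlog hC) (hcl hA) (hcl hC) hAC) (hlog hB)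
      ((hcl hA).union (hcl hC)) (hcl hB) hp)
  rw [union_inter_distrib_right] at hnot
  have hABne : (A ∩ B).Nonempty := by
    rw [nonempty_iff_ne_empty]
    intro he
    rw [he, empty_union] at hnot
    exact hnot hCB
  have hCBne : (C ∩ B).Nonempty := by
    rw [nonempty_iff_ne_empty]
    intro he
    rw [he, union_empty] at hnot
    exact hnot hAB
  have hABC : ∀ x, x ∈ A → x ∈ C → x ∉ B := fun x h1 h2 h3 =>
    hnot (hAB.union x ⟨h1, h3⟩ ⟨h2, h3⟩ hCB)
  have sA := hA (hABne.mono inter_subset_left)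
  have sB := hB (hABne.mono inter_subset_right)
  have sC := hC (hCBne.mono inter_subset_left)
  have hpB : p ∉ B := hABC p sA.left_mem sC.left_mem
  refine ⟨sA, sB, sC, hpB, ?_⟩
  have cB := hcl hB
  have lB := hlog hB
  clear hAC hAB hCB hnot hA hB hC hlog hcl hpre hABne hCBne
  obtain ⟨f, d, hf, f0, -, rfl⟩ := sA
  obtain ⟨g, d', hg, g0, -, rfl⟩ := sC
  obtain ⟨m, ⟨hm, hm'⟩, heq, hinter, hlast⟩ := hP.inter_eq hE hH1 hf hg (f0.trans g0.symm)
  rw [hinter]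
  rcases hm.1.eq_or_lt with rfl | hm0
  · simp [f0]
  exfalso
  have hfm := hf.mono hm.1 hm.2 le_rfl
  have hgm := hg.mono hm'.1 hm'.2 le_rfl
  have hfs := hf.mono le_rfl hm.1 hm.2
  have kf : IsCompact (f '' Icc m d) := isCompact_Icc.image_of_continuousOn (hfm.continuousOn hE)
  have kg : IsCompact (g '' Icc m d') := isCompact_Icc.image_of_continuousOn (hgm.continuousOn hE)
  have ks : IsCompact (f '' Icc 0 m) := isCompact_Icc.image_of_continuousOn (hfs.continuousOn hE)
  have uf : f '' Icc 0 d = f '' Icc 0 m ∪ f '' Icc m d := by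
    rw [← image_union, Icc_union_Icc_eq_Icc hm.1 hm.2]
  have ug : g '' Icc 0 d' = f '' Icc 0 m ∪ g '' Icc m d' := by
    rw [image_congr heq, ← image_union, Icc_union_Icc_eq_Icc hm'.1 hm'.2]
  set T' := f '' Icc m d ∪ B ∪ g '' Icc m d' with hT'
  have hTT : γ.img = T' ∪ f '' Icc 0 m := by
    rw [h, uf, ug, hT']
    ext x; simp only [mem_union]; tauto
  have hT'c : IsClosed T' := (kf.isClosed.union cB).union kg.isClosed
  have hT'γ : T' ⊆ γ.img := hTT ▸ subset_union_left
  have hpT' : p ∉ T' := by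
    rintro ((⟨s, hs, he⟩ | hB) | ⟨s, hs, he⟩)
    · have := hf.injOn ⟨hm.1.trans hs.1, hs.2⟩ ⟨le_rfl, hf.1.1⟩ (he.trans f0.symm)
      linarith [hs.1]
    · exact hpB hB
    · have := hg.injOn ⟨hm.1.trans hs.1, hs.2⟩ ⟨le_rfl, hg.1.1⟩ (he.trans g0.symm)
      linarith [hs.1]
  have hpγ : p ∈ γ.img := hTT ▸ Or.inr ⟨0, ⟨le_rfl, hm.1⟩, f0⟩
  rcases γ.circleLike.allLog_or_eq (γ.isCompact_img.of_isClosed_subset hT'c hT'γ) hT'γ with hl | he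
  · refine γ.not_allLog ?_
    rw [hTT]
    refine AllLog.union hl (allLog_image isCompact_Icc (hfs.continuousOn hE) hfs.injOn) hT'c
      ks.isClosed ?_
    have : T' ∩ f '' Icc 0 m ⊆ {f m} := by
      rintro _ ⟨hx, ⟨s, hs, rfl⟩⟩
      rcases hx with (⟨t, ht, he⟩ | hB) | ⟨t, ht, he⟩
      · have := hf.injOn ⟨hm.1.trans ht.1, ht.2⟩ ⟨hs.1, hs.2.trans hm.2⟩ he
        have : s = m := le_antisymm hs.2 (this ▸ ht.1)
        rw [this]; rfl
      · exact (hABC _ ⟨s, ⟨hs.1, hs.2.trans hm.2⟩, rfl⟩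
          ⟨s, ⟨hs.1, hs.2.trans hm'.2⟩, (heq hs).symm⟩ hB).elim
      · have := (hlast s ⟨hs.1, hs.2.trans hm.2⟩ t ⟨hm.1.trans ht.1, ht.2⟩ he.symm).1
        have : s = m := le_antisymm hs.2 (this ▸ ht.1)
        rw [this]; rfl
    exact (subsingleton_singleton.anti this).isPreconnected
  · exact hpT' (he.symm ▸ hpγ)

end Triangles

end Cat2Cx

end

noncomputable section

namespace Cat2Cx

section Corner
variable {X : Type*} [MetricSpace X] [CAT0Space X] {E : Set X} {𝓕 : Set (Set X)}

theorem isArc_seg {x y : X} (h : x ≠ y) : IsArc (seg x y) x y := by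
  refine ⟨pt x y, (continuous_pt_right x y).continuousOn, fun s hs t ht he => ?_, pt_zero x y,
    pt_one x y, (seg_eq_image x y).symm⟩
  have := dist_pt_pt hs ht x y
  rw [he, dist_self, zero_eq_mul, abs_eq_zero, sub_eq_zero] at this
  exact this.resolve_right (dist_pos.2 h).ne'

/-- No `X`-geodesic ray from `p` runs inside `E` from one side at `p` to the other. -/
theorem LocallyPlanar.no_crosscut (hP : LocallyPlanar 𝓕) (hE : RectConnected E)
    (hH1 : H1Trivial E) {A C : Set X} {p q r u w : X} (hA : IsSide E A p q) (hC : IsSide E C p r)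
    (hAC : A ∩ C = {p}) (hu : u ∈ C) (huA : u ∉ A) (hw : w ∈ A) (hwC : w ∉ C) (hb : Btw p u w)
    (hs : seg u w ⊆ E) (hinter : ∀ z, Btw u z w → z ∈ A ∪ C → z = u ∨ z = w) : False := by
  have hAp := hA.left_mem
  have hCp := hC.left_mem
  obtain ⟨f, d, hf, f0, -, rfl⟩ := hA
  obtain ⟨g, d', hg, g0, -, rfl⟩ := hC
  obtain ⟨t₀, ht₀, rfl⟩ := hu
  obtain ⟨s₀, hs₀, rfl⟩ := hw
  have ht : 0 < t₀ := lt_of_le_of_ne ht₀.1 fun h => huA (by rw [← h, g0]; exact hAp)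
  have hs' : 0 < s₀ := lt_of_le_of_ne hs₀.1 fun h => hwC (by rw [← h, f0]; exact hCp)
  have hf' := hf.mono le_rfl hs₀.1 hs₀.2
  have hg' := hg.mono le_rfl ht₀.1 ht₀.2
  have subf : f '' Icc 0 s₀ ⊆ f '' Icc 0 d := image_mono (Icc_subset_Icc_right hs₀.2)
  have subg : g '' Icc 0 t₀ ⊆ g '' Icc 0 d' := image_mono (Icc_subset_Icc_right ht₀.2)
  have af := isArc_of_injOn hs' (hf'.continuousOn hE) hf'.injOn
  have ag := isArc_of_injOn ht (hg'.continuousOn hE) hg'.injOn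
  have hne : g t₀ ≠ f s₀ := fun h => hwC (h ▸ ⟨t₀, ht₀, rfl⟩)
  rw [f0] at af
  rw [g0] at ag
  have acat := ag.concat (isArc_seg hne) (by
    rintro z ⟨hz, hz'⟩
    rcases hinter z hz' (Or.inr (subg hz)) with rfl | rfl
    · rfl
    · exact (hwC (subg hz)).elim)
  obtain ⟨γ, hγ⟩ := acat.exists_scc af (by
    rintro z ⟨hz | hz, hz'⟩
    · have : z ∈ ({p} : Set X) := hAC ▸ ⟨subf hz', subg hz⟩
      exact Or.inl this
    · rcases hinter z hz (Or.inl (subf hz')) with rfl | rfl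
      · exact (huA (subf hz')).elim
      · exact Or.inr rfl)
  have cf : IsClosed (f '' Icc 0 s₀) :=
    (isCompact_Icc.image_of_continuousOn (hf'.continuousOn hE)).isClosed
  have cg : IsClosed (g '' Icc 0 t₀) :=
    (isCompact_Icc.image_of_continuousOn (hg'.continuousOn hE)).isClosed
  have hnot : ∀ z, z ∈ f '' Icc 0 s₀ → z ∈ g '' Icc 0 t₀ → z ∈ seg p (f s₀) := by
    intro z h1 h2
    have : z ∈ ({p} : Set X) := hAC ▸ ⟨subf h1, subg h2⟩
    rw [mem_singleton_iff.1 this]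
    exact btw_left _ _
  have hsub : ∀ z, z ∈ seg (g t₀) (f s₀) → z ∈ seg p (f s₀) := fun z hz => hb.trans_right hz
  refine hP.not_piecewise_geodesic hE hH1 γ ?_ p (f s₀) ?_
  · rw [hγ]
    exact union_subset (union_subset hg'.2.image_subset hs) hf'.2.image_subset
  · rw [hγ]
    rintro z ((hz | hz) | hz) hzs
    · refine ⟨g, 0, t₀, seg (g t₀) (f s₀) ∪ f '' Icc 0 s₀, hg', ?_, (isClosed_seg _ _).union cf, ?_, ?_⟩
      · exact subset_union_left.trans subset_union_left
      · rw [union_assoc]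
      · rintro (h | h)
        · exact hzs (hsub z h)
        · exact hzs (hnot z h hz)
    · exact (hzs (hsub z hz)).elim
    · refine ⟨f, 0, s₀, g '' Icc 0 t₀ ∪ seg (g t₀) (f s₀), hf', subset_union_right,
        cg.union (isClosed_seg _ _), by rw [union_comm], ?_⟩
      rintro (h | h)
      · exact hzs (hnot z hz h)
      · exact hzs (hsub z h)

/-- The configuration at the vertex `p` of a simple triangle with sides `A`, `B`, `C`. -/
structure Corner (𝓕 : Set (Set X)) (E : Set X) (γ : SCC X) (G : Set X) (p q r : X)
    (A B C : Set X) (ε₀ : ℝ) : Prop where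
  planar : LocallyPlanar 𝓕
  rect : RectConnected E
  h1 : H1Trivial E
  side : IsSide E A p q
  side' : IsSide E C p r
  compact : IsCompact B
  inter : A ∩ C = {p}
  img : γ.img = A ∪ B ∪ C
  fill : MinUnwind G γ
  sub : G ⊆ E
  radius : GoodRadius 𝓕 p ε₀
  far : ∀ x ∈ B, ε₀ ≤ dist p x

variable {γ : SCC X} {G A B C : Set X} {p q r : X} {ε₀ : ℝ}

theorem Corner.swap (h : Corner 𝓕 E γ G p q r A B C ε₀) : Corner 𝓕 E γ G p r q C B A ε₀ where
  planar := h.planar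
  rect := h.rect
  h1 := h.h1
  side := h.side'
  side' := h.side
  compact := h.compact
  inter := by rw [inter_comm, h.inter]
  img := by rw [h.img]; ext x; simp only [mem_union]; tauto
  fill := h.fill
  sub := h.sub
  radius := h.radius
  far := h.far

theorem Corner.exists_far (h : Corner 𝓕 E γ G p q r A B C ε₀) {F : Set X} (hF : F ∈ 𝓕) {y : X}
    (hyG : y ∈ G) (hyF : y ∈ F) (hyT : y ∉ γ.img) (hy : dist p y < ε₀) :
    ∃ w ∈ B, Btw p y w ∧ seg y w ⊆ G ∧ ∀ z, Btw y z w → z ∈ γ.img → z = w := by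
  obtain ⟨w, hwT, hpw, hsG, hfirst⟩ := h.fill.exists_extension h.planar hyG p
  refine ⟨w, ?_, hpw, hsG, hfirst⟩
  by_contra hwB
  obtain ⟨c, hc⟩ := h.planar.chart F hF
  have hpF := h.radius.mem_closure F hF ⟨y, hyF, by rwa [mem_ball']⟩
  have hpA := h.side.left_mem
  have hpC := h.side'.left_mem
  have hpT : p ∈ γ.img := h.img ▸ Or.inl (Or.inl hpA)
  obtain ⟨u, ⟨hu, huT⟩, hmax⟩ := ((isCompact_seg p y).inter_right
    γ.isCompact_img.isClosed).exists_isMaxOn (f := dist p) ⟨p, btw_left _ _, hpT⟩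
    (by fun_prop)
  change Btw p u y at hu
  have huy : u ≠ y := fun he => hyT (he ▸ huT)
  have hlast : ∀ z, Btw u z y → z ∈ γ.img → z = u := by
    intro z hz hzT
    have h1 := hu.trans_right hz
    have h2 := hu.trans_right' hz
    have h3 : dist p z ≤ dist p u := hmax ⟨h1, hzT⟩
    unfold Btw at h2
    exact (dist_le_zero.1 (by linarith [dist_nonneg (x := u) (y := z)])).symm
  have hface : ∀ z, Btw u z y → z ≠ u → z ∈ F := by
    intro z hz hzu
    refine hc.star p hpF y hyF z (hu.trans_right hz) fun he => ?_
    have h2 := hu.trans_right' hz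
    rw [he] at h2
    exact hzu (he.trans (h2.eq_of_self).symm)
  have hpre : IsPreconnected (pt u y '' Ioc 0 1) :=
    isPreconnected_Ioc.image _ (continuous_pt_right u y).continuousOn
  have hmem : ∀ z ∈ pt u y '' Ioc 0 1, Btw u z y ∧ z ≠ u := by
    rintro _ ⟨t, ht, rfl⟩
    refine ⟨btw_pt _ _ _, fun he => ?_⟩
    have := dist_pt ⟨ht.1.le, ht.2⟩ u y
    rw [he, dist_self, zero_eq_mul] at this
    exact this.elim ht.1.ne' (dist_pos.2 huy).ne'
  have hG : pt u y '' Ioc 0 1 ⊆ (G ∩ F) \ γ.img := by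
    refine IsPreconnected.subset_left_of_subset_union (h.fill.isOpen_inter_face h.planar hF)
      h.fill.compact.isClosed.isOpen_compl ?_ ?_ ?_ hpre
    · exact disjoint_left.2 fun z hz hz' => hz' hz.1.1
    · intro z hz
      by_cases hzG : z ∈ G
      · exact Or.inl ⟨⟨hzG, hface z (hmem z hz).1 (hmem z hz).2⟩,
          fun hzT => (hmem z hz).2 (hlast z (hmem z hz).1 hzT)⟩
      · exact Or.inr hzG
    · exact ⟨y, ⟨1, ⟨one_pos, le_rfl⟩, pt_one u y⟩, ⟨hyG, hyF⟩, hyT⟩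
  have huyG : seg u y ⊆ G := by
    rw [seg_eq_image]
    rintro _ ⟨t, ht, rfl⟩
    rcases ht.1.eq_or_lt with rfl | h0
    · rw [pt_zero]; exact h.fill.subset huT
    · exact (hG ⟨t, ⟨h0, ht.2⟩, rfl⟩).1.1
  have huw : Btw p u w := hpw.trans_left hu
  have huyw : Btw u y w := hpw.trans_left' hu
  have huwG : seg u w ⊆ G := by
    intro z hz
    rcases Btw.split hz huyw with h1 | h1
    · exact huyG h1
    · exact hsG h1
  have hends : ∀ z, Btw u z w → z ∈ γ.img → z = u ∨ z = w := by
    intro z hz hzT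
    rcases Btw.split hz huyw with h1 | h1
    · exact Or.inl (hlast z h1 hzT)
    · exact Or.inr (hfirst z h1 hzT)
  have hends' : ∀ z, Btw u z w → z ∈ A ∪ C → z = u ∨ z = w := fun z hz hzT => hends z hz (by
    rw [h.img]
    exact hzT.elim (fun h => Or.inl (Or.inl h)) Or.inr)
  have huB : u ∉ B := fun huB => by
    have := h.far u huB
    have := hu.dist_le_left
    linarith
  have key : ∀ {q r : X} {A C : Set X}, IsSide E A p q → IsSide E C p r → A ∩ C = {p} →
      A ⊆ γ.img → C ⊆ γ.img → (∀ z, Btw u z w → z ∈ A ∪ C → z = u ∨ z = w) → u ∈ C →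
      w ∈ A ∨ w ∈ C → False := by
    intro q r A C hA hC hAC hAT hCT hends hu' hw'
    have same : ∀ {S : Set X} {x : X}, IsSide E S p x → S ⊆ γ.img → u ∈ S → w ∈ S → False := by
      rintro S x ⟨f, d, hf, -, -, rfl⟩ hST hu hw
      exact hyT (hST (hf.seg_subset h.rect hu hw (huwG.trans h.sub) huyw))
    by_cases hwC : w ∈ C
    · exact same hC hCT hu' hwC
    by_cases huA : u ∈ A
    · exact same hA hAT huA (hw'.resolve_right hwC)
    exact h.planar.no_crosscut h.rect h.h1 hA hC hAC hu' huA (hw'.resolve_right hwC) hwC huw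
      (huwG.trans h.sub) hends
  have hAT : A ⊆ γ.img := h.img ▸ (subset_union_left.trans subset_union_left)
  have hCT : C ⊆ γ.img := h.img ▸ subset_union_right
  rw [h.img] at hwT huT
  have hw' : w ∈ A ∨ w ∈ C := by
    rcases hwT with (hw | hw) | hw
    · exact Or.inl hw
    · exact (hwB hw).elim
    · exact Or.inr hw
  rcases huT with (hu' | hu') | hu'
  · exact key h.side' h.side h.swap.inter hCT hAT (by rwa [union_comm]) hu' hw'.symm
  · exact huB hu'
  · exact key h.side h.side' h.inter hAT hCT hends' hu' hw'

theorem Corner.eq_of_btw (h : Corner 𝓕 E γ G p q r A B C ε₀) {u x x' : X} (hup : u ≠ p)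
    (hx : dist p x < ε₀) (h1 : Btw p u x) (h2 : Btw p u x') (he : dist p x = dist p x') : x = x' :=
  h.radius.nonbranching x (by rwa [mem_ball']) x' (by rwa [mem_ball', ← he]) u hup h1 h2 he

/-- Points of the triangle near `p` are not hidden behind points of the filling. -/
theorem Corner.not_btw (h : Corner 𝓕 E γ G p q r A B C ε₀) {F : Set X} (hF : F ∈ 𝓕) {y a : X}
    (hyG : y ∈ G) (hyF : y ∈ F) (hyT : y ∉ γ.img) (haT : a ∈ γ.img) (ha : dist p a < ε₀) :
    ¬ Btw p y a := by
  intro hb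
  obtain ⟨w, hwB, hpw, -, hfirst⟩ := h.exists_far hF hyG hyF hyT (hb.dist_le_left.trans_lt ha)
  have hw := h.far w hwB
  have hpT : p ∈ γ.img := h.img ▸ Or.inl (Or.inl h.side.left_mem)
  have hd : dist p (rad p (dist p a) w) = dist p a := dist_rad dist_nonneg (ha.le.trans hw)
  have hv := btw_rad p (dist p a) w
  have h1 : Btw p y (rad p (dist p a) w) := hpw.of_dist_le hv (by rw [hd]; exact hb.dist_le_left)
  have hyp : y ≠ p := fun he => hyT (he ▸ hpT)
  have : a = rad p (dist p a) w := h.eq_of_btw hyp ha hb h1 hd.symm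
  rw [← this] at hv h1
  have := hfirst a (hv.trans_left' h1) haT
  rw [this] at ha
  linarith

theorem Corner.mem_closure (h : Corner 𝓕 E γ G p q r A B C ε₀) {a : X} (ha : a ∈ γ.img) :
    a ∈ closure ((G ∩ ⋃₀ 𝓕) \ γ.img) := by
  refine closure_minimal (fun y hy => ?_) isClosed_closure (h.fill.subset_closure_diff ha)
  have := h.fill.mem_closure_faces h.planar hy.1 hy.2
  rw [sdiff_eq]
  exact (γ.isCompact_img.isClosed.isOpen_compl).closure_inter ⟨this, hy.2⟩

theorem Corner.exists_far_of_mem (h : Corner 𝓕 E γ G p q r A B C ε₀) {a : X} (haT : a ∈ γ.img)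
    (ha : dist p a < ε₀) : ∃ w ∈ B, Btw p a w ∧ seg a w ⊆ G := by
  obtain ⟨y, hy, hya⟩ := mem_closure_iff_seq_limit.1 (h.mem_closure haT)
  have hclose : ∀ᶠ n in atTop, dist p (y n) < ε₀ :=
    (tendsto_const_nhds.dist hya).eventually_lt_const ha
  have : ∀ n, ∃ w, dist p (y n) < ε₀ → w ∈ B ∧ Btw p (y n) w ∧ seg (y n) w ⊆ G := by
    intro n
    by_cases hn : dist p (y n) < ε₀
    · obtain ⟨⟨hG, F, hF, hyF⟩, hT⟩ := hy n
      obtain ⟨w, h1, h2, h3, -⟩ := h.exists_far hF hG hyF hT hn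
      exact ⟨w, fun _ => ⟨h1, h2, h3⟩⟩
    · exact ⟨p, fun h => (hn h).elim⟩
  choose w hw using this
  obtain ⟨x, hxB, φ, hφ, hlim⟩ := h.compact.tendsto_subseq' (x := w)
    (hclose.mono fun n hn => (hw n hn).1).frequently
  have hy' := hya.comp hφ.tendsto_atTop
  have hev := hφ.tendsto_atTop.eventually hclose
  refine ⟨x, hxB, Btw.of_tendsto tendsto_const_nhds hy' hlim (hev.mono fun n hn => (hw _ hn).2.1), ?_⟩
  rw [seg_eq_image]
  rintro _ ⟨t, ht, rfl⟩
  have hc : Tendsto (fun n => pt (y (φ n)) (w (φ n)) t) atTop (nhds (pt a x t)) :=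
    (continuous_pt.tendsto (a, x, t)).comp (hy'.prodMk_nhds (hlim.prodMk_nhds tendsto_const_nhds))
  exact h.fill.compact.isClosed.mem_of_tendsto hc (hev.mono fun n hn => (hw _ hn).2.2 (btw_pt _ _ _))

end Corner

end Cat2Cx

end

noncomputable section

namespace Cat2Cx

theorem exists_mem_Ioo_of_frequently {P : ℝ → Prop} (h : ∃ᶠ t in nhdsWithin (0 : ℝ) (Ioi 0), P t)
    {τ : ℝ} (hτ : 0 < τ) : ∃ t ∈ Ioo 0 τ, P t := by
  obtain ⟨t, h1, h2⟩ := (h.and_eventually (Ioo_mem_nhdsGT hτ)).exists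
  exact ⟨t, h2, h1⟩

theorem frequently_of_forall_exists {P : ℝ → Prop} (h : ∀ τ > 0, ∃ t ∈ Ioo 0 τ, P t) :
    ∃ᶠ t in nhdsWithin (0 : ℝ) (Ioi 0), P t := by
  intro hn
  obtain ⟨τ, hτ, hsub⟩ := mem_nhdsGT_iff_exists_Ioo_subset.1 hn
  obtain ⟨t, ht, hP⟩ := h τ hτ
  exact hsub ht hP

theorem exists_crossing {D : ℝ → ℝ} {τ₀ : ℝ} (hτ₀ : 0 < τ₀) (hD : ContinuousOn D (Ioc 0 τ₀))
    {α v : ℝ} (hαv : α ≤ v) (h1 : ∃ᶠ t in nhdsWithin (0 : ℝ) (Ioi 0), D t < α)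
    (h2 : ∃ᶠ t in nhdsWithin (0 : ℝ) (Ioi 0), v ≤ D t) {τ : ℝ} (hτ : 0 < τ) :
    ∃ s u, 0 < s ∧ s ≤ u ∧ u < τ ∧ u ≤ τ₀ ∧ D s < α ∧ D u = v ∧ ∀ x ∈ Icc s u, D x ≤ v := by
  obtain ⟨t, ht, hvt⟩ := exists_mem_Ioo_of_frequently h2 (lt_min hτ hτ₀)
  obtain ⟨s, hs, hs'⟩ := exists_mem_Ioo_of_frequently h1 ht.1
  have htτ₀ : t ≤ τ₀ := ht.2.le.trans (min_le_right _ _)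
  have hsub : ∀ {x}, x ≤ t → Icc s x ⊆ Ioc 0 τ₀ := fun hx z hz =>
    ⟨hs.1.trans_le hz.1, (hz.2.trans hx).trans htτ₀⟩
  have hK : IsCompact (Icc s t ∩ D ⁻¹' {v}) := isCompact_Icc.of_isClosed_subset
    ((hD.mono (hsub le_rfl)).preimage_isClosed_of_isClosed isClosed_Icc isClosed_singleton)
    inter_subset_left
  obtain ⟨z, hz, hzv⟩ := intermediate_value_Icc hs.2.le (hD.mono (hsub le_rfl))
    ⟨hs'.le.trans hαv, hvt⟩
  obtain ⟨u, ⟨hu, huv⟩, hmin⟩ := hK.exists_isMinOn (f := id) ⟨z, hz, hzv⟩ continuousOn_id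
  refine ⟨s, u, hs.1, hu.1, (hu.2.trans_lt ht.2).trans_le (min_le_left _ _), hu.2.trans htτ₀, hs',
    huv, fun x hx => ?_⟩
  by_contra! hlt
  obtain ⟨y, hy, hyv⟩ := intermediate_value_Icc hx.1 (hD.mono (hsub (hx.2.trans hu.2)))
    ⟨hs'.le.trans hαv, hlt.le⟩
  have huy : u ≤ y := hmin ⟨⟨hy.1, hy.2.trans (hx.2.trans hu.2)⟩, hyv⟩
  have : y = x := le_antisymm hy.2 (hx.2.trans huy)
  rw [this] at hyv
  have e1 : D x = v := hyv
  linarith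

section Sector
variable {X : Type*} [MetricSpace X]

/-- The slope of the chart around the direction of `x₀` at `p`. -/
theorem FaceChart.exists_sector {F : Set X} {h : X → ℂ} (hF : FaceChart F h) {p x₀ : X}
    (hp : p ∈ closure F) (hx₀ : x₀ ∈ F) (hne : x₀ ≠ p) :
    ∃ (W : Set X) (m : X → ℝ), IsOpen W ∧ W ⊆ F ∧ x₀ ∈ W ∧ ContinuousOn m W ∧ m x₀ = 0 ∧
      (∀ x ∈ W, ∀ a, a ≠ p → Btw p a x → a ∈ W ∧ m a = m x) ∧
      ∀ y ∈ W, ∀ y' ∈ W, m y = m y' → Btw p y y' ∨ Btw p y' y := by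
  set v : ℂ := h x₀ - h p with hv
  have hv0 : v ≠ 0 := fun he => hne (hF.inj (subset_closure hx₀) hp (sub_eq_zero.1 he))
  let ζ : X → ℂ := fun x => (h x - h p) * (starRingEnd ℂ) v
  have hζ : ContinuousOn ζ F :=
    ((hF.cont.mono subset_closure).sub continuousOn_const).mul continuousOn_const
  have hre : ContinuousOn (fun x => (ζ x).re) F := Complex.continuous_re.comp_continuousOn hζ
  have him : ContinuousOn (fun x => (ζ x).im) F := Complex.continuous_im.comp_continuousOn hζ
  have hconj : (starRingEnd ℂ) v ≠ 0 := by simpa using hv0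
  have ζ0 : ζ x₀ = (Complex.normSq v : ℂ) := by
    change v * (starRingEnd ℂ) v = _
    exact Complex.mul_conj v
  refine ⟨F ∩ (fun x => (ζ x).re) ⁻¹' Ioi 0, fun x => (ζ x).im / (ζ x).re,
    hre.isOpen_inter_preimage hF.isOpen isOpen_Ioi, inter_subset_left, ⟨hx₀, ?_⟩, ?_, ?_, ?_, ?_⟩
  · change 0 < (ζ x₀).re
    rw [ζ0, Complex.ofReal_re]
    exact Complex.normSq_pos.2 hv0
  · exact (him.mono inter_subset_left).div (hre.mono inter_subset_left) fun x hx => ne_of_gt hx.2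
  · change (ζ x₀).im / (ζ x₀).re = 0
    rw [ζ0, Complex.ofReal_im, zero_div]
  · rintro x ⟨hxF, hx0⟩ a hap hb
    have haF : a ∈ F := hF.star p hp x hxF a hb hap
    have := hF.segment_of_btw p hp x (subset_closure hxF) a hb
    rw [segment_eq_image'] at this
    obtain ⟨t, ht, hta⟩ := this
    simp only [Complex.real_smul] at hta
    have ht0 : 0 < t := lt_of_le_of_ne ht.1 fun h0 => hap (hF.inj (subset_closure haF) hp (by
      rw [← hta, ← h0]; simp))
    have e : ζ a = t * ζ x := by
      change (h a - h p) * _ = t * ((h x - h p) * _)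
      rw [← hta]; ring
    have er : (ζ a).re = t * (ζ x).re := by rw [e, Complex.re_ofReal_mul]
    have ei : (ζ a).im = t * (ζ x).im := by rw [e, Complex.im_ofReal_mul]
    refine ⟨⟨haF, ?_⟩, ?_⟩
    · change 0 < (ζ a).re
      rw [er]; exact mul_pos ht0 hx0
    · change (ζ a).im / (ζ a).re = (ζ x).im / (ζ x).re
      rw [er, ei, mul_div_mul_left _ _ ht0.ne']
  · have key : ∀ y ∈ F, ∀ y' ∈ F, 0 < (ζ y).re → 0 < (ζ y').re →
        (ζ y).im / (ζ y).re = (ζ y').im / (ζ y').re → (ζ y).re ≤ (ζ y').re → Btw p y y' := by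
      intro y hy y' hy' h0 h0' he hle
      refine hF.btw_of_segment p hp y' (subset_closure hy') y (subset_closure hy) ?_
      rw [segment_eq_image']
      refine ⟨(ζ y).re / (ζ y').re, ⟨by positivity, (div_le_one h0').2 hle⟩, ?_⟩
      have e : ζ y = ((ζ y).re / (ζ y').re : ℝ) * ζ y' := by
        apply Complex.ext
        · rw [Complex.re_ofReal_mul]; field_simp
        · rw [Complex.im_ofReal_mul]; field_simp at he ⊢; linarith
      have e2 : h y - h p = ((ζ y).re / (ζ y').re : ℝ) * (h y' - h p) := by
        apply mul_right_cancel₀ hconj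
        rw [mul_assoc]; exact e
      simp only [Complex.real_smul]
      rw [← e2]; ring
    rintro y ⟨hy, hy0⟩ y' ⟨hy', hy0'⟩ he
    rcases le_total (ζ y).re (ζ y').re with hle | hle
    · exact Or.inl (key y hy y' hy' hy0 hy0' he hle)
    · exact Or.inr (key y' hy' y hy hy0' hy0 he.symm hle)

end Sector

section Limit
variable {X : Type*} [MetricSpace X] [CAT0Space X] {E : Set X} {𝓕 : Set (Set X)}
  {γ : SCC X} {G A B C : Set X} {p q r : X} {ε₀ : ℝ}

theorem Corner.no_oscillation (h : Corner 𝓕 E γ G p q r A B C ε₀) {F W : Set X} (hF : F ∈ 𝓕)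
    {m : X → ℝ} (hW : IsOpen W) (hWF : W ⊆ F) (hm : ContinuousOn m W)
    (hstar : ∀ x ∈ W, ∀ a, a ≠ p → Btw p a x → a ∈ W ∧ m a = m x)
    (hinj : ∀ y ∈ W, ∀ y' ∈ W, m y = m y' → Btw p y y' ∨ Btw p y' y)
    {f e : ℝ → X} {τ₀ : ℝ} (hf : ContinuousOn f (Icc 0 τ₀)) (he : ContinuousOn e (Ioc 0 τ₀))
    (f0 : f 0 = p) (hτ₀ : 0 < τ₀)
    (hfe : ∀ t ∈ Ioc 0 τ₀, f t ≠ p ∧ f t ∈ γ.img ∧ dist p (f t) < ε₀ ∧ Btw p (f t) (e t))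
    {c : ℝ} (hc : 0 < c)
    (hosc : ∀ τ > 0, ∃ s u, 0 < s ∧ s ≤ u ∧ u < τ ∧ u ≤ τ₀ ∧ (∀ x ∈ Icc s u, e x ∈ W) ∧
      m (e s) ≤ c / 2 ∧ c ≤ m (e u)) : False := by
  have ivt : ∀ {s u : ℝ}, 0 < s → s ≤ u → u ≤ τ₀ → (∀ x ∈ Icc s u, e x ∈ W) → m (e s) ≤ c / 2 →
      c ≤ m (e u) → ∀ k ∈ Icc (c / 2) c, ∃ t ∈ Icc s u, m (e t) = k := by
    intro s u hs hsu hu hW' h1 h2 k hk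
    have hcont : ContinuousOn (fun t => m (e t)) (Icc s u) :=
      hm.comp (he.mono fun x hx => ⟨hs.trans_le hx.1, hx.2.trans hu⟩) hW'
    exact intermediate_value_Icc hsu hcont ⟨h1.trans hk.1, hk.2.trans h2⟩
  obtain ⟨s₁, u₁, hs₁, hsu₁, -, hu₁, hW₁, hl₁, hr₁⟩ := hosc 1 one_pos
  obtain ⟨tm, htm, hmin⟩ := (isCompact_Icc (a := s₁) (b := u₁)).exists_isMinOn
    (f := fun t => dist p (f t)) ⟨s₁, le_rfl, hsu₁⟩
    (continuous_dist.comp_continuousOn (continuousOn_const.prodMk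
      (hf.mono fun x hx => ⟨hs₁.le.trans hx.1, hx.2.trans hu₁⟩)))
  set δ := dist p (f tm) with hδ
  have hδ0 : 0 < δ := dist_pos.2 (hfe tm ⟨hs₁.trans_le htm.1, htm.2.trans hu₁⟩).1.symm
  have hnear : ∀ᶠ t in nhdsWithin (0 : ℝ) (Icc 0 τ₀), dist p (f t) < δ := by
    have := (hf 0 ⟨le_rfl, hτ₀.le⟩)
    rw [ContinuousWithinAt, f0] at this
    exact ((tendsto_const_nhds.dist this).eventually_lt_const (by rwa [dist_self]))
  obtain ⟨τ, hτ, hτsub⟩ := Metric.mem_nhdsWithin_iff.1 hnear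
  obtain ⟨s₂, u₂, hs₂, hsu₂, huτ, hu₂, hW₂, hl₂, hr₂⟩ := hosc τ hτ
  obtain ⟨t₂, ht₂, hmt₂⟩ := ivt hs₂ hsu₂ hu₂ hW₂ hl₂ hr₂ (3 * c / 4) ⟨by linarith, by linarith⟩
  have ht₂' : t₂ ∈ Ioc 0 τ₀ := ⟨hs₂.trans_le ht₂.1, ht₂.2.trans hu₂⟩
  obtain ⟨hne₂, hT₂, -, hb₂⟩ := hfe t₂ ht₂'
  obtain ⟨hfW₂, hfm₂⟩ := hstar _ (hW₂ t₂ ht₂) _ hne₂ hb₂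
  have hd₂ : dist p (f t₂) < δ := hτsub ⟨by
    rw [mem_ball, Real.dist_eq, sub_zero, abs_of_pos ht₂'.1]; exact ht₂.2.trans_lt huτ,
    ht₂'.1.le, ht₂'.2⟩
  have hV : IsOpen (W ∩ m ⁻¹' Ioo (c / 2) c ∩ {x | dist p x < δ}) :=
    (hm.isOpen_inter_preimage hW isOpen_Ioo).inter (isOpen_lt (by fun_prop) (by fun_prop))
  obtain ⟨y, ⟨⟨hyW, hym⟩, hyd⟩, ⟨hyG, -⟩, hyT⟩ := mem_closure_iff.1 (h.mem_closure hT₂) _ hV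
    ⟨⟨hfW₂, by rw [mem_preimage, hfm₂, hmt₂]; constructor <;> linarith⟩, hd₂⟩
  obtain ⟨t₁, ht₁, hmt₁⟩ := ivt hs₁ hsu₁ hu₁ hW₁ hl₁ hr₁ (m y) ⟨hym.1.le, hym.2.le⟩
  obtain ⟨hne₁, hT₁, hd₁, hb₁⟩ := hfe t₁ ⟨hs₁.trans_le ht₁.1, ht₁.2.trans hu₁⟩
  obtain ⟨hfW₁, hfm₁⟩ := hstar _ (hW₁ t₁ ht₁) _ hne₁ hb₁
  rcases hinj y hyW _ hfW₁ (by rw [hfm₁, hmt₁]) with hb | hb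
  · exact h.not_btw hF hyG (hWF hyW) hyT hT₁ hd₁ hb
  · have h1 := hb.dist_le_left
    have h2 : δ ≤ dist p (f t₁) := hmin ht₁
    have h3 : dist p y < δ := hyd
    linarith

end Limit

end Cat2Cx

end

noncomputable section

namespace Cat2Cx

section Limit
variable {X : Type*} [MetricSpace X] [CAT0Space X] {E : Set X} {𝓕 : Set (Set X)}
  {γ : SCC X} {G A B C : Set X} {p q r : X} {ε₀ : ℝ}

theorem Corner.cluster_unique_of_face (h : Corner 𝓕 E γ G p q r A B C ε₀) {F K : Set X} (hF : F ∈ 𝓕)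
    {f e : ℝ → X} {τ₀ ε : ℝ} (hε : 0 < ε) (hε₀ : ε < ε₀) (hK : IsCompact K)
    (hKs : ∀ x ∈ K, dist p x = ε)
    (hf : ContinuousOn f (Icc 0 τ₀)) (he : ContinuousOn e (Ioc 0 τ₀))
    (f0 : f 0 = p) (hτ₀ : 0 < τ₀) (heK : ∀ t ∈ Ioc 0 τ₀, e t ∈ K)
    (hfe : ∀ t ∈ Ioc 0 τ₀, f t ≠ p ∧ f t ∈ γ.img ∧ dist p (f t) < ε₀ ∧ Btw p (f t) (e t))
    {x₀ x₁ : X} (hx₀ : x₀ ∈ F) (hx₀K : x₀ ∈ K)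
    (hc₀ : MapClusterPt x₀ (nhdsWithin (0 : ℝ) (Ioi 0)) e)
    (hc₁ : MapClusterPt x₁ (nhdsWithin (0 : ℝ) (Ioi 0)) e) : x₀ = x₁ := by
  by_contra hne
  obtain ⟨ch, hch⟩ := h.planar.chart F hF
  have hd₀ := hKs x₀ hx₀K
  have hpF := h.radius.mem_closure F hF ⟨x₀, hx₀, by rw [mem_ball', hd₀]; exact hε₀⟩
  have hx₀p : x₀ ≠ p := fun he => by rw [he, dist_self] at hd₀; exact hε.ne hd₀
  obtain ⟨W, m, hW, hWF, hx₀W, hm, hm0, hstar, hinj⟩ := hch.exists_sector hpF hx₀ hx₀p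
  obtain ⟨ρ, hρ, hρW⟩ := Metric.isOpen_iff.1 hW x₀ hx₀W
  set v := min (ρ / 2) (dist x₁ x₀ / 2) with hv
  have hd : 0 < dist x₁ x₀ := dist_pos.2 (Ne.symm hne)
  have hv0 : 0 < v := lt_min (by linarith) (by linarith)
  have hvρ : v < ρ := (min_le_left _ _).trans_lt (by linarith)
  have hvd : v < dist x₁ x₀ := (min_le_right _ _).trans_lt (by linarith)
  have hcb : closedBall x₀ v ⊆ W := (closedBall_subset_ball hvρ).trans hρW
  obtain ⟨c, hc, hcS⟩ : ∃ c > 0, ∀ x ∈ K, dist x x₀ = v → c ≤ |m x| := by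
    have hS : IsCompact (K ∩ sphere x₀ v) := hK.inter_right isClosed_sphere
    have hSW : K ∩ sphere x₀ v ⊆ W := fun x hx => hcb (sphere_subset_closedBall hx.2)
    rcases (K ∩ sphere x₀ v).eq_empty_or_nonempty with hemp | hn
    · exact ⟨1, one_pos, fun x hx hxv => (eq_empty_iff_forall_notMem.1 hemp x ⟨hx, hxv⟩).elim⟩
    · obtain ⟨z, hz, hmin⟩ := hS.exists_isMinOn hn ((hm.mono hSW).abs)
      refine ⟨|m z|, abs_pos.2 fun hz0 => ?_, fun x hx hxv => hmin ⟨hx, hxv⟩⟩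
      have hzx : z ≠ x₀ := fun h => by
        have := hz.2
        rw [h, mem_sphere, dist_self] at this
        exact hv0.ne this
      have e1 := hKs z hz.1
      rcases hinj z (hSW hz) x₀ hx₀W (hz0.trans hm0.symm) with hb | hb
      · unfold Btw at hb
        exact hzx (dist_le_zero.1 (by linarith))
      · unfold Btw at hb
        exact hzx (dist_le_zero.1 (by linarith)).symm
  have hmx : ContinuousAt m x₀ := hm.continuousAt (hW.mem_nhds hx₀W)
  obtain ⟨α', hα', hα'm⟩ := Metric.continuousAt_iff.1 hmx (c / 2) (by positivity)
  have freq₀ : ∃ᶠ t in nhdsWithin (0 : ℝ) (Ioi 0), dist (e t) x₀ < min α' v :=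
    (mapClusterPt_iff_frequently.1 hc₀) _ (ball_mem_nhds x₀ (lt_min hα' hv0))
  have freq₁ : ∃ᶠ t in nhdsWithin (0 : ℝ) (Ioi 0), v ≤ dist (e t) x₀ := by
    refine ((mapClusterPt_iff_frequently.1 hc₁) _ (ball_mem_nhds x₁ (sub_pos.2 hvd))).mono ?_
    intro t ht
    rw [mem_ball'] at ht
    have := dist_triangle x₁ (e t) x₀
    linarith
  have hD : ContinuousOn (fun t => dist (e t) x₀) (Ioc 0 τ₀) :=
    continuous_dist.comp_continuousOn (he.prodMk continuousOn_const)
  have cross : ∀ τ > 0, ∃ s u, 0 < s ∧ s ≤ u ∧ u < τ ∧ u ≤ τ₀ ∧ (∀ x ∈ Icc s u, e x ∈ W) ∧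
      |m (e s)| ≤ c / 2 ∧ c ≤ |m (e u)| := by
    intro τ hτ
    obtain ⟨s, u, hs, hsu, huτ, hu, hDs, hDu, hle⟩ :=
      exists_crossing hτ₀ hD (min_le_right α' v) freq₀ freq₁ hτ
    refine ⟨s, u, hs, hsu, huτ, hu, fun x hx => hcb (hle x hx), ?_, hcS _ (heK u ⟨hs.trans_le hsu, hu⟩) hDu⟩
    have := hα'm (hDs.trans_le (min_le_left _ _))
    rw [hm0, Real.dist_eq, sub_zero] at this
    exact this.le
  by_cases hsign : ∀ τ > 0, ∃ s u, 0 < s ∧ s ≤ u ∧ u < τ ∧ u ≤ τ₀ ∧ (∀ x ∈ Icc s u, e x ∈ W) ∧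
      m (e s) ≤ c / 2 ∧ c ≤ m (e u)
  · exact h.no_oscillation hF hW hWF hm hstar hinj hf he f0 hτ₀ hfe hc hsign
  · push Not at hsign
    obtain ⟨τ', hτ', hneg⟩ := hsign
    refine h.no_oscillation hF hW hWF hm.neg (fun x hx a ha hb => ?_) (fun y hy y' hy' hyy => ?_)
      hf he f0 hτ₀ hfe hc fun τ hτ => ?_
    · obtain ⟨h1, h2⟩ := hstar x hx a ha hb
      exact ⟨h1, by simp [h2]⟩
    · exact hinj y hy y' hy' (neg_injective hyy)
    · obtain ⟨s, u, hs, hsu, huτ, hu, hWe, h1, h2⟩ := cross (min τ τ') (lt_min hτ hτ')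
      have h3 := hneg s u hs hsu (huτ.trans_le (min_le_right _ _)) hu hWe ((le_abs_self _).trans h1)
      refine ⟨s, u, hs, hsu, huτ.trans_le (min_le_left _ _), hu, hWe, (neg_le_abs _).trans h1, ?_⟩
      rcases abs_cases (m (e u)) with ⟨h4, -⟩ | ⟨h4, -⟩
      · linarith
      · change c ≤ -m (e u)
        linarith

theorem Corner.exists_shadow (h : Corner 𝓕 E γ G p q r A B C ε₀) {a : X} (ha : a ∈ γ.img) {ε : ℝ}
    (hε : 0 < ε) (hε₀ : ε < ε₀) (hd : dist p a ≤ ε) :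
    ∃ w ∈ B, Btw p a w ∧ seg a w ⊆ G ∧ Btw p a (rad p ε w) ∧ dist p (rad p ε w) = ε := by
  obtain ⟨w, hw, hb, hs⟩ := h.exists_far_of_mem ha (hd.trans_lt hε₀)
  have hr : dist p (rad p ε w) = ε := dist_rad hε.le (hε₀.le.trans (h.far w hw))
  exact ⟨w, hw, hb, hs, hb.of_dist_le (btw_rad p ε w) (by rwa [hr]), hr⟩

set_option maxHeartbeats 1000000 in
/-- The geodesics from `p` through the points of the side converge. -/
theorem Corner.exists_limit (h : Corner 𝓕 E γ G p q r A B C ε₀) {f : ℝ → X} {d ε : ℝ}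
    (hf : YGeod E f 0 d) (f0 : f 0 = p) (hfT : f '' Icc 0 d ⊆ γ.img) (hd : 0 < d) (hε : 0 < ε)
    (hε₀ : ε < ε₀) : ∃ x₀, dist p x₀ = ε ∧
      (∀ δ > 0, ∃ t₀ > 0, ∀ t, 0 < t → t ≤ t₀ → t ≤ d → ∀ x, dist p x = ε → Btw p (f t) x →
        dist x x₀ ≤ δ) ∧
      ∃ q' ∈ B, Btw p x₀ q' ∧ seg p q' ⊆ G := by
  have hcf := hf.continuousOn h.rect
  have hBp : ∀ w ∈ B, w ≠ p := fun w hw he => by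
    have := h.far w hw
    rw [he, dist_self] at this
    linarith [h.radius.pos]
  have hnear : ∀ᶠ t in nhdsWithin (0 : ℝ) (Icc 0 d), dist p (f t) < ε := by
    have := (hcf 0 ⟨le_rfl, hd.le⟩)
    rw [ContinuousWithinAt, f0] at this
    exact ((tendsto_const_nhds.dist this).eventually_lt_const (by rwa [dist_self]))
  obtain ⟨τ, hτ, hτsub⟩ := Metric.mem_nhdsWithin_iff.1 hnear
  obtain ⟨τ₀, hτ₀, hτ₀m⟩ := exists_between (lt_min hτ hd)
  have hsub : Icc 0 τ₀ ⊆ Icc 0 d := Icc_subset_Icc_right (hτ₀m.le.trans (min_le_right _ _))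
  have hdist : ∀ t ∈ Icc 0 τ₀, dist p (f t) < ε := fun t ht => hτsub ⟨by
    rw [mem_ball, Real.dist_eq, sub_zero, abs_of_nonneg ht.1]
    exact ht.2.trans_lt (hτ₀m.trans_le (min_le_left _ _)), hsub ht⟩
  have hfne : ∀ t ∈ Ioc 0 τ₀, f t ≠ p := fun t ht he => ht.1.ne'
    (hf.injOn (hsub ⟨ht.1.le, ht.2⟩) ⟨le_rfl, hd.le⟩ (he.trans f0.symm))
  have : ∀ t, ∃ w, t ∈ Ioc 0 τ₀ → w ∈ B ∧ Btw p (f t) w ∧ seg (f t) w ⊆ G ∧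
      Btw p (f t) (rad p ε w) ∧ dist p (rad p ε w) = ε := by
    intro t
    by_cases ht : t ∈ Ioc 0 τ₀
    · obtain ⟨w, hw⟩ := h.exists_shadow (hfT ⟨t, hsub ⟨ht.1.le, ht.2⟩, rfl⟩) hε hε₀
        (hdist t ⟨ht.1.le, ht.2⟩).le
      exact ⟨w, fun _ => hw⟩
    · exact ⟨p, fun h => (ht h).elim⟩
  choose w hw using this
  set e : ℝ → X := fun t => rad p ε (w t) with he
  set K := rad p ε '' B with hKdef
  have hradc : ContinuousOn (rad p ε) B :=
    (continuousOn_rad p).comp (continuousOn_const.prodMk continuousOn_id) fun x hx => hBp x hx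
  have hK : IsCompact K := h.compact.image_of_continuousOn hradc
  have hKs : ∀ x ∈ K, dist p x = ε := by
    rintro _ ⟨x, hx, rfl⟩
    exact dist_rad hε.le (hε₀.le.trans (h.far x hx))
  have heK : ∀ t ∈ Ioc 0 τ₀, e t ∈ K := fun t ht => ⟨w t, (hw t ht).1, rfl⟩
  have hec : ContinuousOn e (Ioc 0 τ₀) := by
    intro t ht
    refine hK.tendsto_nhds_of_unique_mapClusterPt (eventually_mem_nhdsWithin.mono heK) ?_
    intro x hx hcl
    obtain ⟨U, hU, hUx⟩ := mapClusterPt_iff_ultrafilter.1 hcl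
    have hfU : Tendsto f U (nhds (f t)) := ((hcf.mono (Ioc_subset_Icc_self.trans hsub)) t ht).mono_left hU
    have hb : Btw p (f t) x := Btw.of_tendsto tendsto_const_nhds hfU hUx
      (hU (eventually_mem_nhdsWithin.mono fun s hs => (hw s hs).2.2.2.1))
    exact h.eq_of_btw (hfne t ht) (by rwa [hKs x hx]) hb (hw t ht).2.2.2.1
      ((hKs x hx).trans (hw t ht).2.2.2.2.symm)
  have hfe : ∀ t ∈ Ioc 0 τ₀, f t ≠ p ∧ f t ∈ γ.img ∧ dist p (f t) < ε₀ ∧ Btw p (f t) (e t) :=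
    fun t ht => ⟨hfne t ht, hfT ⟨t, hsub ⟨ht.1.le, ht.2⟩, rfl⟩,
      (hdist t ⟨ht.1.le, ht.2⟩).trans hε₀, (hw t ht).2.2.2.1⟩
  have hcf' := hcf.mono hsub
  have hevK : ∀ᶠ t in nhdsWithin (0 : ℝ) (Ioi 0), e t ∈ K := by
    filter_upwards [Ioc_mem_nhdsGT hτ₀] with t ht using heK t ht
  obtain ⟨x₀, hx₀K, hx₀⟩ := hK.exists_mapClusterPt_of_frequently hevK.frequently
  have huniq : ∀ x ∈ K, MapClusterPt x (nhdsWithin (0 : ℝ) (Ioi 0)) e → x = x₀ := by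
    intro x₁ hx₁K hx₁
    by_contra hne
    have hb : 0 < dist x₁ x₀ := dist_pos.2 hne
    obtain ⟨v, hv, hvn⟩ := (Ioo_infinite hb).exists_notMem_finite
      ((h.radius.finite_sphere ε ⟨hε, hε₀⟩).image fun x => dist x x₀)
    have hD : ContinuousOn (fun t => dist (e t) x₀) (Ioc 0 τ₀) :=
      continuous_dist.comp_continuousOn (hec.prodMk continuousOn_const)
    have freq₀ : ∃ᶠ t in nhdsWithin (0 : ℝ) (Ioi 0), dist (e t) x₀ < v :=
      (mapClusterPt_iff_frequently.1 hx₀) _ (ball_mem_nhds x₀ hv.1)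
    have freq₁ : ∃ᶠ t in nhdsWithin (0 : ℝ) (Ioi 0), v ≤ dist (e t) x₀ := by
      refine ((mapClusterPt_iff_frequently.1 hx₁) _ (ball_mem_nhds x₁ (sub_pos.2 hv.2))).mono ?_
      intro t ht
      rw [mem_ball'] at ht
      have := dist_triangle x₁ (e t) x₀
      linarith
    have hfreq : ∃ᶠ t in nhdsWithin (0 : ℝ) (Ioi 0), e t ∈ K ∩ sphere x₀ v := by
      refine frequently_of_forall_exists fun τ hτ => ?_
      obtain ⟨s, u, hs, hsu, huτ, hu, -, hDu, -⟩ := exists_crossing hτ₀ hD le_rfl freq₀ freq₁ hτ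
      exact ⟨u, ⟨hs.trans_le hsu, huτ⟩, heK u ⟨hs.trans_le hsu, hu⟩, hDu⟩
    obtain ⟨z, ⟨hzK, hzv⟩, hz⟩ := (hK.inter_right isClosed_sphere).exists_mapClusterPt_of_frequently hfreq
    have hzF : z ∈ ⋃₀ 𝓕 := by
      by_contra hzF
      exact hvn ⟨z, ⟨by rw [mem_sphere', hKs z hzK], hzF⟩, hzv⟩
    obtain ⟨F, hF, hzF⟩ := hzF
    have := h.cluster_unique_of_face hF hε hε₀ hK hKs hcf' hec f0 hτ₀ heK hfe hzF hzK hz hx₀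
    rw [this, mem_sphere, dist_self] at hzv
    exact hv.1.ne hzv
  have hlim : Tendsto e (nhdsWithin (0 : ℝ) (Ioi 0)) (nhds x₀) :=
    hK.tendsto_nhds_of_unique_mapClusterPt hevK huniq
  refine ⟨x₀, hKs x₀ hx₀K, fun δ hδ => ?_, ?_⟩
  · obtain ⟨t₁, ht₁, hsub₁⟩ := mem_nhdsGT_iff_exists_Ioo_subset.1
      (hlim (closedBall_mem_nhds x₀ hδ))
    have ht₁' : (0 : ℝ) < t₁ := ht₁
    refine ⟨min τ₀ (t₁ / 2), lt_min hτ₀ (by linarith), fun t ht htt _ x hx hb => ?_⟩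
    have ht' : t ∈ Ioc 0 τ₀ := ⟨ht, htt.trans (min_le_left _ _)⟩
    have : x = e t := h.eq_of_btw (hfne t ht') (by rwa [hx]) hb (hw t ht').2.2.2.1
      (hx.trans (hw t ht').2.2.2.2.symm)
    rw [this]
    exact hsub₁ ⟨ht, htt.trans_lt ((min_le_right _ _).trans_lt (by linarith))⟩
  · have hevB : ∀ᶠ t in nhdsWithin (0 : ℝ) (Ioi 0), w t ∈ B := by
      filter_upwards [Ioc_mem_nhdsGT hτ₀] with t ht using (hw t ht).1
    obtain ⟨q', hq'B, hq'⟩ := h.compact.exists_mapClusterPt_of_frequently hevB.frequently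
    obtain ⟨U, hU, hUq⟩ := mapClusterPt_iff_ultrafilter.1 hq'
    have hUe := hlim.mono_left hU
    have hUI : ∀ᶠ t in (U : Filter ℝ), t ∈ Ioc 0 τ₀ := hU (Ioc_mem_nhdsGT hτ₀)
    have hUf : Tendsto f U (nhds p) := by
      have := hcf' 0 ⟨le_rfl, hτ₀.le⟩
      rw [ContinuousWithinAt, f0] at this
      refine this.mono_left (le_inf (hU.trans nhdsWithin_le_nhds) ?_)
      exact le_principal_iff.2 (mem_of_superset hUI Ioc_subset_Icc_self)
    refine ⟨q', hq'B, Btw.of_tendsto tendsto_const_nhds hUe hUq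
      (Eventually.of_forall fun t => btw_rad p ε (w t)), ?_⟩
    rw [seg_eq_image]
    rintro _ ⟨s, hs, rfl⟩
    have hc : Tendsto (fun t => pt (f t) (w t) s) U (nhds (pt p q' s)) :=
      (continuous_pt.tendsto (p, q', s)).comp (hUf.prodMk_nhds (hUq.prodMk_nhds tendsto_const_nhds))
    exact h.fill.compact.isClosed.mem_of_tendsto hc (hUI.mono fun t ht => (hw t ht).2.2.1 (btw_pt _ _ _))

end Limit

end Cat2Cx

end

noncomputable section

namespace Cat2Cx

section Conclusion
variable {X : Type*} [MetricSpace X] [CAT0Space X] {E : Set X} {𝓕 : Set (Set X)}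
  {γ : SCC X} {G A B C : Set X} {p q r : X} {ε₀ : ℝ}

theorem geodSeg_xDist (x y : X) : geodSeg (xDist X) univ x y = seg x y := by
  refine Subset.antisymm (iUnion₂_subset ?_) fun z hz => ?_
  · rintro f ⟨h0, h1, ⟨-, hf⟩, -⟩ _ ⟨t, ht, rfl⟩
    have h0' : (0 : ℝ) ∈ Icc 0 (dist x y) := ⟨le_rfl, dist_nonneg⟩
    have h1' : dist x y ∈ Icc 0 (dist x y) := ⟨dist_nonneg, le_rfl⟩
    have e1 := hf 0 h0' t ht
    have e2 := hf t ht _ h1'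
    simp only [xDist] at h1 e1 e2
    rw [h0, zero_sub, abs_neg, abs_of_nonneg ht.1] at e1
    rw [h1, abs_sub_comm, abs_of_nonneg (sub_nonneg.2 ht.2)] at e2
    change dist x (f t) + dist (f t) y = dist x y
    rw [e1, e2]; ring
  · refine mem_biUnion (x := fun t => pt x y (t / dist x y)) ?_ ?_
    · rcases eq_or_ne x y with rfl | hne
      · refine ⟨by simp [pt_zero], by simp [pt_zero], ⟨dist_nonneg, ?_⟩, fun _ _ => mem_univ _⟩
        simp only [xDist, dist_self, Icc_self, mem_singleton_iff]
        rintro s rfl t rfl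
        simp
      · have hd := dist_pos.2 hne
        refine ⟨by simp [pt_zero], by simp [xDist, div_self hd.ne', pt_one], ⟨dist_nonneg, ?_⟩,
          fun _ _ => mem_univ _⟩
        intro s hs t ht
        simp only [xDist] at *
        rw [dist_pt_pt ⟨div_nonneg hs.1 hd.le, (div_le_one hd).2 hs.2⟩
          ⟨div_nonneg ht.1 hd.le, (div_le_one hd).2 ht.2⟩, ← sub_div, abs_div, abs_of_pos hd,
          div_mul_cancel₀ _ hd.ne']
    · exact ⟨dist x z, ⟨dist_nonneg, Btw.dist_le_left hz⟩, (Btw.eq_rad hz).symm⟩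

theorem Corner.exists_limitSegment (h : Corner 𝓕 E γ G p q r A B C ε₀) (hqp : q ≠ p) {ε₁ ε : ℝ}
    (hε : 0 < ε) (hε₁ : ε ≤ ε₁) (hε₀ : ε₁ < ε₀) :
    ∃ R : ℝ → X, IsLimitSegment E p q ε R ∧ ∃ q' ∈ B,
      R '' Icc 0 ε ⊆ geodSeg (xDist X) univ p q' ∧
      geodSeg (xDist X) univ p q' ⊆ γ.img ∪ γ.interiorSet := by
  obtain ⟨f, d, hf, f0, f1, him⟩ := h.side
  have hε₁0 : 0 < ε₁ := hε.trans_le hε₁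
  have hdE : pathDistIn E p q = d := by
    have := hf.1.2 0 ⟨le_rfl, hf.1.1⟩ d ⟨hf.1.1, le_rfl⟩
    rwa [f0, f1, zero_sub, abs_neg, abs_of_nonneg hf.1.1] at this
  have hd : 0 < d := lt_of_le_of_ne hf.1.1 fun h0 => hqp (by rw [← f1, ← h0, f0])
  obtain ⟨x₀, hx₀, hlim, q', hq', hb, hG⟩ := h.exists_limit hf f0
    (by rw [him, h.img]; exact subset_union_left.trans subset_union_left) hd hε₁0 hε₀
  have hfrac : ∀ {s}, s ∈ Icc 0 ε → s / ε₁ ∈ Icc (0 : ℝ) 1 := fun hs =>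
    ⟨div_nonneg hs.1 hε₁0.le, (div_le_one hε₁0).2 (hs.2.trans hε₁)⟩
  refine ⟨fun s => pt p x₀ (s / ε₁), ⟨hε, by simp [pt_zero], ⟨hε.le, ?_⟩, ?_⟩, q', hq', ?_, ?_⟩
  · intro s hs t ht
    simp only
    rw [dist_pt_pt (hfrac hs) (hfrac ht), hx₀, ← sub_div, abs_div, abs_of_pos hε₁0,
      div_mul_cancel₀ _ hε₁0.ne']
  · intro σ hσ δ hδ
    obtain ⟨hσ0, hσ1, hσg, hσm⟩ := hσ
    rw [hdE] at hσ1 hσg hσm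
    have heq := h.planar.ygeod_unique h.rect h.h1 hf ⟨hσg, hσm⟩ (f0.trans hσ0.symm)
      (f1.trans hσ1.symm)
    obtain ⟨t₁, ht₁, hlim⟩ := hlim δ hδ
    refine ⟨min t₁ ε, lt_min ht₁ hε, fun t ht htt htd g hg g0 hgt s hs => ?_⟩
    rw [hdE] at htd
    have htI : t ∈ Icc 0 d := ⟨ht.le, htd⟩
    rw [← heq htI] at hgt
    have hfT : f t ∈ γ.img := by
      rw [h.img]
      exact Or.inl (Or.inl (him ▸ ⟨t, htI, rfl⟩))
    have hdt : dist p (f t) ≤ ε := by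
      have := hf.dist_le h.rect ⟨le_rfl, hf.1.1⟩ htI
      rw [f0, zero_sub, abs_neg, abs_of_pos ht] at this
      exact this.trans (htt.trans (min_le_right _ _))
    have hne : f t ≠ p := fun he => ht.ne' (hf.injOn htI ⟨le_rfl, hf.1.1⟩ (he.trans f0.symm))
    obtain ⟨w, -, -, -, hbw, hdw⟩ := h.exists_shadow hfT hε₁0 hε₀ (hdt.trans hε₁)
    set x := rad p ε₁ w with hx
    have hclose : dist x x₀ ≤ δ := hlim t ht (htt.trans (min_le_left _ _)) htd x hdw hbw
    have gdist : ∀ {a b}, 0 ≤ a → a ≤ b → b ≤ ε → Btw p (g a) (g b) ∧ dist p (g b) = b := by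
      intro a b ha hab hb
      have e0 := hg.2 0 ⟨le_rfl, hε.le⟩ a ⟨ha, hab.trans hb⟩
      have e1 := hg.2 a ⟨ha, hab.trans hb⟩ b ⟨ha.trans hab, hb⟩
      have e2 := hg.2 0 ⟨le_rfl, hε.le⟩ b ⟨ha.trans hab, hb⟩
      simp only at e0 e1 e2
      rw [g0, zero_sub, abs_neg, abs_of_nonneg ha] at e0
      rw [g0, zero_sub, abs_neg, abs_of_nonneg (ha.trans hab)] at e2
      rw [abs_sub_comm, abs_of_nonneg (sub_nonneg.2 hab)] at e1
      exact ⟨by unfold Btw; rw [e0, e1, e2]; ring, e2⟩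
    have hgε := gdist dist_nonneg hdt le_rfl
    rw [hgt] at hgε
    have hv : dist p (rad p ε x) = ε := dist_rad hε.le (by rwa [hdw])
    have hbv := btw_rad p ε x
    have hge : g ε = rad p ε x := h.eq_of_btw hne (by rw [hgε.2]; exact hε₁.trans_lt hε₀) hgε.1
      (hbw.of_dist_le hbv (by rwa [hv])) (hgε.2.trans hv.symm)
    have hgs := gdist hs.1 hs.2 le_rfl
    have hgs' := gdist le_rfl hs.1 hs.2
    have hgx : g s = pt p x (s / ε₁) := by
      refine Btw.eq_pt (hfrac hs) ?_ ?_
      · refine Btw.trans_left hbv ?_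
        rw [← hge]; exact hgs.1
      · rw [hgs'.2, hdw, div_mul_cancel₀ _ hε₁0.ne']
    rw [hgx]
    calc dist (pt p x (s / ε₁)) (pt p x₀ (s / ε₁)) ≤ s / ε₁ * dist x x₀ :=
          dist_pt_pt_le (hfrac hs) p x x₀
      _ ≤ 1 * dist x x₀ := mul_le_mul_of_nonneg_right (hfrac hs).2 dist_nonneg
      _ ≤ δ := by rwa [one_mul]
  · rw [geodSeg_xDist]
    rintro _ ⟨s, hs, rfl⟩
    exact hb.trans_left (btw_pt _ _ _)
  · rw [geodSeg_xDist]
    exact hG.trans (h.fill.subset_interior h.planar)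

/-- The main statement for locally planar CAT(0) spaces. -/
theorem LocallyPlanar.limit_segments (hP : LocallyPlanar 𝓕) (hE : RectConnected E)
    (hH1 : H1Trivial E) (γ : SCC X) (p q r : X) (hT : IsYTriangle E γ.img p q r) :
    ∃ ε₀ > 0, ∀ ε, 0 < ε → ε ≤ ε₀ →
      ∃ Rq Rr : ℝ → X, IsLimitSegment E p q ε Rq ∧ IsLimitSegment E p r ε Rr ∧
        (∃ q' ∈ geodSeg (pathDistIn E) E q r,
          Rq '' Set.Icc 0 ε ⊆ geodSeg (xDist X) Set.univ p q' ∧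
          geodSeg (xDist X) Set.univ p q' ⊆ γ.img ∪ γ.interiorSet) ∧
        (∃ r' ∈ geodSeg (pathDistIn E) E q r,
          Rr '' Set.Icc 0 ε ⊆ geodSeg (xDist X) Set.univ p r' ∧
          geodSeg (xDist X) Set.univ p r' ⊆ γ.img ∪ γ.interiorSet) := by
  obtain ⟨-, -, -, hT⟩ := hT
  obtain ⟨sA, sB, sC, hpB, hAC⟩ := hP.triangle_sides hE hH1 γ (IsSide.geodSeg_eq hP hE hH1)
    (IsSide.geodSeg_eq hP hE hH1) (fun hn => (IsSide.geodSeg_eq hP hE hH1 hn).symm) hT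
  set A := geodSeg (pathDistIn E) E p q
  set B := geodSeg (pathDistIn E) E q r
  set C := geodSeg (pathDistIn E) E r p
  have side_sub : ∀ {S : Set X} {x y : X}, IsSide E S x y → S ⊆ E := by
    rintro S x y ⟨f, d, hf, -, -, rfl⟩
    exact hf.2.image_subset
  have hγE : γ.img ⊆ E := by
    rw [hT]
    exact union_subset (union_subset (side_sub sA) (side_sub sB)) (side_sub sC)
  obtain ⟨K, hK, hγK, hKE, hun⟩ := γ.exists_compact_unwinds hγE (hH1 _ _)
  obtain ⟨G, hGK, hG⟩ := exists_minUnwind hK hγK hun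
  obtain ⟨ε₀, hr, hball⟩ := hP.exists_radius_lt p ((sB.isCompact hE).isClosed.isOpen_compl.mem_nhds hpB)
  have h : Corner 𝓕 E γ G p q r A B C ε₀ :=
    ⟨hP, hE, hH1, sA, sC, sB.isCompact hE, hAC, hT, hG, hGK.trans hKE, hr, fun x hx => by
      by_contra! hlt
      exact hball (by rwa [mem_ball']) hx⟩
  have hqp : q ≠ p := fun he => hpB (he ▸ sB.left_mem)
  have hrp : r ≠ p := fun he => hpB (he ▸ sB.symm.left_mem)
  refine ⟨ε₀ / 2, half_pos hr.pos, fun ε hε hle => ?_⟩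
  obtain ⟨Rq, h1, h2⟩ := h.exists_limitSegment hqp hε hle (half_lt_self hr.pos)
  obtain ⟨Rr, h3, h4⟩ := h.swap.exists_limitSegment hrp hε hle (half_lt_self hr.pos)
  exact ⟨Rq, Rr, h1, h3, h2, h4⟩

end Conclusion

end Cat2Cx

end

noncomputable section

namespace Cat2Cx

/-! ### The angle condition implies Stewart's inequality -/

section Angle
variable {X : Type*} [MetricSpace X]

/-- Convexity of `cosh ∘ √`. -/
theorem cosh_le_of_sq_eq {a b c l m : ℝ} (hl : 0 ≤ l) (hm : 0 ≤ m) (hlm : l + m = 1)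
    (h : c ^ 2 = l * a ^ 2 + m * b ^ 2) :
    Real.cosh c ≤ l * Real.cosh a + m * Real.cosh b := by
  refine hasSum_le (fun n => ?_) (Real.hasSum_cosh c)
    (((Real.hasSum_cosh a).mul_left l).add ((Real.hasSum_cosh b).mul_left m))
  have h1 := (convexOn_pow (𝕜 := ℝ) n).2 (sq_nonneg a : a ^ 2 ∈ Ici (0:ℝ))
    (sq_nonneg b : b ^ 2 ∈ Ici (0:ℝ)) hl hm hlm
  simp only [smul_eq_mul] at h1
  rw [← h] at h1
  have h2 : (0:ℝ) < ((2 * n).factorial : ℝ) := by positivity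
  rw [pow_mul, pow_mul, pow_mul, ← mul_div_assoc, ← mul_div_assoc, ← add_div]
  exact div_le_div_of_nonneg_right h1 h2.le

theorem eucl_ratio_mem {a b c : ℝ} (ha : 0 < a) (hb : 0 < b) (h1 : |a - b| ≤ c) (h2 : c ≤ a + b) :
    (a ^ 2 + b ^ 2 - c ^ 2) / (2 * a * b) ∈ Icc (-1:ℝ) 1 := by
  have hc : 0 ≤ c := (abs_nonneg _).trans h1
  have h3 : (a - b) ^ 2 ≤ c ^ 2 := by
    rw [← sq_abs (a - b)]; exact pow_le_pow_left₀ (abs_nonneg _) h1 2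
  have h4 : c ^ 2 ≤ (a + b) ^ 2 := pow_le_pow_left₀ hc h2 2
  have hab : 0 < 2 * a * b := by positivity
  constructor
  · rw [le_div_iff₀ hab]; nlinarith
  · rw [div_le_iff₀ hab]; nlinarith

theorem cos_euclCompAngle {a b c : ℝ} (ha : 0 < a) (hb : 0 < b) (h1 : |a - b| ≤ c)
    (h2 : c ≤ a + b) :
    Real.cos (euclCompAngle a b c) = (a ^ 2 + b ^ 2 - c ^ 2) / (2 * a * b) :=
  Real.cos_arccos (eucl_ratio_mem ha hb h1 h2).1 (eucl_ratio_mem ha hb h1 h2).2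

theorem compAngle_le {κ a b c : ℝ} (hκ : κ ≤ 0) (ha : 0 < a) (hb : 0 < b) (h1 : |a - b| ≤ c)
    (h2 : c ≤ a + b) : compAngle κ a b c ≤ euclCompAngle a b c := by
  unfold compAngle
  split_ifs with h0
  · exact le_rfl
  have hs : 0 < Real.sqrt (-κ) := Real.sqrt_pos.2 (by
    rcases hκ.lt_or_eq with h | h
    · linarith
    · exact absurd h h0)
  set s := Real.sqrt (-κ)
  have hsa : 0 < Real.sinh (s * a) := Real.sinh_pos_iff.2 (by positivity)
  have hsb : 0 < Real.sinh (s * b) := Real.sinh_pos_iff.2 (by positivity)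
  apply Real.arccos_le_arccos
  rw [le_div_iff₀ (by positivity)]
  have hx := eucl_ratio_mem ha hb h1 h2
  set x := (a ^ 2 + b ^ 2 - c ^ 2) / (2 * a * b) with hxd
  have hcx : c ^ 2 = a ^ 2 + b ^ 2 - 2 * a * b * x := by rw [hxd]; field_simp; ring
  have := cosh_le_of_sq_eq (a := s * a - s * b) (b := s * a + s * b) (c := s * c)
    (l := (1 + x) / 2) (m := (1 - x) / 2) (by linarith [hx.1]) (by linarith [hx.2]) (by ring)
    (by rw [mul_pow, hcx]; ring)
  rw [Real.cosh_sub, Real.cosh_add] at this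
  linarith

theorem dist_sq_le_of_euclCompAngle {z u v : X} {θ : ℝ} (hu : 0 < dist z u) (hv : 0 < dist z v)
    (hθ : θ ≤ Real.pi) (h : euclCompAngle (dist z u) (dist z v) (dist u v) ≤ θ) :
    dist u v ^ 2 ≤ dist z u ^ 2 + dist z v ^ 2 - 2 * dist z u * dist z v * Real.cos θ := by
  have h1 : |dist z u - dist z v| ≤ dist u v := by
    rw [dist_comm z u, dist_comm z v]; exact abs_dist_sub_le u v z
  have h2 : dist u v ≤ dist z u + dist z v := by
    rw [dist_comm z u]; exact dist_triangle u z v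
  have h3 := Real.cos_le_cos_of_nonneg_of_le_pi (Real.arccos_nonneg _) hθ h
  have h4 := cos_euclCompAngle hu hv h1 h2
  unfold euclCompAngle at h4
  rw [h4, le_div_iff₀ (by positivity)] at h3
  linarith

theorem eventually_euclCompAngle_lt {z : X} {σ τ : ℝ → X} {θ : ℝ}
    (h : upperAngleWrt (fun x y : X => dist x y) z σ τ < θ) :
    ∃ ε > 0, ∀ s t, 0 < s → s < ε → 0 < t → t < ε →
      euclCompAngle (dist z (σ s)) (dist z (τ t)) (dist (σ s) (τ t)) < θ := by
  unfold upperAngleWrt at h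
  obtain ⟨a, ⟨ε, hε, rfl⟩, ha⟩ := exists_lt_of_csInf_lt (by exact ⟨_, 1, one_pos, rfl⟩) h
  refine ⟨ε, hε, fun s t h1 h2 h3 h4 => lt_of_le_of_lt (le_csSup ?_ ?_) ha⟩
  · refine ⟨Real.pi, ?_⟩
    rintro b ⟨s, t, -, -, -, -, rfl⟩
    exact Real.arccos_le_pi _
  · exact ⟨s, t, h1, h2, h3, h4, rfl⟩

set_option maxHeartbeats 1000000 in
/-- The cosines of adjacent angles along a geodesic have nonpositive sum. -/
theorem cos_add_cos_nonpos {x y z o : X} {σ τ ρ : ℝ → X} (hb : Btw x z y) (hxz : z ≠ x)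
    (hyz : z ≠ y) (hoz : z ≠ o)
    (hσ : IsGeodesicFromTo (fun x y : X => dist x y) univ σ z x)
    (hτ : IsGeodesicFromTo (fun x y : X => dist x y) univ τ z y)
    (hρ : IsGeodesicFromTo (fun x y : X => dist x y) univ ρ z o) {θ₁ θ₂ : ℝ}
    (hp₁ : θ₁ ≤ Real.pi) (hp₂ : θ₂ ≤ Real.pi)
    (h₁ : upperAngleWrt (fun x y : X => dist x y) z σ ρ ≤ θ₁)
    (h₂ : upperAngleWrt (fun x y : X => dist x y) z τ ρ ≤ θ₂) :
    Real.cos θ₁ + Real.cos θ₂ ≤ 0 := by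
  by_contra! hpos
  have hlt₁ : θ₁ < Real.pi := by
    refine hp₁.lt_of_ne fun he => ?_
    rw [he, Real.cos_pi] at hpos
    linarith [Real.cos_le_one θ₂]
  have hlt₂ : θ₂ < Real.pi := by
    refine hp₂.lt_of_ne fun he => ?_
    rw [he, Real.cos_pi] at hpos
    linarith [Real.cos_le_one θ₁]
  have hev : ∀ᶠ δ : ℝ in nhdsWithin 0 (Ioi 0), 0 < Real.cos (θ₁ + δ) + Real.cos (θ₂ + δ) ∧
      θ₁ + δ < Real.pi ∧ θ₂ + δ < Real.pi := by
    apply Filter.Eventually.filter_mono nhdsWithin_le_nhds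
    have c1 : Continuous fun δ : ℝ => Real.cos (θ₁ + δ) + Real.cos (θ₂ + δ) := by fun_prop
    have c2 : Continuous fun δ : ℝ => θ₁ + δ := by fun_prop
    have c3 : Continuous fun δ : ℝ => θ₂ + δ := by fun_prop
    refine (c1.continuousAt.eventually_const_lt (by simpa using hpos)).and
      ((c2.continuousAt.eventually_lt_const (by simpa using hlt₁)).and
      (c3.continuousAt.eventually_lt_const (by simpa using hlt₂)))
  obtain ⟨δ, ⟨hC, hπ₁, hπ₂⟩, hδ⟩ := (hev.and self_mem_nhdsWithin).exists
  have hδ : 0 < δ := hδ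
  obtain ⟨ε₁, hε₁, H₁⟩ := eventually_euclCompAngle_lt (h₁.trans_lt (lt_add_of_pos_right θ₁ hδ))
  obtain ⟨ε₂, hε₂, H₂⟩ := eventually_euclCompAngle_lt (h₂.trans_lt (lt_add_of_pos_right θ₂ hδ))
  set C₁ := Real.cos (θ₁ + δ)
  set C₂ := Real.cos (θ₂ + δ)
  have hC₁ : C₁ ≤ 1 := Real.cos_le_one _
  have hC₂ : C₂ ≤ 1 := Real.cos_le_one _
  set w := (C₁ + C₂) / 2 with hw
  have hw0 : 0 < w := by rw [hw]; linarith
  have hw1 : w ≤ 1 := by rw [hw]; linarith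
  have hzx := dist_pos.2 hxz
  have hzy := dist_pos.2 hyz
  have hzo := dist_pos.2 hoz
  obtain ⟨s, hs0, hs⟩ : ∃ s > 0, s < ε₁ ∧ s < ε₂ ∧ s ≤ dist z x ∧ s ≤ dist z y ∧ s ≤ dist z o := by
    refine ⟨min (min (ε₁ / 2) (ε₂ / 2)) (min (dist z x) (min (dist z y) (dist z o))), ?_, ?_⟩
    · simp only [gt_iff_lt, lt_min_iff]
      exact ⟨⟨by linarith, by linarith⟩, hzx, hzy, hzo⟩
    · refine ⟨?_, ?_, ?_, ?_, ?_⟩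
      · exact ((min_le_left _ _).trans (min_le_left _ _)).trans_lt (by linarith)
      · exact ((min_le_left _ _).trans (min_le_right _ _)).trans_lt (by linarith)
      · exact (min_le_right _ _).trans (min_le_left _ _)
      · exact (min_le_right _ _).trans ((min_le_right _ _).trans (min_le_left _ _))
      · exact (min_le_right _ _).trans ((min_le_right _ _).trans (min_le_right _ _))
  obtain ⟨hs1, hs2, hsx, hsy, hso⟩ := hs
  have hws : w * s ≤ s := by nlinarith
  have hws0 : 0 < w * s := by positivity
  obtain ⟨σ0, σ1, ⟨-, σd⟩, -⟩ := hσ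
  obtain ⟨τ0, τ1, ⟨-, τd⟩, -⟩ := hτ
  obtain ⟨ρ0, ρ1, ⟨-, ρd⟩, -⟩ := hρ
  have eσ : dist z (σ s) = s := by
    have := σd 0 ⟨le_rfl, hzx.le⟩ s ⟨hs0.le, hsx⟩
    simp only [σ0] at this
    rw [this, zero_sub, abs_neg, abs_of_pos hs0]
  have eτ : dist z (τ s) = s := by
    have := τd 0 ⟨le_rfl, hzy.le⟩ s ⟨hs0.le, hsy⟩
    simp only [τ0] at this
    rw [this, zero_sub, abs_neg, abs_of_pos hs0]
  have eρ : dist z (ρ (w * s)) = w * s := by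
    have := ρd 0 ⟨le_rfl, hzo.le⟩ (w * s) ⟨hws0.le, hws.trans hso⟩
    simp only [ρ0] at this
    rw [this, zero_sub, abs_neg, abs_of_pos hws0]
  have fσ : dist x (σ s) = dist z x - s := by
    have := σd (dist z x) ⟨hzx.le, le_rfl⟩ s ⟨hs0.le, hsx⟩
    simp only [σ1] at this
    rw [this, abs_of_nonneg (by linarith)]
  have fτ : dist (τ s) y = dist z y - s := by
    have := τd (dist z y) ⟨hzy.le, le_rfl⟩ s ⟨hs0.le, hsy⟩
    simp only [τ1] at this
    rw [dist_comm, this, abs_of_nonneg (by linarith)]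
  have hfar : 2 * s ≤ dist (σ s) (τ s) := by
    have := dist_triangle4 x (σ s) (τ s) y
    unfold Btw at hb
    rw [dist_comm x z] at hb
    linarith
  have key : ∀ {v : X} {C : ℝ}, C ≤ 1 → dist v (ρ (w * s)) ^ 2 ≤ s ^ 2 + (w * s) ^ 2
      - 2 * s * (w * s) * C → dist v (ρ (w * s)) ≤ s * (1 + (w ^ 2 - 2 * w * C) / 2) := by
    intro v C hC h
    refine le_of_sq_le_sq (h.trans ?_) (mul_nonneg hs0.le ?_)
    · nlinarith [sq_nonneg (s * ((w ^ 2 - 2 * w * C) / 2))]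
    · nlinarith [sq_nonneg (1 - w)]
  have a1 := dist_sq_le_of_euclCompAngle (by rw [eσ]; exact hs0) (by rw [eρ]; exact hws0) hπ₁.le
    (H₁ s (w * s) hs0 hs1 hws0 (hws.trans_lt hs1)).le
  have a2 := dist_sq_le_of_euclCompAngle (by rw [eτ]; exact hs0) (by rw [eρ]; exact hws0) hπ₂.le
    (H₂ s (w * s) hs0 hs2 hws0 (hws.trans_lt hs2)).le
  rw [eσ, eρ] at a1
  rw [eτ, eρ] at a2
  have b1 := key hC₁ a1
  have b2 := key hC₂ a2
  have b3 := dist_triangle_right (σ s) (τ s) (ρ (w * s))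
  have b4 : 0 < s * w ^ 2 := by positivity
  have b5 : C₁ + C₂ = 2 * w := by rw [hw]; ring
  have b6 : s * (1 + (w ^ 2 - 2 * w * C₁) / 2) + s * (1 + (w ^ 2 - 2 * w * C₂) / 2)
      = 2 * s + s * w ^ 2 - s * w * (C₁ + C₂) := by ring
  rw [b5] at b6
  nlinarith

theorem IsCATSpace.cat0Space {κ : ℝ} (hX : IsCATSpace κ X) (hκ : κ ≤ 0) : CAT0Space X where
  exists_pt x y t ht := by
    obtain ⟨f, f0, f1, ⟨-, hf⟩, -⟩ := hX.1 x (mem_univ _) y (mem_univ _)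
    have hd := dist_nonneg (x := x) (y := y)
    have hm : t * dist x y ∈ Icc 0 (dist x y) :=
      ⟨mul_nonneg ht.1 hd, mul_le_of_le_one_left hd ht.2⟩
    refine ⟨f (t * dist x y), ?_, ?_⟩
    · have := hf 0 ⟨le_rfl, hd⟩ _ hm
      simp only [f0] at this
      rw [this, zero_sub, abs_neg, abs_of_nonneg hm.1]
    · have := hf _ hm (dist x y) ⟨hd, le_rfl⟩
      simp only [f1] at this
      rw [this, abs_sub_comm, abs_of_nonneg (by linarith [hm.2])]
      ring
  stewart o x y z t ht h1 h2 := by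
    by_cases hxz : z = x
    · subst hxz
      rw [dist_self] at h1
      rcases mul_eq_zero.1 h1.symm with h | h
      · subst h; simp
      · rw [h, dist_eq_zero.1 h]; nlinarith
    by_cases hyz : z = y
    · subst hyz
      rw [dist_self] at h2
      rcases mul_eq_zero.1 h2.symm with h | h
      · obtain rfl : t = 1 := by linarith
        simp
      · rw [h, dist_eq_zero.1 h]; nlinarith
    by_cases hoz : z = o
    · subst hoz
      rw [dist_self, dist_comm z x, h1, h2]
      nlinarith
    by_cases hox : o = x
    · subst hox
      rw [h1, dist_self]
      nlinarith
    by_cases hoy : o = y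
    · subst hoy
      rw [dist_comm o z, h2, dist_self, dist_comm o x]
      nlinarith
    have hb : Btw x z y := by unfold Btw; rw [h1, h2]; ring
    obtain ⟨σ, hσ⟩ := hX.1 z (mem_univ _) x (mem_univ _)
    obtain ⟨τ, hτ⟩ := hX.1 z (mem_univ _) y (mem_univ _)
    obtain ⟨ρ, hρ⟩ := hX.1 z (mem_univ _) o (mem_univ _)
    have hzx := dist_pos.2 hxz
    have hzy := dist_pos.2 hyz
    have hzo := dist_pos.2 hoz
    have tri : ∀ u : X, |dist z u - dist z o| ≤ dist u o := fun u => by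
      rw [dist_comm z u, dist_comm z o]; exact abs_dist_sub_le u o z
    have tri' : ∀ u : X, dist u o ≤ dist z u + dist z o := fun u => by
      rw [dist_comm z u]; exact dist_triangle u z o
    have A1 := (hX.2 z (mem_univ _) x (mem_univ _) o (mem_univ _) hxz hoz (Ne.symm hox) σ ρ hσ hρ).trans
      (compAngle_le hκ hzx hzo (tri x) (tri' x))
    have A2 := (hX.2 z (mem_univ _) y (mem_univ _) o (mem_univ _) hyz hoz (Ne.symm hoy) τ ρ hτ hρ).trans
      (compAngle_le hκ hzy hzo (tri y) (tri' y))
    have hc : Real.cos (euclCompAngle (dist z x) (dist z o) (dist x o)) +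
        Real.cos (euclCompAngle (dist z y) (dist z o) (dist y o)) ≤ 0 :=
      cos_add_cos_nonpos hb hxz hyz hoz hσ hτ hρ (Real.arccos_le_pi _) (Real.arccos_le_pi _) A1 A2
    rw [cos_euclCompAngle hzx hzo (tri x) (tri' x), cos_euclCompAngle hzy hzo (tri y) (tri' y),
      div_add_div _ _ (by positivity) (by positivity), div_le_iff₀ (by positivity), zero_mul] at hc
    rw [dist_comm x z] at h1
    have hD : 0 < dist x y := by
      rcases (dist_nonneg (x := x) (y := y)).lt_or_eq with h | h
      · exact h
      · rw [← h, mul_zero] at h1; linarith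
    have hc' : dist z o * (dist z y * (dist z x ^ 2 + dist z o ^ 2 - dist x o ^ 2) +
        dist z x * (dist z y ^ 2 + dist z o ^ 2 - dist y o ^ 2)) ≤ 0 := by linarith
    have hc'' := nonpos_of_mul_nonpos_right hc' hzo
    rw [h1, h2] at hc''
    rw [dist_comm o z, dist_comm o x, dist_comm o y]
    have : dist x y * (dist z o ^ 2 - ((1 - t) * dist x o ^ 2 + t * dist y o ^ 2
        - t * (1 - t) * dist x y ^ 2)) ≤ 0 := by
      linarith
    linarith [nonpos_of_mul_nonpos_right this hD]

end Angle

end Cat2Cx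

end

noncomputable section

namespace Cat2Cx

/-! ### Linear coordinates on the model plane -/

section Model

/-- `k` is a coordinate on the plane in which the geodesics of `m` are the straight segments. -/
structure LinearCoord (m : ℝ × ℝ → ℝ × ℝ → ℝ) (k : ℝ × ℝ → ℂ) : Prop where
  inj : Function.Injective k
  cont : Continuous k
  isOpenMap : IsOpenMap k
  geod : ∀ u v, ∃ f, IsGeodesicFromTo m univ f u v ∧
    (fun s => k (f s)) '' Icc 0 (m u v) = segment ℝ (k u) (k v)
  mem_of_lt : ∀ u, ∀ W ∈ nhds u, ∃ ε > 0, ∀ v, m u v < ε → v ∈ W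

theorem mDist_zero_eq (u v : ℝ × ℝ) :
    mDist 0 u v = dist (Complex.equivRealProdCLM.symm u) (Complex.equivRealProdCLM.symm v) := by
  simp [mDist, Complex.dist_eq_re_im]

theorem linearCoord_zero : LinearCoord (mDist 0) Complex.equivRealProdCLM.symm where
  inj := Complex.equivRealProdCLM.symm.injective
  cont := Complex.equivRealProdCLM.symm.continuous
  isOpenMap := Complex.equivRealProdCLM.symm.toHomeomorph.isOpenMap
  geod u v := by
    set k := Complex.equivRealProdCLM.symm with hk
    set L := mDist 0 u v with hL
    have hLd : L = dist (k u) (k v) := mDist_zero_eq u v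
    have hL0 : 0 ≤ L := hLd ▸ dist_nonneg
    have hf : ∀ s : ℝ, k (k.symm (AffineMap.lineMap (k u) (k v) (s / L)))
        = AffineMap.lineMap (k u) (k v) (s / L) := fun s => k.apply_symm_apply _
    refine ⟨fun s => k.symm (AffineMap.lineMap (k u) (k v) (s / L)), ⟨?_, ?_, ⟨hL0, ?_⟩,
      mapsTo_univ _ _⟩, ?_⟩
    · simp
    · rw [← hL]
      rcases hL0.lt_or_eq with h | h
      · simp [div_self h.ne']
      · rw [← h] at hLd
        simp [← h, k.injective (dist_eq_zero.1 hLd.symm)]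
    · intro s _ t _
      rw [mDist_zero_eq, ← hk, hf, hf, dist_lineMap_lineMap, ← hLd, Real.dist_eq, ← sub_div, abs_div,
        abs_of_nonneg hL0]
      rcases hL0.lt_or_eq with h | h
      · field_simp
      · have hs : s ∈ Icc 0 L := by assumption
        have ht : t ∈ Icc 0 L := by assumption
        rw [← h] at hs ht
        have e1 : s = 0 := le_antisymm hs.2 hs.1
        have e2 : t = 0 := le_antisymm ht.2 ht.1
        simp [e1, e2]
    · simp only [hf]
      rw [segment_eq_image_lineMap]
      rcases hL0.lt_or_eq with h | h
      · ext z
        constructor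
        · rintro ⟨s, hs, rfl⟩
          exact ⟨s / L, ⟨div_nonneg hs.1 hL0, (div_le_one h).2 hs.2⟩, rfl⟩
        · rintro ⟨s, hs, rfl⟩
          exact ⟨s * L, ⟨mul_nonneg hs.1 hL0, mul_le_of_le_one_left hL0 hs.2⟩, by
            simp only [mul_div_cancel_right₀ s h.ne']⟩
      · rw [← h] at hLd
        rw [dist_eq_zero.1 hLd.symm, ← h]
        ext z
        simp only [AffineMap.lineMap_same_apply, mem_image]
        exact ⟨fun ⟨_, _, h⟩ => ⟨0, by simp, h⟩, fun ⟨_, _, h⟩ => ⟨0, by simp, h⟩⟩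
  mem_of_lt u W hW := by
    have hc : Continuous Complex.equivRealProdCLM := Complex.equivRealProdCLM.continuous
    have := hc.continuousAt (x := Complex.equivRealProdCLM.symm u)
    obtain ⟨ε, hε, h⟩ := Metric.mem_nhds_iff.1 (this.preimage_mem_nhds
      (by rwa [ContinuousLinearEquiv.apply_symm_apply]))
    refine ⟨ε, hε, fun v hv => ?_⟩
    rw [mDist_zero_eq, dist_comm] at hv
    simpa using h hv

/-- The time coordinate of the hyperboloid point over `u`. -/
def hypTime (u : ℝ × ℝ) : ℝ := Real.sqrt (1 + u.1 ^ 2 + u.2 ^ 2)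

/-- The Lorentzian product of hyperboloid points. -/
def hypForm (u v : ℝ × ℝ) : ℝ := hypTime u * hypTime v - u.1 * v.1 - u.2 * v.2

theorem hypTime_sq (u : ℝ × ℝ) : hypTime u ^ 2 = 1 + u.1 ^ 2 + u.2 ^ 2 :=
  Real.sq_sqrt (by positivity)

theorem hypTime_pos (u : ℝ × ℝ) : 0 < hypTime u := Real.sqrt_pos.2 (by positivity)

theorem hypTime_eq {w : ℝ × ℝ} {c : ℝ} (hc : 0 ≤ c) (h : c ^ 2 = 1 + w.1 ^ 2 + w.2 ^ 2) :
    hypTime w = c := by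
  unfold hypTime
  rw [← h, Real.sqrt_sq hc]

theorem one_le_hypForm (u v : ℝ × ℝ) : 1 ≤ hypForm u v := by
  unfold hypForm
  have h1 := hypTime_sq u
  have h2 := hypTime_sq v
  have h3 := hypTime_pos u
  have h4 := hypTime_pos v
  have : 1 + u.1 * v.1 + u.2 * v.2 ≤ hypTime u * hypTime v := by
    refine le_of_sq_le_sq ?_ (by positivity)
    rw [mul_pow, h1, h2]
    nlinarith [sq_nonneg (u.1 - v.1), sq_nonneg (u.2 - v.2), sq_nonneg (u.1 * v.2 - u.2 * v.1)]
  linarith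

theorem sq_sub_le_hypForm (u v : ℝ × ℝ) :
    (v.1 - hypForm u v * u.1) ^ 2 + (v.2 - hypForm u v * u.2) ^ 2 ≤
      hypTime u ^ 2 * (hypForm u v ^ 2 - 1) := by
  have h1 := hypTime_sq u
  have h2 := hypTime_sq v
  have h3 := hypTime_pos u
  set B := hypForm u v with hB
  have hB' : B = hypTime u * hypTime v - u.1 * v.1 - u.2 * v.2 := hB
  set U := hypTime u
  set V := hypTime v
  set n1 := v.1 - B * u.1 with hn1
  set n2 := v.2 - B * u.2 with hn2
  have e1 : U * (V - B * U) = u.1 * n1 + u.2 * n2 := by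
    rw [hn1, hn2]; linear_combination (-B) * h1 - hB'
  have e2 : n1 ^ 2 + n2 ^ 2 - (V - B * U) ^ 2 = B ^ 2 - 1 := by
    rw [hn1, hn2]; linear_combination h1 * (-B ^ 2) - h2 - 2 * B * hB'
  have e3 : (U * (V - B * U)) ^ 2 ≤ (U ^ 2 - 1) * (n1 ^ 2 + n2 ^ 2) := by
    rw [e1, h1]
    nlinarith [sq_nonneg (u.1 * n2 - u.2 * n1)]
  have e4 : U ^ 2 * (B ^ 2 - 1) = U ^ 2 * (n1 ^ 2 + n2 ^ 2) - (U * (V - B * U)) ^ 2 := by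
    rw [← e2]; ring
  rw [e4]
  linarith

theorem mDist_of_ne {κ : ℝ} (h : κ ≠ 0) (u v : ℝ × ℝ) :
    mDist κ u v = 1 / Real.sqrt (-κ) * Real.arcosh (hypForm u v) := by
  rw [mDist, if_neg h]
  rfl

/-- The Klein coordinate. -/
def klein (u : ℝ × ℝ) : ℂ :=
  OpenPartialHomeomorph.univUnitBall (Complex.equivRealProdCLM.symm u)

theorem klein_eq (u : ℝ × ℝ) :
    klein u = (hypTime u)⁻¹ • Complex.equivRealProdCLM.symm u := by
  rw [klein, OpenPartialHomeomorph.univUnitBall_apply, hypTime, Complex.sq_norm,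
    Complex.normSq_apply]
  simp only [Complex.equivRealProdCLM_symm_apply_re, Complex.equivRealProdCLM_symm_apply_im]
  rw [add_assoc, pow_two, pow_two]

theorem klein_combo {u v w : ℝ × ℝ} {p q : ℝ} (h1 : w.1 = p * u.1 + q * v.1)
    (h2 : w.2 = p * u.2 + q * v.2) (h0 : hypTime w = p * hypTime u + q * hypTime v) :
    klein w = AffineMap.lineMap (klein u) (klein v)
      (q * hypTime v / (p * hypTime u + q * hypTime v)) := by
  have hw := hypTime_pos w
  have hu := (hypTime_pos u).ne'
  have hv := (hypTime_pos v).ne'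
  rw [h0] at hw
  have hw' := hw.ne'
  rw [klein_eq, klein_eq, klein_eq, AffineMap.lineMap_apply_module, h0]
  apply Complex.ext
  · simp only [Complex.smul_re, Complex.add_re, smul_eq_mul,
      Complex.equivRealProdCLM_symm_apply_re, h1]
    field_simp
    ring
  · simp only [Complex.smul_im, Complex.add_im, smul_eq_mul,
      Complex.equivRealProdCLM_symm_apply_im, h2]
    field_simp
    ring

theorem linearCoord_klein {κ : ℝ} (hκ : κ < 0) : LinearCoord (mDist κ) klein where
  inj := fun u v h => by
    have := (OpenPartialHomeomorph.univUnitBall (E := ℂ)).injOn (mem_univ _) (mem_univ _) h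
    exact Complex.equivRealProdCLM.symm.injective this
  cont := by
    have h := (OpenPartialHomeomorph.univUnitBall (E := ℂ)).continuousOn
    have h' : Continuous (OpenPartialHomeomorph.univUnitBall (E := ℂ)) := continuousOn_univ.1 h
    exact h'.comp Complex.equivRealProdCLM.symm.continuous
  isOpenMap := by
    have h : IsOpenMap (OpenPartialHomeomorph.univUnitBall (E := ℂ)) := fun s hs =>
      OpenPartialHomeomorph.isOpen_image_of_subset_source _ hs (subset_univ _)
    exact h.comp Complex.equivRealProdCLM.symm.toHomeomorph.isOpenMap
  geod u v := by
    have hl : 0 < Real.sqrt (-κ) := Real.sqrt_pos.2 (by linarith)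
    set l := Real.sqrt (-κ) with hld
    have hB := one_le_hypForm u v
    set a := Real.arcosh (hypForm u v) with ha
    have ha0 : 0 ≤ a := Real.arcosh_nonneg hB
    have hca : Real.cosh a = hypForm u v := Real.cosh_arcosh hB
    have hm : mDist κ u v = a / l := by rw [mDist_of_ne hκ.ne, ← hld]; ring
    rw [hm]
    rcases ha0.lt_or_eq with hap | hap
    swap
    · have hB1 : hypForm u v = 1 := by rw [← hca, ← hap, Real.cosh_zero]
      have hs := sq_sub_le_hypForm u v
      rw [hB1] at hs
      have huv : v = u := by
        apply Prod.ext
        · nlinarith [sq_nonneg (v.1 - 1 * u.1), sq_nonneg (v.2 - 1 * u.2)]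
        · nlinarith [sq_nonneg (v.1 - 1 * u.1), sq_nonneg (v.2 - 1 * u.2)]
      have hm0 : mDist κ u u = 0 := by
        have := hm
        rw [huv] at this
        rw [this, ← hap, zero_div]
      subst huv
      refine ⟨fun _ => v, ⟨rfl, rfl, ⟨hm0.ge, ?_⟩, mapsTo_univ _ _⟩, ?_⟩
      · intro s hs t ht
        rw [hm0] at hs ht
        rw [hm0, le_antisymm hs.2 hs.1, le_antisymm ht.2 ht.1]
        simp
      · rw [← hap, segment_same, zero_div, Icc_self, image_singleton]
    have hsa : 0 < Real.sinh a := Real.sinh_pos_iff.2 hap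
    set p : ℝ → ℝ := fun θ => Real.sinh (a - θ) / Real.sinh a with hp
    set q : ℝ → ℝ := fun θ => Real.sinh θ / Real.sinh a with hq
    have hp0 : ∀ θ ∈ Icc 0 a, 0 ≤ p θ := fun θ hθ =>
      div_nonneg (Real.sinh_nonneg_iff.2 (by linarith [hθ.2])) hsa.le
    have hq0 : ∀ θ ∈ Icc 0 a, 0 ≤ q θ := fun θ hθ =>
      div_nonneg (Real.sinh_nonneg_iff.2 hθ.1) hsa.le
    have hpq : ∀ θ φ, p θ * p φ + q θ * q φ + (p θ * q φ + q θ * p φ) * Real.cosh a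
        = Real.cosh (θ - φ) := by
      intro θ φ
      simp only [hp, hq]
      rw [Real.sinh_sub, Real.sinh_sub, Real.cosh_sub]
      have := Real.cosh_sq a
      field_simp
      linear_combination (-Real.sinh θ * Real.sinh φ) * this
    set g : ℝ → ℝ × ℝ := fun θ => (p θ * u.1 + q θ * v.1, p θ * u.2 + q θ * v.2) with hg
    have hu := hypTime_sq u
    have hv := hypTime_sq v
    have hB' : Real.cosh a = hypTime u * hypTime v - u.1 * v.1 - u.2 * v.2 := hca
    have hgt : ∀ θ ∈ Icc 0 a, hypTime (g θ) = p θ * hypTime u + q θ * hypTime v := by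
      intro θ hθ
      have h1 := hp0 θ hθ
      have h2 := hq0 θ hθ
      have h3 := hypTime_pos u
      have h4 := hypTime_pos v
      apply hypTime_eq (by positivity)
      have := hpq θ θ
      rw [sub_self, Real.cosh_zero] at this
      simp only [hg]
      linear_combination (p θ) ^ 2 * hu + (q θ) ^ 2 * hv - 2 * p θ * q θ * hB' + this
    have hform : ∀ θ ∈ Icc 0 a, ∀ φ ∈ Icc 0 a, hypForm (g θ) (g φ) = Real.cosh (θ - φ) := by
      intro θ hθ φ hφ
      rw [hypForm, hgt θ hθ, hgt φ hφ, ← hpq θ φ]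
      simp only [hg]
      linear_combination p θ * p φ * hu + q θ * q φ * hv - (p θ * q φ + q θ * p φ) * hB'
    have hg0 : g 0 = u := by
      simp only [hg, hp, hq, sub_zero, Real.sinh_zero, zero_div, div_self hsa.ne']
      simp
    have hga : g a = v := by
      simp only [hg, hp, hq, sub_self, Real.sinh_zero, zero_div, div_self hsa.ne']
      simp
    have hscale : ∀ {s}, s ∈ Icc 0 (a / l) → l * s ∈ Icc 0 a := fun {s} hs =>
      ⟨mul_nonneg hl.le hs.1, by have := (le_div_iff₀ hl).1 hs.2; linarith⟩
    have hlm : ∀ θ ∈ Icc 0 a, klein (g θ) = AffineMap.lineMap (klein u) (klein v)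
        (q θ * hypTime v / (p θ * hypTime u + q θ * hypTime v)) := fun θ hθ =>
      klein_combo rfl rfl (hgt θ hθ)
    have hden : ∀ θ ∈ Icc 0 a, 0 < p θ * hypTime u + q θ * hypTime v := fun θ hθ => by
      rw [← hgt θ hθ]; exact hypTime_pos _
    refine ⟨fun s => g (l * s), ⟨by simp [hg0], ?_, ⟨?_, ?_⟩, mapsTo_univ _ _⟩, ?_⟩
    · simp only [hm, mul_div_cancel₀ a hl.ne', hga]
    · rw [hm]; positivity
    · intro s hs t ht
      rw [hm] at hs ht
      rw [mDist_of_ne hκ.ne, ← hld, hform _ (hscale hs) _ (hscale ht), ← Real.cosh_abs,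
        Real.arcosh_cosh (abs_nonneg _), ← mul_sub, abs_mul, abs_of_pos hl]
      field_simp
    · rw [segment_eq_image_lineMap]
      ext z
      constructor
      · rintro ⟨s, hs, rfl⟩
        refine ⟨_, ⟨?_, ?_⟩, (hlm _ (hscale hs)).symm⟩
        · exact div_nonneg (mul_nonneg (hq0 _ (hscale hs)) (hypTime_pos v).le) (hden _ (hscale hs)).le
        · rw [div_le_one (hden _ (hscale hs))]
          linarith [mul_nonneg (hp0 _ (hscale hs)) (hypTime_pos u).le]
      · rintro ⟨t, ht, rfl⟩
        have hc : ContinuousOn (fun θ => q θ * hypTime v / (p θ * hypTime u + q θ * hypTime v))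
            (Icc 0 a) := by
          refine ContinuousOn.div ?_ ?_ fun θ hθ => (hden θ hθ).ne'
          · exact Continuous.continuousOn (by simp only [hq]; fun_prop)
          · exact Continuous.continuousOn (by simp only [hp, hq]; fun_prop)
        have hivt := intermediate_value_Icc ha0 hc
        have e0 : q 0 * hypTime v / (p 0 * hypTime u + q 0 * hypTime v) = 0 := by simp [hq]
        have e1 : q a * hypTime v / (p a * hypTime u + q a * hypTime v) = 1 := by
          simp [hq, hp, div_self hsa.ne', (hypTime_pos v).ne']
        simp only [e0, e1] at hivt
        obtain ⟨θ, hθ, rfl⟩ := hivt ht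
        refine ⟨θ / l, ⟨div_nonneg hθ.1 hl.le, div_le_div_of_nonneg_right hθ.2 hl.le⟩, ?_⟩
        simp only [mul_div_cancel₀ θ hl.ne']
        exact hlm θ hθ
  mem_of_lt u W hW := by
    have hl : 0 < Real.sqrt (-κ) := Real.sqrt_pos.2 (by linarith)
    set l := Real.sqrt (-κ) with hld
    obtain ⟨ρ, hρ, hW⟩ := Metric.mem_nhds_iff.1 hW
    have hcont : Continuous fun x : ℝ => hypTime u * Real.sqrt (Real.cosh (l * x) ^ 2 - 1) +
        |Real.cosh (l * x) - 1| * (|u.1| + |u.2|) := by fun_prop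
    have := hcont.continuousAt (x := 0) |>.eventually_lt_const (u := ρ) (by simpa using hρ)
    obtain ⟨ε, hε, hb⟩ := Metric.eventually_nhds_iff.1 this
    refine ⟨ε, hε, fun v hv => hW ?_⟩
    have hB := one_le_hypForm u v
    have hx : l * mDist κ u v = Real.arcosh (hypForm u v) := by
      rw [mDist_of_ne hκ.ne, ← hld]; field_simp
    have hm0 : 0 ≤ mDist κ u v := by
      have := Real.arcosh_nonneg hB
      rw [← hx] at this
      exact nonneg_of_mul_nonneg_right this hl
    have h := hb (y := mDist κ u v) (by rwa [Real.dist_eq, sub_zero, abs_of_nonneg hm0])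
    rw [hx, Real.cosh_arcosh hB] at h
    have hs := sq_sub_le_hypForm u v
    set B := hypForm u v
    have hsq : hypTime u * Real.sqrt (B ^ 2 - 1) = Real.sqrt (hypTime u ^ 2 * (B ^ 2 - 1)) := by
      rw [Real.sqrt_mul (sq_nonneg _), Real.sqrt_sq (hypTime_pos u).le]
    rw [hsq] at h
    have c1 : |v.1 - B * u.1| ≤ Real.sqrt (hypTime u ^ 2 * (B ^ 2 - 1)) :=
      Real.abs_le_sqrt (by nlinarith [sq_nonneg (v.2 - B * u.2)])
    have c2 : |v.2 - B * u.2| ≤ Real.sqrt (hypTime u ^ 2 * (B ^ 2 - 1)) :=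
      Real.abs_le_sqrt (by nlinarith [sq_nonneg (v.1 - B * u.1)])
    have d1 : |v.1 - u.1| ≤ |v.1 - B * u.1| + |B - 1| * |u.1| := by
      rw [← abs_mul, show v.1 - u.1 = (v.1 - B * u.1) + (B - 1) * u.1 by ring]
      exact abs_add_le _ _
    have d2 : |v.2 - u.2| ≤ |v.2 - B * u.2| + |B - 1| * |u.2| := by
      rw [← abs_mul, show v.2 - u.2 = (v.2 - B * u.2) + (B - 1) * u.2 by ring]
      exact abs_add_le _ _
    have f1 : 0 ≤ |B - 1| * |u.1| := by positivity
    have f2 : 0 ≤ |B - 1| * |u.2| := by positivity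
    rw [mul_add] at h
    rw [mem_ball, Prod.dist_eq, max_lt_iff, Real.dist_eq, Real.dist_eq]
    exact ⟨by linarith, by linarith⟩

theorem exists_linearCoord {κ : ℝ} (hκ : κ ≤ 0) : ∃ k, LinearCoord (mDist κ) k := by
  rcases hκ.lt_or_eq with h | rfl
  · exact ⟨klein, linearCoord_klein h⟩
  · exact ⟨_, linearCoord_zero⟩

end Model

end Cat2Cx

end

noncomputable section

namespace Cat2Cx

/-! ### Polyhedral complexes are locally planar -/

section Poly
variable {X : Type*} [MetricSpace X]

theorem IsPolygonalCell.convexWrt {κ : ℝ} {P : Set (ℝ × ℝ)} (h : IsPolygonalCell κ P) :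
    ConvexWrt (mDist κ) P := by
  obtain ⟨S, rfl, -⟩ := h
  intro x hx y hy z hz C hC
  exact hC.1 x (hx C hC) y (hy C hC) hz

theorem exists_faceChart [CAT0Space X] {κ : ℝ} (hκ : κ ≤ 0) {F : Set X} (hFo : IsOpen F)
    {f : X → ℝ × ℝ} {P : Set (ℝ × ℝ)} (hP : IsPolygonalCell κ P) (hinj : InjOn f (closure F))
    (himg : f '' closure F = P) (hinter : f '' F = interior P)
    (hd : ∀ x ∈ closure F, ∀ y ∈ closure F, mDist κ (f x) (f y) = dist x y) :
    ∃ h : X → ℂ, FaceChart F h := by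
  obtain ⟨k, hk⟩ := exists_linearCoord hκ
  have hconv := hP.convexWrt
  have key : ∀ x ∈ closure F, ∀ y ∈ closure F, ∃ g : ℝ → X, MapsTo g (Icc 0 (dist x y)) (closure F) ∧
      (∀ s ∈ Icc 0 (dist x y), dist x (g s) = s ∧ dist (g s) y = dist x y - s) ∧
      (fun s => k (f (g s))) '' Icc 0 (dist x y) = segment ℝ (k (f x)) (k (f y)) := by
    intro x hx y hy
    obtain ⟨c, hc, hseg⟩ := hk.geod (f x) (f y)
    have hsub : c '' Icc 0 (mDist κ (f x) (f y)) ⊆ P := by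
      refine Subset.trans ?_ (hconv (f x) (himg ▸ mem_image_of_mem f hx) (f y)
        (himg ▸ mem_image_of_mem f hy))
      exact subset_biUnion_of_mem (u := fun c => c '' Icc 0 (mDist κ (f x) (f y))) hc
    obtain ⟨c0, c1, ⟨-, cd⟩, -⟩ := hc
    rw [hd x hx y hy] at hsub cd c1 hseg
    have hL := dist_nonneg (x := x) (y := y)
    have hex : ∀ s, ∃ z, s ∈ Icc 0 (dist x y) → z ∈ closure F ∧ f z = c s := by
      intro s
      by_cases hs : s ∈ Icc 0 (dist x y)
      · have := hsub (mem_image_of_mem c hs)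
        rw [← himg] at this
        obtain ⟨z, hz, e⟩ := this
        exact ⟨z, fun _ => ⟨hz, e⟩⟩
      · exact ⟨x, fun h => absurd h hs⟩
    choose g hg using hex
    refine ⟨g, fun s hs => (hg s hs).1, fun s hs => ⟨?_, ?_⟩, ?_⟩
    · rw [← hd x hx _ (hg s hs).1, (hg s hs).2]
      have := cd 0 ⟨le_rfl, hL⟩ s hs
      rw [c0] at this
      rw [this, zero_sub, abs_neg, abs_of_nonneg hs.1]
    · rw [← hd _ (hg s hs).1 y hy, (hg s hs).2]
      have := cd s hs (dist x y) ⟨hL, le_rfl⟩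
      rw [c1] at this
      rw [this, abs_sub_comm, abs_of_nonneg (by linarith [hs.2])]
    · rw [← hseg]
      exact image_congr fun s hs => by simp only [(hg s hs).2]
  have hbtw : ∀ x ∈ closure F, ∀ y ∈ closure F, ∀ z, Btw x z y →
      z ∈ closure F ∧ k (f z) ∈ segment ℝ (k (f x)) (k (f y)) := by
    intro x hx y hy z hz
    obtain ⟨g, g1, g2, g3⟩ := key x hx y hy
    have hm : dist x z ∈ Icc 0 (dist x y) := ⟨dist_nonneg, hz.dist_le_left⟩
    have hzg : z = g (dist x z) := by
      refine hz.unique ?_ (g2 _ hm).1.symm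
      unfold Btw
      rw [(g2 _ hm).1, (g2 _ hm).2]; ring
    constructor
    · rw [hzg]; exact g1 hm
    · rw [← g3]
      exact ⟨dist x z, hm, by simp only [← hzg]⟩
  have hkP : Convex ℝ (k '' P) := by
    rw [convex_iff_segment_subset]
    rintro _ ⟨u, hu, rfl⟩ _ ⟨v, hv, rfl⟩
    rw [← himg] at hu hv
    obtain ⟨x, hx, rfl⟩ := hu
    obtain ⟨y, hy, rfl⟩ := hv
    obtain ⟨g, g1, -, g3⟩ := key x hx y hy
    rw [← g3, ← himg]
    rintro _ ⟨s, hs, rfl⟩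
    exact ⟨_, ⟨g s, g1 hs, rfl⟩, rfl⟩
  refine ⟨fun x => k (f x), hFo, ?_, fun x hx y hy h => hinj hx hy (hk.inj h),
    fun x hx y hy z hz => (hbtw x hx y hy z hz).1, fun x hx y hy z hz => (hbtw x hx y hy z hz).2,
    ?_, ?_⟩
  · refine hk.cont.comp_continuousOn fun x hx => ?_
    intro W hW
    obtain ⟨ε, hε, h⟩ := hk.mem_of_lt (f x) W hW
    refine Metric.mem_nhdsWithin_iff.2 ⟨ε, hε, fun y hy => h _ ?_⟩
    rw [hd x hx y hy.2, dist_comm]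
    exact hy.1
  · intro x hx y hy z hz h
    obtain ⟨g, g1, g2, g3⟩ := key x hx y hy
    rw [← g3] at h
    obtain ⟨s, hs, e⟩ := h
    have : g s = z := hinj (g1 hs) hz (hk.inj e)
    rw [← this]
    unfold Btw
    rw [(g2 s hs).1, (g2 s hs).2]; ring
  · intro y hy x hx z hz hne
    obtain ⟨hzF, hzs⟩ := hbtw y hy x (subset_closure hx) z hz
    have hin : ∀ {w}, w ∈ closure F → k (f w) ∈ interior (k '' P) → w ∈ F := by
      intro w hw h
      have h1 : f w ∈ interior P := by
        refine mem_interior.2 ⟨k ⁻¹' interior (k '' P), fun v hv => ?_,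
          isOpen_interior.preimage hk.cont, h⟩
        obtain ⟨v', hv', e⟩ := interior_subset hv
        exact hk.inj e ▸ hv'
      rw [← hinter] at h1
      obtain ⟨w', hw', e⟩ := h1
      exact hinj (subset_closure hw') hw e ▸ hw'
    have hxi : k (f x) ∈ interior (k '' P) := by
      have : k '' interior P ⊆ interior (k '' P) :=
        interior_maximal (image_mono interior_subset) (hk.isOpenMap _ isOpen_interior)
      exact this ⟨_, hinter ▸ mem_image_of_mem f hx, rfl⟩
    have hyk : k (f y) ∈ k '' P := ⟨_, himg ▸ mem_image_of_mem f hy, rfl⟩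
    by_cases hzx : z = x
    · exact hzx ▸ hx
    refine hin hzF (hkP.openSegment_interior_self_subset_interior hxi hyk ?_)
    rw [openSegment_symm]
    refine mem_openSegment_of_ne_left_right ?_ ?_ hzs
    · exact fun e => hne (hinj hzF hy (hk.inj e.symm))
    · exact fun e => hzx (hinj hzF (subset_closure hx) (hk.inj e.symm))

theorem FaceChart.nonbranching {F : Set X} {h : X → ℂ} (hF : FaceChart F h) {y u x x' : X}
    (hy : y ∈ closure F) (hx : x ∈ closure F) (hx' : x' ∈ closure F) (hne : u ≠ y) (hb : Btw y u x)
    (hb' : Btw y u x') (he : dist y x = dist y x') : x = x' := by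
  have huF := hF.mem_of_btw y hy x hx u hb
  have s1 := (mem_segment_iff_wbtw.1 (hF.segment_of_btw y hy x hx u hb)).sameRay_vsub_left
  have s2 := (mem_segment_iff_wbtw.1 (hF.segment_of_btw y hy x' hx' u hb')).sameRay_vsub_left
  have s3 := s1.symm.trans s2 fun h0 => absurd (hF.inj huF hy (vsub_eq_zero_iff_eq.1 h0)) hne
  rcases wbtw_total_of_sameRay_vsub_left s3 with hw | hw
  · have := hF.btw_of_segment y hy x' hx' x hx (mem_segment_iff_wbtw.2 hw)
    unfold Btw at this
    exact dist_le_zero.1 (by linarith)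
  · have := hF.btw_of_segment y hy x hx x' hx' (mem_segment_iff_wbtw.2 hw)
    unfold Btw at this
    exact (dist_le_zero.1 (by linarith)).symm

/-- A unit speed parametrization of an open edge. -/
structure EdgeParam (e : Set X) (f : ℝ → X) (L : ℝ) : Prop where
  dist_eq : ∀ s ∈ Icc 0 L, ∀ t ∈ Icc 0 L, dist (f s) (f t) = |s - t|
  image : f '' Ioo 0 L = e

theorem EdgeParam.closure_subset {e : Set X} {f : ℝ → X} {L : ℝ} (h : EdgeParam e f L) :
    closure e ⊆ f '' Icc 0 L := by
  have hc : ContinuousOn f (Icc 0 L) := by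
    have : LipschitzOnWith 1 f (Icc 0 L) := LipschitzOnWith.of_dist_le_mul fun s hs t ht => by
      rw [h.dist_eq s hs t ht, Real.dist_eq]; simp
    exact this.continuousOn
  refine closure_minimal ?_ (isCompact_Icc.image_of_continuousOn hc).isClosed
  rw [← h.image]
  exact image_mono Ioo_subset_Icc_self

theorem EdgeParam.finite_sphere {e : Set X} {f : ℝ → X} {L : ℝ} (h : EdgeParam e f L) {y : X}
    (hy : y ∈ closure e) (η : ℝ) : (e ∩ sphere y η).Finite := by
  obtain ⟨s, hs, rfl⟩ := h.closure_subset hy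
  refine (Set.toFinite {f (s + η), f (s - η)}).subset ?_
  rintro x ⟨hx, hd⟩
  rw [← h.image] at hx
  obtain ⟨t, ht, rfl⟩ := hx
  rw [mem_sphere, h.dist_eq t (Ioo_subset_Icc_self ht) s hs] at hd
  rcases abs_cases (t - s) with ⟨h1, -⟩ | ⟨h1, -⟩
  · left; congr 1; linarith
  · right; rw [mem_singleton_iff]; congr 1; linarith

theorem EdgeParam.exists_between [CAT0Space X] {e : Set X} {f : ℝ → X} {L : ℝ}
    (h : EdgeParam e f L) {s t : ℝ} (hs : s ∈ Icc 0 L) (ht : t ∈ Icc 0 L) {u : X}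
    (hu : Btw (f s) u (f t)) : ∃ r ∈ uIcc s t, f r = u ∧ |s - r| = dist (f s) u := by
  have hd := h.dist_eq s hs t ht
  have hle := hu.dist_le_left
  rw [hd] at hle
  have h0 := dist_nonneg (x := f s) (y := u)
  obtain ⟨r, hr, hr1, hr2⟩ : ∃ r ∈ uIcc s t, |s - r| = dist (f s) u ∧ |s - r| + |r - t| = |s - t| := by
    rcases le_total s t with hst | hst
    · rw [abs_of_nonpos (by linarith)] at hle
      refine ⟨s + dist (f s) u, by rw [uIcc_of_le hst]; constructor <;> linarith, ?_, ?_⟩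
      · rw [abs_of_nonpos (by linarith)]; ring
      · rw [abs_of_nonpos (by linarith), abs_of_nonpos (by linarith), abs_of_nonpos (by linarith)]
        ring
    · rw [abs_of_nonneg (by linarith)] at hle
      refine ⟨s - dist (f s) u, by rw [uIcc_of_ge hst]; constructor <;> linarith, ?_, ?_⟩
      · rw [abs_of_nonneg (by linarith)]; ring
      · rw [abs_of_nonneg (by linarith), abs_of_nonneg (by linarith), abs_of_nonneg (by linarith)]
        ring
  have hrL : r ∈ Icc 0 L := uIcc_subset_Icc hs ht hr
  have hsr := h.dist_eq s hs r hrL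
  refine ⟨r, hr, ?_, hr1⟩
  refine Btw.unique (x := f s) (y := f t) ?_ hu (hsr.trans hr1)
  unfold Btw
  rw [hsr, h.dist_eq r hrL t ht, hd, hr2]

theorem EdgeParam.star [CAT0Space X] {e : Set X} {f : ℝ → X} {L : ℝ} (h : EdgeParam e f L)
    {y x u : X} (hy : y ∈ closure e) (hx : x ∈ e) (hne : u ≠ y) (hb : Btw y u x) : u ∈ e := by
  obtain ⟨s, hs, rfl⟩ := h.closure_subset hy
  rw [← h.image] at hx ⊢
  obtain ⟨t, ht, rfl⟩ := hx
  obtain ⟨r, hr, rfl, -⟩ := h.exists_between hs (Ioo_subset_Icc_self ht) hb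
  have hrs : r ≠ s := fun h => hne (h ▸ rfl)
  refine mem_image_of_mem f ?_
  rcases le_total s t with hst | hst
  · rw [uIcc_of_le hst] at hr
    exact ⟨hs.1.trans_lt (hr.1.lt_of_ne hrs.symm), hr.2.trans_lt ht.2⟩
  · rw [uIcc_of_ge hst] at hr
    exact ⟨ht.1.trans_le hr.1, (hr.2.lt_of_ne hrs).trans_le hs.2⟩

theorem EdgeParam.nonbranching [CAT0Space X] {e : Set X} {f : ℝ → X} {L : ℝ} (h : EdgeParam e f L)
    {y x x' u : X} (hy : y ∈ closure e) (hx : x ∈ e) (hx' : x' ∈ e) (hne : u ≠ y) (hb : Btw y u x)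
    (hb' : Btw y u x') (he : dist y x = dist y x') : x = x' := by
  obtain ⟨s, hs, rfl⟩ := h.closure_subset hy
  rw [← h.image] at hx hx'
  obtain ⟨t, ht, rfl⟩ := hx
  obtain ⟨t', ht', rfl⟩ := hx'
  replace ht := Ioo_subset_Icc_self ht
  replace ht' := Ioo_subset_Icc_self ht'
  obtain ⟨r, hr, rfl, -⟩ := h.exists_between hs ht hb
  have hrL : r ∈ Icc 0 L := uIcc_subset_Icc hs ht hr
  have hrs : r ≠ s := fun h => hne (h ▸ rfl)
  unfold Btw at hb hb'
  rw [h.dist_eq _ hs _ hrL, h.dist_eq _ hrL _ ht, h.dist_eq _ hs _ ht] at hb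
  rw [h.dist_eq _ hs _ hrL, h.dist_eq _ hrL _ ht', h.dist_eq _ hs _ ht'] at hb'
  rw [h.dist_eq _ hs _ ht, h.dist_eq _ hs _ ht'] at he
  congr 1
  rcases abs_cases (s - r) with ⟨a1, a2⟩ | ⟨a1, a2⟩ <;>
  rcases abs_cases (s - t) with ⟨b1, b2⟩ | ⟨b1, b2⟩ <;>
  rcases abs_cases (s - t') with ⟨c1, c2⟩ | ⟨c1, c2⟩ <;>
  rcases abs_cases (r - t) with ⟨d1, d2⟩ | ⟨d1, d2⟩ <;>
  rcases abs_cases (r - t') with ⟨e1, e2⟩ | ⟨e1, e2⟩ <;>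
  first
    | linarith
    | exact absurd (by linarith : r = s) hrs

variable {κ : ℝ} (PC : PolyComplex2 κ X)

theorem PolyComplex2.exists_edgeParam {e : Set X} (he : e ∈ PC.edges) :
    ∃ f L, EdgeParam e f L := by
  obtain ⟨f, L, -, h, hi⟩ := PC.edge_geodesic e he
  exact ⟨f, L, h.2, hi⟩

theorem PolyComplex2.exists_faceChart [CAT0Space X] (hκ : κ ≤ 0) {F : Set X} (hF : F ∈ PC.faces) :
    ∃ h : X → ℂ, FaceChart F h := by
  obtain ⟨f, P, h1, h2, h3, h4, h5⟩ := PC.face_chart F hF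
  exact Cat2Cx.exists_faceChart hκ (PC.faces_open F hF) h1 h2 h3 h4 h5

/-- Small balls only meet cells adherent to their centre. -/
theorem PolyComplex2.exists_radius (y : X) : ∃ η > 0,
    {c | c ∈ PC.faces ∪ PC.edges ∧ (c ∩ ball y η).Nonempty}.Finite ∧
    (∀ c ∈ PC.faces ∪ PC.edges, (c ∩ ball y η).Nonempty → y ∈ closure c) ∧
    (∀ v ∈ PC.vertices, v ∈ ball y η → v = y) := by
  obtain ⟨ε, hε, hc, hv⟩ := PC.locally_finite y
  have hball : ∀ {U : Set X}, U ∈ nhds y → ∀ᶠ η : ℝ in nhdsWithin 0 (Ioi 0), ball y η ⊆ U := by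
    intro U hU
    obtain ⟨δ, hδ, h⟩ := Metric.mem_nhds_iff.1 hU
    filter_upwards [Ioo_mem_nhdsGT hδ] with η hη
    exact (ball_subset_ball hη.2.le).trans h
  have e1 : ∀ᶠ η : ℝ in nhdsWithin 0 (Ioi 0),
      ∀ c ∈ {c | (c ∈ PC.faces ∨ c ∈ PC.edges) ∧ (c ∩ ball y ε).Nonempty},
        (c ∩ ball y η).Nonempty → y ∈ closure c := by
    refine (eventually_all_finite hc).2 fun c _ => ?_
    by_cases hy : y ∈ closure c
    · exact Eventually.of_forall fun _ _ => hy
    · filter_upwards [hball (isClosed_closure.isOpen_compl.mem_nhds hy)] with η hη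
      rintro ⟨x, hx, hxb⟩
      exact absurd (subset_closure hx) (hη hxb)
  have e2 : ∀ᶠ η : ℝ in nhdsWithin 0 (Ioi 0), ∀ v ∈ PC.vertices ∩ ball y ε, v ∈ ball y η → v = y := by
    refine (eventually_all_finite hv).2 fun v _ => ?_
    by_cases hy : v = y
    · exact Eventually.of_forall fun _ _ => hy
    · filter_upwards [hball (isOpen_compl_singleton.mem_nhds (Ne.symm hy : y ≠ v))] with η hη hvb
      exact absurd rfl (hη hvb)
  obtain ⟨η, ⟨h1, h2⟩, hη⟩ := ((e1.and e2).and (Ioo_mem_nhdsGT hε)).exists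
  have hsub := ball_subset_ball (x := y) hη.2.le
  refine ⟨η, hη.1, hc.subset ?_, fun c hc hn => h1 c ⟨hc, ?_⟩ hn, fun v hv hvb => h2 v ⟨hv, hsub hvb⟩ hvb⟩
  · rintro c ⟨hcm, hn⟩
    exact ⟨hcm, hn.mono (inter_subset_inter_right _ hsub)⟩
  · exact hn.mono (inter_subset_inter_right _ hsub)

theorem PolyComplex2.exists_cell {x : X} (hx : x ∉ PC.vertices) :
    ∃ c ∈ PC.faces ∪ PC.edges, x ∈ c := by
  have := PC.cover.ge (mem_univ x)
  rcases this with (⟨c, hc, h⟩ | ⟨c, hc, h⟩) | h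
  · exact ⟨c, .inl hc, h⟩
  · exact ⟨c, .inr hc, h⟩
  · exact absurd h hx

theorem PolyComplex2.cell_star [CAT0Space X] (hκ : κ ≤ 0) {c : Set X}
    (hc : c ∈ PC.faces ∪ PC.edges) {y x u : X} (hy : y ∈ closure c) (hx : x ∈ c) (hne : u ≠ y)
    (hb : Btw y u x) : u ∈ c := by
  rcases hc with hc | hc
  · obtain ⟨h, hF⟩ := PC.exists_faceChart hκ hc
    exact hF.star y hy x hx u hb hne
  · obtain ⟨f, L, h⟩ := PC.exists_edgeParam hc
    exact h.star hy hx hne hb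

theorem PolyComplex2.locallyPlanar [CAT0Space X] (hκ : κ ≤ 0) : LocallyPlanar PC.faces where
  chart F hF := PC.exists_faceChart hκ hF
  exists_radius y := by
    obtain ⟨η₀, hpos, hfin, hcl, hvert⟩ := PC.exists_radius y
    refine ⟨η₀, hpos, hfin.subset fun F hF => ⟨.inl hF.1, hF.2⟩, fun F hF => hcl F (.inl hF), ?_, ?_⟩
    · intro η hη
      have hsub : sphere y η ⊆ ball y η₀ := fun x hx => by
        rw [mem_sphere] at hx; rw [mem_ball, hx]; exact hη.2
      have hf : (⋃ c ∈ {c | c ∈ PC.edges ∧ (c ∩ ball y η₀).Nonempty}, c ∩ sphere y η).Finite := by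
        refine (hfin.subset fun c hc => ⟨.inr hc.1, hc.2⟩).biUnion fun c hc => ?_
        obtain ⟨f, L, h⟩ := PC.exists_edgeParam hc.1
        exact h.finite_sphere (hcl c (.inr hc.1) hc.2) η
      refine hf.subset ?_
      rintro x ⟨hx, hxF⟩
      have hxv : x ∉ PC.vertices := fun hv => by
        have := hvert x hv (hsub hx)
        rw [this, mem_sphere, dist_self] at hx
        exact hη.1.ne hx
      obtain ⟨c, hc | hc, hxc⟩ := PC.exists_cell hxv
      · exact absurd ⟨c, hc, hxc⟩ hxF
      · exact mem_biUnion (x := c) ⟨hc, x, hxc, hsub hx⟩ ⟨hxc, hx⟩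
    · intro x hx x' hx' u hne hb hb' he
      have aux : ∀ w ∈ ball y η₀, Btw y u w → ∃ c ∈ PC.faces ∪ PC.edges, w ∈ c ∧ y ∈ closure c ∧
          u ∈ c := by
        intro w hw hbw
        have hwv : w ∉ PC.vertices := fun hv => by
          rw [hvert w hv hw] at hbw
          exact hne hbw.eq_of_self
        obtain ⟨c, hc, hwc⟩ := PC.exists_cell hwv
        have hyc := hcl c hc ⟨w, hwc, hw⟩
        exact ⟨c, hc, hwc, hyc, PC.cell_star hκ hc hyc hwc hne hbw⟩
      obtain ⟨c, hc, hxc, hyc, huc⟩ := aux x hx hb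
      obtain ⟨c', hc', hxc', -, huc'⟩ := aux x' hx' hb'
      have hcc : c = c' := by
        by_contra hne
        have := PC.cells_disjoint c hc c' hc' hne
        exact (this.le ⟨huc, huc'⟩ : u ∈ (∅ : Set X))
      subst hcc
      rcases hc with hc | hc
      · obtain ⟨h, hF⟩ := PC.exists_faceChart hκ hc
        exact hF.nonbranching hyc (subset_closure hxc) (subset_closure hxc') hne hb hb' he
      · obtain ⟨f, L, h⟩ := PC.exists_edgeParam hc
        exact h.nonbranching hyc hxc hxc' hne hb hb' he

end Poly

end Cat2Cx

end

open Cat2Cx in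
/-- **Lemma (feature_2).**  Let `T` be a simple geodesic triangle in `Y` with vertices
`p, q, r`.  For all sufficiently small `ε > 0`, the limit segment `R_q^ε` of `T` at `p`
extends to an `X`-geodesic from `p` to a point `q' ∈ [q,r]_Y` lying in `T ∪ Int T`, and
similarly for `R_r^ε`. -/
theorem limit_segments_extend_to_opposite_side
    {κ : ℝ} (hκ : κ ≤ 0) {X : Type*} [MetricSpace X]
    (PC : PolyComplex2 κ X) (hX : IsCATSpace κ X)
    (E : Set X) (hEclosed : IsClosed E) (hErc : RectConnected E) (hH1 : H1Trivial ↥E)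
    (γT : SCC X) (p q r : X) (hT : IsYTriangle E γT.img p q r) :
    ∃ ε₀ > 0, ∀ ε, 0 < ε → ε ≤ ε₀ →
      ∃ Rq Rr : ℝ → X, IsLimitSegment E p q ε Rq ∧ IsLimitSegment E p r ε Rr ∧
        (∃ q' ∈ geodSeg (pathDistIn E) E q r,
          Rq '' Set.Icc 0 ε ⊆ geodSeg (xDist X) Set.univ p q' ∧
          geodSeg (xDist X) Set.univ p q' ⊆ γT.img ∪ γT.interiorSet) ∧
        (∃ r' ∈ geodSeg (pathDistIn E) E q r,
          Rr '' Set.Icc 0 ε ⊆ geodSeg (xDist X) Set.univ p r' ∧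
          geodSeg (xDist X) Set.univ p r' ⊆ γT.img ∪ γT.interiorSet) := by
  have : CAT0Space X := hX.cat0Space hκ
  exact LocallyPlanar.limit_segments (PC.locallyPlanar hκ) hErc hH1 γT p q r hT
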